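/- Let p be a prime, ℓ > 1 an integer, and G a finite p-group that is non-cyclic and not isomorphic to any generalized quaternion group. Then there exists δ > 0 such that for every ε > 0 there is a constant C > 0 with |Cl_F[ℓ]| ≤ C · Disc(F)^{1/2 − δ + ε} for every Galois number field F over ℚ with Gal(F/ℚ) ≅ G. -/

import Mathlib

open NumberField

/-- The number of `ℓ`-torsion elements in the class group of a number field `F`. -/
noncomputable def ellTorsion (F : Type*) [Field F] [NumberField F] (ℓ : ℕ) : ℕ :=
  Nat.card {x : ClassGroup (𝓞 F) // x ^ ℓ = 1}

set_option linter.unusedSectionVars false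

/-- The tent function of width `1 / 4` around `1`. -/
noncomputable def tent {ι : Type} [Fintype ι] (x : ι → ℂ) : ℝ := max 0 (1 - 4 * ‖x - 1‖)

section Lattice

variable {ι : Type} [Fintype ι]

lemma tent_nonneg (x : ι → ℂ) : 0 ≤ tent x := le_max_left _ _

lemma tent_le_one (x : ι → ℂ) : tent x ≤ 1 := by
  unfold tent
  have := norm_nonneg (x - 1)
  exact max_le (by norm_num) (by linarith)

lemma tent_lipschitz (x y : ι → ℂ) : |tent x - tent y| ≤ 4 * ‖x - y‖ := by
  unfold tent
  rw [max_comm 0, max_comm 0]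
  refine (abs_max_sub_max_le_abs _ _ _).trans ?_
  have h := abs_norm_sub_norm_le (x - 1) (y - 1)
  rw [show x - 1 - (y - 1) = x - y by ring] at h
  rw [show 1 - 4 * ‖x - 1‖ - (1 - 4 * ‖y - 1‖) = -4 * (‖x - 1‖ - ‖y - 1‖) by ring, abs_mul]
  norm_num
  exact h

lemma norm_sub_one_lt_of_tent_ne_zero {x : ι → ℂ} (h : tent x ≠ 0) : ‖x - 1‖ < 1 / 4 := by
  unfold tent at h
  by_contra! h'
  exact h (max_eq_left (by linarith))

lemma half_le_tent {x : ι → ℂ} (h : ‖x - 1‖ ≤ 1 / 8) : 1 / 2 ≤ tent x :=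
  le_max_of_le_right (by linarith)

lemma tent_one : tent (1 : ι → ℂ) = 1 := by simp [tent]

/-- The number of elements of a subgroup in the closed ball of radius `R`. -/
noncomputable def ballCount (Λ : AddSubgroup (ι → ℂ)) (R : ℝ) : ℕ :=
  {x : Λ | ‖(x : ι → ℂ)‖ ≤ R}.ncard

/-- A subgroup with finitely many elements in every ball. -/
def LocallyFin (Λ : AddSubgroup (ι → ℂ)) : Prop := ∀ R : ℝ, {x : Λ | ‖(x : ι → ℂ)‖ ≤ R}.Finite

lemma ballCount_pos {Λ : AddSubgroup (ι → ℂ)} (hΛ : LocallyFin Λ) {R : ℝ} (hR : 0 ≤ R) :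
    0 < ballCount Λ R :=
  (Set.ncard_pos (hΛ R)).2 ⟨0, by simpa using hR⟩

lemma ballCount_doubling {r R : ℝ} (hr : 0 < r) :
    ∃ C : ℝ, 0 < C ∧ ∀ Λ : AddSubgroup (ι → ℂ), LocallyFin Λ →
      (ballCount Λ R : ℝ) ≤ C * ballCount Λ r := by
  classical
  obtain ⟨M, hM⟩ := exists_nat_gt (|R| * (2 / r) + 1)
  let B : Finset (ι → ℤ × ℤ) :=
    Fintype.piFinset fun _ => Finset.Icc (-(M : ℤ)) M ×ˢ Finset.Icc (-(M : ℤ)) M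
  refine ⟨B.card + 1, by positivity, fun Λ hΛ => ?_⟩
  let f : Λ → (ι → ℤ × ℤ) := fun x i =>
    (⌊((x : ι → ℂ) i).re * (2 / r)⌋, ⌊((x : ι → ℂ) i).im * (2 / r)⌋)
  have hk : 0 < 2 / r := by positivity
  have hbd : ∀ t : ℝ, |t| ≤ R → ⌊t * (2 / r)⌋ ∈ Finset.Icc (-(M : ℤ)) M := by
    intro t ht
    have h1 : |t * (2 / r)| ≤ |R| * (2 / r) := by
      rw [abs_mul, abs_of_pos hk]; exact mul_le_mul_of_nonneg_right (ht.trans (le_abs_self R)) hk.le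
    rw [abs_le] at h1
    rw [Finset.mem_Icc]
    constructor
    · rw [Int.le_floor]; push_cast; linarith
    · have := Int.floor_le (t * (2 / r))
      exact_mod_cast (this.trans (h1.2.trans (by linarith)) : (⌊t * (2 / r)⌋ : ℝ) ≤ M)
  have hmaps : ∀ x ∈ (hΛ R).toFinset, f x ∈ B := by
    intro x hx
    simp only [Set.Finite.mem_toFinset, Set.mem_ofPred_eq] at hx
    simp only [B, Fintype.mem_piFinset, Finset.mem_product]
    intro i
    have hi : ‖(x : ι → ℂ) i‖ ≤ R := (norm_le_pi_norm _ i).trans hx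
    exact ⟨hbd _ ((Complex.abs_re_le_norm _).trans hi), hbd _ ((Complex.abs_im_le_norm _).trans hi)⟩
  have hfl : ∀ a b : ℝ, ⌊a * (2 / r)⌋ = ⌊b * (2 / r)⌋ → |a - b| ≤ r / 2 := by
    intro a b h
    have := Int.abs_sub_lt_one_of_floor_eq_floor h
    rw [← sub_mul, abs_mul, abs_of_pos hk] at this
    have h2 := this.le
    rw [← le_div_iff₀ hk] at h2
    simpa using h2
  have hfib : ∀ b ∈ B, ((hΛ R).toFinset.filter fun x => f x = b).card ≤ ballCount Λ r := by
    intro b _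
    rcases ((hΛ R).toFinset.filter fun x => f x = b).eq_empty_or_nonempty with h0 | ⟨x0, hx0⟩
    · rw [h0]; simp
    · rw [ballCount, Set.ncard_eq_toFinset_card _ (hΛ r)]
      apply Finset.card_le_card_of_injOn (fun x => x - x0)
      · intro x hx
        simp only [Finset.coe_filter, Finset.mem_filter, Set.mem_ofPred_eq] at hx hx0
        simp only [Set.Finite.coe_toFinset, Set.mem_ofPred_eq]
        rw [pi_norm_le_iff_of_nonneg hr.le]
        intro i
        have h := congrFun (hx.2.trans hx0.2.symm) i
        simp only [f, Prod.mk.injEq] at h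
        refine (Complex.norm_le_abs_re_add_abs_im _).trans ?_
        have h1 := hfl _ _ h.1
        have h2 := hfl _ _ h.2
        simp only [AddSubgroup.coe_sub, Pi.sub_apply, Complex.sub_re, Complex.sub_im]
        linarith
      · intro x _ y _ h
        simpa using h
  have := Finset.card_le_mul_card_image_of_maps_to hmaps _ hfib
  rw [ballCount, Set.ncard_eq_toFinset_card _ (hΛ R)]
  calc ((hΛ R).toFinset.card : ℝ) ≤ ballCount Λ r * B.card := by exact_mod_cast this
    _ ≤ (B.card + 1) * ballCount Λ r := by
      have : (0 : ℝ) ≤ ballCount Λ r := by positivity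
      nlinarith

/-- The coordinates of `x` have absolute value close to `1`. -/
def NearOne (x : ι → ℂ) : Prop := ∀ i, 3 / 4 ≤ ‖x i‖ ∧ ‖x i‖ ≤ 7 / 5

lemma NearOne.norm_inv_sub_inv_le {x y : ι → ℂ} (hx : NearOne x) (hy : NearOne y) {δ : ℝ}
    (h : ‖x - y‖ ≤ δ) : ‖x⁻¹ - y⁻¹‖ ≤ 2 * δ := by
  have hδ : 0 ≤ δ := (norm_nonneg _).trans h
  rw [pi_norm_le_iff_of_nonneg (by positivity)]
  intro i
  have h1 := (hx i).1
  have h2 := (hy i).1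
  have hx0 : x i ≠ 0 := fun h => by rw [h, norm_zero] at h1; norm_num at h1
  have hy0 : y i ≠ 0 := fun h => by rw [h, norm_zero] at h2; norm_num at h2
  have h3 : ‖y i - x i‖ ≤ δ := by
    rw [norm_sub_rev]; exact (norm_le_pi_norm (x - y) i).trans h
  rw [Pi.sub_apply, Pi.inv_apply, Pi.inv_apply, inv_sub_inv hx0 hy0, norm_div, norm_mul,
    div_le_iff₀ (by positivity)]
  nlinarith [mul_le_mul h1 h2 (by norm_num) (by linarith)]

lemma norm_bounds_of_tent_inv_ne_zero {x : ι → ℂ} (h : tent x⁻¹ ≠ 0) (i : ι) :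
    4 / 5 ≤ ‖x i‖ ∧ ‖x i‖ ≤ 4 / 3 := by
  have h1 : ‖(x i)⁻¹ - 1‖ < 1 / 4 :=
    (norm_le_pi_norm (x⁻¹ - 1) i).trans_lt (norm_sub_one_lt_of_tent_ne_zero h)
  have h2 := abs_norm_sub_norm_le (x i)⁻¹ 1
  rw [norm_one, norm_inv, abs_le] at h2
  have h3 : 0 < ‖x i‖⁻¹ := by linarith [h2.1]
  have h4 : 0 < ‖x i‖ := inv_pos.1 h3
  have h5 : ‖x i‖⁻¹ * ‖x i‖ = 1 := inv_mul_cancel₀ h4.ne'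
  constructor <;> nlinarith [h2.1, h2.2]

/-- The sum of the tent function over a dilated lattice. -/
noncomputable def tentSum (Λ : AddSubgroup (ι → ℂ)) (x : ι → ℂ) : ℝ :=
  ∑' y : Λ, tent ((y : ι → ℂ) * x⁻¹)

lemma norm_le_two_of_tent_ne_zero {x y : ι → ℂ} (hx : NearOne x) (h : tent (y * x⁻¹) ≠ 0) :
    ‖y‖ ≤ 2 := by
  rw [pi_norm_le_iff_of_nonneg (by norm_num)]
  intro i
  have h1 : ‖y i * (x i)⁻¹ - 1‖ < 1 / 4 :=
    (norm_le_pi_norm (y * x⁻¹ - 1) i).trans_lt (norm_sub_one_lt_of_tent_ne_zero h)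
  have h2 := abs_norm_sub_norm_le (y i * (x i)⁻¹) 1
  rw [norm_one, norm_mul, norm_inv, abs_le] at h2
  have h4 : 0 < ‖x i‖ := by linarith [(hx i).1]
  have h5 : ‖y i‖ * ‖x i‖⁻¹ * ‖x i‖ = ‖y i‖ := by field_simp
  have h6 : ‖y i‖ * ‖x i‖⁻¹ ≤ 5 / 4 := by linarith [h2.2]
  rw [← h5]
  nlinarith [(hx i).2]

lemma tentSum_eq_sum {Λ : AddSubgroup (ι → ℂ)} (hΛ : LocallyFin Λ) {x : ι → ℂ} (hx : NearOne x) :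
    tentSum Λ x = ∑ y ∈ (hΛ 2).toFinset, tent ((y : ι → ℂ) * x⁻¹) := by
  unfold tentSum
  refine tsum_eq_sum fun y hy => ?_
  by_contra h
  exact hy (by simpa using norm_le_two_of_tent_ne_zero hx h)

lemma half_ballCount_le_tentSum {Λ : AddSubgroup (ι → ℂ)} (hΛ : LocallyFin Λ) {x : Λ}
    (hx : NearOne (x : ι → ℂ)) : (ballCount Λ (1 / 12) : ℝ) / 2 ≤ tentSum Λ x := by
  classical
  have hx0 : ∀ i, (x : ι → ℂ) i ≠ 0 := fun i h => by
    have := (hx i).1; rw [h, norm_zero] at this; norm_num at this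
  have key : ∀ v ∈ (hΛ (1 / 12)).toFinset,
      ‖((v + x : Λ) : ι → ℂ) * (x : ι → ℂ)⁻¹ - 1‖ ≤ 1 / 8 := by
    intro v hv
    simp only [Set.Finite.mem_toFinset, Set.mem_ofPred_eq] at hv
    rw [pi_norm_le_iff_of_nonneg (by norm_num)]
    intro i
    have h1 := (hx i).1
    have h2 := (norm_le_pi_norm (v : ι → ℂ) i).trans hv
    have : (((v + x : Λ) : ι → ℂ) * (x : ι → ℂ)⁻¹ - 1) i
        = (v : ι → ℂ) i / (x : ι → ℂ) i := by
      simp [add_mul, hx0 i, div_eq_mul_inv]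
    rw [this, norm_div, div_le_iff₀ (by linarith)]
    nlinarith
  rw [tentSum_eq_sum hΛ hx]
  have hsub : (hΛ (1 / 12)).toFinset.map (addRightEmbedding x) ⊆ (hΛ 2).toFinset := by
    intro y hy
    rw [Finset.mem_map] at hy
    obtain ⟨v, hv, rfl⟩ := hy
    have h := half_le_tent (key v hv)
    have h2 := norm_le_two_of_tent_ne_zero hx (fun h0 => by rw [h0] at h; norm_num at h)
    simpa using h2
  refine le_trans ?_ (Finset.sum_le_sum_of_subset_of_nonneg hsub fun _ _ _ => tent_nonneg _)
  rw [Finset.sum_map, ballCount, Set.ncard_eq_toFinset_card _ (hΛ _), div_eq_mul_one_div,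
    ← nsmul_eq_mul]
  exact Finset.card_nsmul_le_sum _ _ _ fun v hv => half_le_tent (key v hv)

lemma abs_tentSum_sub_le {Λ : AddSubgroup (ι → ℂ)} (hΛ : LocallyFin Λ) {x y : ι → ℂ}
    (hx : NearOne x) (hy : NearOne y) {δ : ℝ} (h : ‖x - y‖ ≤ δ) :
    |tentSum Λ x - tentSum Λ y| ≤ 16 * δ * ballCount Λ 2 := by
  rw [tentSum_eq_sum hΛ hx, tentSum_eq_sum hΛ hy, ← Finset.sum_sub_distrib]
  refine (Finset.abs_sum_le_sum_abs _ _).trans ?_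
  rw [ballCount, Set.ncard_eq_toFinset_card _ (hΛ _), mul_comm, ← nsmul_eq_mul]
  refine Finset.sum_le_card_nsmul _ _ _ fun v hv => ?_
  simp only [Set.Finite.mem_toFinset, Set.mem_ofPred_eq] at hv
  refine (tent_lipschitz _ _).trans ?_
  rw [← mul_sub]
  have h1 := norm_mul_le (v : ι → ℂ) (x⁻¹ - y⁻¹)
  have h2 := hx.norm_inv_sub_inv_le hy h
  nlinarith [norm_nonneg (x⁻¹ - y⁻¹)]

/-- The weight attached to a lattice point. -/
noncomputable def weight (Λ : AddSubgroup (ι → ℂ)) (s : ℂ) (x : ι → ℂ) : ℂ :=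
  ((∏ i, ‖x i‖ : ℝ) : ℂ) ^ (-s) * ((tent x⁻¹ / tentSum Λ x : ℝ) : ℂ)

lemma NearOne.prod_pos {x : ι → ℂ} (hx : NearOne x) : 0 < ∏ i, ‖x i‖ :=
  Finset.prod_pos fun i _ => by linarith [(hx i).1]

lemma NearOne.abs_log_prod_le {x : ι → ℂ} (hx : NearOne x) :
    |Real.log (∏ i, ‖x i‖)| ≤ Fintype.card ι := by
  rw [Real.log_prod fun i _ => by linarith [(hx i).1]]
  refine (Finset.abs_sum_le_sum_abs _ _).trans ?_
  rw [Fintype.card, ← nsmul_one]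
  refine Finset.sum_le_card_nsmul _ _ _ fun i _ => ?_
  have h0 : 0 < ‖x i‖ := by linarith [(hx i).1]
  have h1 := Real.log_le_sub_one_of_pos h0
  have h2 := Real.one_sub_inv_le_log_of_pos h0
  have h3 : ‖x i‖⁻¹ ≤ 2 := by
    rw [inv_le_comm₀ h0 (by norm_num)]; linarith [(hx i).1]
  rw [abs_le]
  constructor <;> linarith [(hx i).2]

lemma NearOne.abs_log_prod_sub_le {x y : ι → ℂ} (hx : NearOne x) (hy : NearOne y) {δ : ℝ}
    (h : ‖x - y‖ ≤ δ) :
    |Real.log (∏ i, ‖x i‖) - Real.log (∏ i, ‖y i‖)| ≤ Fintype.card ι * (2 * δ) := by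
  have hδ : 0 ≤ δ := (norm_nonneg _).trans h
  rw [Real.log_prod fun i _ => by linarith [(hx i).1],
    Real.log_prod fun i _ => by linarith [(hy i).1], ← Finset.sum_sub_distrib]
  refine (Finset.abs_sum_le_sum_abs _ _).trans ?_
  rw [Fintype.card, ← nsmul_eq_mul]
  refine Finset.sum_le_card_nsmul _ _ _ fun i _ => ?_
  have hlog : ∀ a b : ℝ, 3 / 4 ≤ a → 3 / 4 ≤ b → |a - b| ≤ δ → Real.log a - Real.log b ≤ 2 * δ := by
    intro a b ha hb hab
    rw [← Real.log_div (by linarith) (by linarith)]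
    refine (Real.log_le_sub_one_of_pos (by positivity)).trans ?_
    rw [div_sub_one (by linarith), div_le_iff₀ (by linarith)]
    nlinarith [le_abs_self (a - b)]
  have h3 : |‖x i‖ - ‖y i‖| ≤ δ :=
    (abs_norm_sub_norm_le _ _).trans ((norm_le_pi_norm (x - y) i).trans h)
  rw [abs_le]
  constructor
  · linarith [hlog _ _ (hy i).1 (hx i).1 (by rwa [abs_sub_comm])]
  · exact hlog _ _ (hx i).1 (hy i).1 h3

lemma ofReal_cpow_neg_eq_exp {u : ℝ} (hu : 0 < u) (s : ℂ) :
    (u : ℂ) ^ (-s) = Complex.exp (-s * (Real.log u : ℝ)) := by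
  rw [Complex.cpow_def_of_ne_zero (by exact_mod_cast hu.ne'), Complex.ofReal_log hu.le, mul_comm]

lemma re_neg_mul_log_le {s : ℂ} (h0 : 0 ≤ s.re) (h4 : s.re ≤ 4) {t n : ℝ} (ht : |t| ≤ n) :
    (-s * (t : ℂ)).re ≤ 4 * n := by
  have : (-s * (t : ℂ)).re = -(s.re * t) := by simp
  rw [this]
  have := abs_nonneg t
  nlinarith [neg_abs_le t]

lemma norm_exp_sub_exp_le {a b : ℂ} {M : ℝ} (ha : a.re ≤ M) (hb : b.re ≤ M) :
    ‖Complex.exp a - Complex.exp b‖ ≤ Real.exp M * ‖a - b‖ := by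
  have := (convex_halfSpace_re_le M).norm_image_sub_le_of_norm_deriv_le
    (f := Complex.exp) (C := Real.exp M) (fun x _ => Complex.differentiableAt_exp)
    (fun x hx => by
      rw [Complex.deriv_exp, Complex.norm_exp]
      exact Real.exp_le_exp.2 hx) hb ha
  exact this

lemma weight_eq_zero {Λ : AddSubgroup (ι → ℂ)} {s : ℂ} {x : ι → ℂ} (h : tent x⁻¹ = 0) :
    weight Λ s x = 0 := by simp [weight, h]

lemma nearOne_of_tent_inv_ne_zero {x : ι → ℂ} (h : tent x⁻¹ ≠ 0) : NearOne x := fun i => by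
  have := norm_bounds_of_tent_inv_ne_zero h i
  constructor <;> linarith

lemma NearOne.norm_cpow_le {x : ι → ℂ} (hx : NearOne x) {s : ℂ} (h0 : 0 ≤ s.re) (h4 : s.re ≤ 4) :
    ‖((∏ i, ‖x i‖ : ℝ) : ℂ) ^ (-s)‖ ≤ Real.exp (4 * Fintype.card ι) := by
  rw [ofReal_cpow_neg_eq_exp hx.prod_pos, Complex.norm_exp]
  exact Real.exp_le_exp.2 (re_neg_mul_log_le h0 h4 hx.abs_log_prod_le)

lemma tentSum_pos {Λ : AddSubgroup (ι → ℂ)} (hΛ : LocallyFin Λ) {x : Λ}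
    (hx : NearOne (x : ι → ℂ)) : 0 < tentSum Λ x := by
  refine lt_of_lt_of_le ?_ (half_ballCount_le_tentSum hΛ hx)
  have : (0 : ℝ) < ballCount Λ (1 / 12) := by exact_mod_cast ballCount_pos hΛ (by norm_num)
  positivity

lemma inv_tentSum_le {Λ : AddSubgroup (ι → ℂ)} (hΛ : LocallyFin Λ) {x : Λ}
    (hx : NearOne (x : ι → ℂ)) : (tentSum Λ x)⁻¹ ≤ 2 / ballCount Λ (1 / 12) := by
  have h1 : (0 : ℝ) < ballCount Λ (1 / 12) := by exact_mod_cast ballCount_pos hΛ (by norm_num)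
  rw [← inv_div]
  exact inv_anti₀ (by positivity) (half_ballCount_le_tentSum hΛ hx)

lemma norm_weight_le {Λ : AddSubgroup (ι → ℂ)} (hΛ : LocallyFin Λ) {s : ℂ} (h0 : 0 ≤ s.re)
    (h4 : s.re ≤ 4) (x : Λ) :
    ‖weight Λ s x‖ ≤ 2 * Real.exp (4 * Fintype.card ι) / ballCount Λ (1 / 12) := by
  by_cases h : tent (x : ι → ℂ)⁻¹ = 0
  · rw [weight_eq_zero h, norm_zero]; positivity
  · have hx := nearOne_of_tent_inv_ne_zero h
    have := tentSum_pos hΛ hx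
    rw [weight, norm_mul, Complex.norm_real, Real.norm_of_nonneg
      (div_nonneg (tent_nonneg _) this.le), div_eq_mul_inv, mul_comm 2, mul_div_assoc]
    refine mul_le_mul (hx.norm_cpow_le h0 h4) ?_ (by have := tent_nonneg (x : ι → ℂ)⁻¹; positivity)
      (by positivity)
    have h1 := inv_tentSum_le hΛ hx
    have h2 := tent_le_one (x : ι → ℂ)⁻¹
    have h3 : 0 < (tentSum Λ x)⁻¹ := by positivity
    nlinarith

lemma NearOne.norm_cpow_sub_le {x y : ι → ℂ} (hx : NearOne x) (hy : NearOne y) {s : ℂ}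
    (h0 : 0 ≤ s.re) (h4 : s.re ≤ 4) {δ : ℝ} (h : ‖x - y‖ ≤ δ) :
    ‖((∏ i, ‖x i‖ : ℝ) : ℂ) ^ (-s) - ((∏ i, ‖y i‖ : ℝ) : ℂ) ^ (-s)‖ ≤
      Real.exp (4 * Fintype.card ι) * (‖s‖ * (Fintype.card ι * (2 * δ))) := by
  rw [ofReal_cpow_neg_eq_exp hx.prod_pos, ofReal_cpow_neg_eq_exp hy.prod_pos]
  refine (norm_exp_sub_exp_le (re_neg_mul_log_le h0 h4 hx.abs_log_prod_le)
    (re_neg_mul_log_le h0 h4 hy.abs_log_prod_le)).trans ?_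
  rw [← mul_sub, norm_mul, norm_neg, ← Complex.ofReal_sub, Complex.norm_real, Real.norm_eq_abs]
  gcongr
  exact hx.abs_log_prod_sub_le hy h

lemma exists_weight_lipschitz (ι : Type) [Fintype ι] : ∃ C : ℝ, 0 < C ∧
    ∀ Λ : AddSubgroup (ι → ℂ), LocallyFin Λ → ∀ s : ℂ, 0 ≤ s.re → s.re ≤ 4 →
      ∀ (x y : Λ) (δ : ℝ), ‖(x : ι → ℂ) - y‖ ≤ δ → tent (x : ι → ℂ)⁻¹ ≠ 0 →
        ‖weight Λ s x - weight Λ s y‖ ≤ C * (1 + ‖s‖) * δ / ballCount Λ (1 / 12) := by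
  obtain ⟨C2, hC2, hdb⟩ := ballCount_doubling (ι := ι) (r := 1 / 12) (R := 2) (by norm_num)
  set E := Real.exp (4 * Fintype.card ι) with hE
  have hEpos : 0 < E := Real.exp_pos _
  set n : ℝ := (Fintype.card ι : ℝ) with hn
  have hn0 : 0 ≤ n := by positivity
  refine ⟨E * (80 + 4 * n + 16 + 64 * C2), by positivity, ?_⟩
  intro Λ hΛ s h0 h4 x y δ hδ hx
  have hδ0 : 0 ≤ δ := (norm_nonneg _).trans hδ
  set D : ℝ := (ballCount Λ (1 / 12) : ℝ) with hD
  have hDpos : 0 < D := by rw [hD]; exact_mod_cast ballCount_pos hΛ (by norm_num)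
  have hs := norm_nonneg s
  rw [le_div_iff₀ hDpos]
  by_cases hbig : 1 / 20 ≤ δ
  · have h1 := norm_weight_le hΛ h0 h4 x
    have h2 := norm_weight_le hΛ h0 h4 y
    rw [← hD, le_div_iff₀ hDpos] at h1 h2
    have h3 := norm_sub_le (weight Λ s x) (weight Λ s y)
    have h5 : ‖weight Λ s x - weight Λ s y‖ * D ≤ 4 * E := by nlinarith
    have h6 : 4 * E ≤ E * 80 * 1 * δ := by nlinarith
    refine h5.trans (h6.trans ?_)
    gcongr
    · linarith [mul_nonneg hn0 hn0]
    · linarith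
  push Not at hbig
  have hx1 := nearOne_of_tent_inv_ne_zero hx
  have hy1 : NearOne (y : ι → ℂ) := fun i => by
    have h1 := norm_bounds_of_tent_inv_ne_zero hx i
    have h2 := (abs_norm_sub_norm_le ((x : ι → ℂ) i) ((y : ι → ℂ) i)).trans
      ((norm_le_pi_norm ((x : ι → ℂ) - (y : ι → ℂ)) i).trans hδ)
    rw [abs_le] at h2
    constructor <;> linarith [h2.1, h2.2]
  have hdx := half_ballCount_le_tentSum hΛ hx1
  have hdy := half_ballCount_le_tentSum hΛ hy1
  rw [← hD] at hdx hdy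
  have hd := (abs_tentSum_sub_le hΛ hx1 hy1 hδ).trans
    (mul_le_mul_of_nonneg_left (hdb Λ hΛ) (by positivity))
  rw [← hD] at hd
  have hA := hx1.norm_cpow_sub_le hy1 h0 h4 hδ
  have hA' := hy1.norm_cpow_le h0 h4
  rw [← hE] at hA hA'
  have hB := (tent_lipschitz (x : ι → ℂ)⁻¹ (y : ι → ℂ)⁻¹).trans
    (mul_le_mul_of_nonneg_left (hx1.norm_inv_sub_inv_le hy1 hδ) (by norm_num))
  unfold weight
  generalize (((∏ i, ‖(x : ι → ℂ) i‖ : ℝ) : ℂ) ^ (-s)) = A at *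
  generalize (((∏ i, ‖(y : ι → ℂ) i‖ : ℝ) : ℂ) ^ (-s)) = A' at *
  have hB1 := tent_le_one (x : ι → ℂ)⁻¹
  have hB0 := tent_nonneg (x : ι → ℂ)⁻¹
  generalize tent (x : ι → ℂ)⁻¹ = B at *
  generalize tent (y : ι → ℂ)⁻¹ = B' at *
  generalize tentSum Λ x = d at *
  generalize tentSum Λ y = d' at *
  have hd0 : 0 < d := by linarith
  have hd0' : 0 < d' := by linarith
  have key : |B / d - B' / d'| * D ≤ (16 + 64 * C2) * δ := by
    have e : B / d - B' / d' = (B - B') / d' + B * (d' - d) / (d * d') := by field_simp; ring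
    have e1 : |(B - B') / d'| * D ≤ 16 * δ := by
      rw [abs_div, abs_of_pos hd0', div_mul_eq_mul_div, div_le_iff₀ hd0']
      nlinarith [mul_nonneg hδ0 hd0'.le, abs_nonneg (B - B')]
    have e2 : |B * (d' - d) / (d * d')| * D ≤ 64 * C2 * δ := by
      rw [abs_div, abs_mul, abs_of_nonneg hB0, abs_of_pos (mul_pos hd0 hd0'),
        div_mul_eq_mul_div, div_le_iff₀ (mul_pos hd0 hd0'), abs_sub_comm]
      have f1 : B * |d - d'| ≤ 16 * δ * (C2 * D) := by nlinarith [abs_nonneg (d - d')]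
      have f2 : D * D ≤ 4 * (d * d') := by nlinarith
      have f3 : 0 ≤ 16 * δ * C2 := by positivity
      calc B * |d - d'| * D ≤ 16 * δ * (C2 * D) * D := by gcongr
        _ = 16 * δ * C2 * (D * D) := by ring
        _ ≤ 16 * δ * C2 * (4 * (d * d')) := by gcongr
        _ = _ := by ring
    rw [e]
    have := abs_add_le ((B - B') / d') (B * (d' - d) / (d * d'))
    nlinarith
  have hBd : |B / d| * D ≤ 2 := by
    rw [abs_div, abs_of_nonneg hB0, abs_of_pos hd0, div_mul_eq_mul_div, div_le_iff₀ hd0]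
    nlinarith
  have e : A * ((B / d : ℝ) : ℂ) - A' * ((B' / d' : ℝ) : ℂ)
      = (A - A') * ((B / d : ℝ) : ℂ) + A' * ((B / d - B' / d' : ℝ) : ℂ) := by push_cast; ring
  rw [e]
  have n1 := norm_add_le ((A - A') * ((B / d : ℝ) : ℂ)) (A' * ((B / d - B' / d' : ℝ) : ℂ))
  rw [norm_mul, norm_mul, Complex.norm_real, Complex.norm_real, Real.norm_eq_abs,
    Real.norm_eq_abs] at n1
  calc _ ≤ (‖A - A'‖ * |B / d| + ‖A'‖ * |B / d - B' / d'|) * D := by gcongr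
    _ = ‖A - A'‖ * (|B / d| * D) + ‖A'‖ * (|B / d - B' / d'| * D) := by ring
    _ ≤ E * (‖s‖ * (n * (2 * δ))) * 2 + E * ((16 + 64 * C2) * δ) := by gcongr
    _ = E * (4 * n * ‖s‖ + (16 + 64 * C2) * 1) * δ := by ring
    _ ≤ E * ((80 + 4 * n) * (1 + ‖s‖) + (16 + 64 * C2) * (1 + ‖s‖)) * δ := by
      gcongr <;> linarith
    _ = _ := by ring

lemma norm_le_of_tent_inv_ne_zero {x : ι → ℂ} (h : tent x⁻¹ ≠ 0) : ‖x‖ ≤ 4 / 3 := by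
  rw [pi_norm_le_iff_of_nonneg (by norm_num)]
  exact fun i => (norm_bounds_of_tent_inv_ne_zero h i).2

lemma weight_support_finite {Λ : AddSubgroup (ι → ℂ)} (hΛ : LocallyFin Λ) (s : ℂ) :
    (Function.support fun x : Λ => weight Λ s x).Finite := by
  refine (hΛ (4 / 3)).subset fun x hx => ?_
  exact norm_le_of_tent_inv_ne_zero fun h => hx (weight_eq_zero h)

/-- Cancellation between the weights of a lattice and of twice the lattice. -/
lemma exists_norm_weight_sum_sub_le (ι : Type) [Fintype ι] : ∃ C : ℝ, 0 < C ∧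
    ∀ Λ : AddSubgroup (ι → ℂ), LocallyFin Λ → ∀ (κ : Type) [Fintype κ] (r : κ → Λ) (δ : ℝ),
      (∀ k, ‖(r k : ι → ℂ)‖ ≤ δ) →
      Function.Bijective (fun p : κ × Λ => r p.1 + p.2 + p.2) →
      ∀ s : ℂ, 0 ≤ s.re → s.re ≤ 4 →
        ‖∑' x : Λ, weight Λ s x - Fintype.card κ * ∑' x : Λ, weight Λ s (x + x : Λ)‖ ≤
          C * Fintype.card κ * (1 + ‖s‖) * δ := by
  classical
  obtain ⟨C1, hC1, hlip⟩ := exists_weight_lipschitz ι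
  obtain ⟨C2, hC2, hdb⟩ := ballCount_doubling (ι := ι) (r := 1 / 12) (R := 4 / 3) (by norm_num)
  refine ⟨C1 * (2 * C2), by positivity, ?_⟩
  intro Λ hΛ κ _ r δ hr hbij s h0 h4
  rcases isEmpty_or_nonempty κ with hκ | ⟨⟨k0⟩⟩
  · obtain ⟨p, -⟩ := hbij.2 0
    exact (hκ.false p.1).elim
  have hδ0 : 0 ≤ δ := (norm_nonneg _).trans (hr k0)
  set D : ℝ := (ballCount Λ (1 / 12) : ℝ) with hD
  have hDpos : 0 < D := by rw [hD]; exact_mod_cast ballCount_pos hΛ (by norm_num)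
  let w : Λ → ℂ := fun x => weight Λ s x
  have hw : (Function.support w).Finite := weight_support_finite hΛ s
  have hinj : ∀ k, Function.Injective (fun u : Λ => r k + u + u) := fun k a b h => by
    have := @hbij.1 (k, a) (k, b) h
    exact (Prod.ext_iff.1 this).2
  have hfin : ∀ k, (Function.support fun u : Λ => w (r k + u + u)).Finite := fun k =>
    hw.preimage ((hinj k).injOn)
  have hinj0 : Function.Injective (fun u : Λ => u + u) := fun a b h => hinj k0 (by
    simpa [add_assoc] using h)
  have hfin0 : (Function.support fun u : Λ => w (u + u)).Finite := hw.preimage hinj0.injOn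
  have hsum : ∑' x : Λ, w x = ∑ k, ∑' u : Λ, w (r k + u + u) := by
    rw [← (Equiv.ofBijective _ hbij).tsum_eq w, Summable.tsum_prod' ?_ ?_]
    · rw [tsum_fintype]; rfl
    · exact ((Equiv.ofBijective _ hbij).summable_iff (f := w)).2 (summable_of_hasFiniteSupport hw)
    · exact fun k => summable_of_hasFiniteSupport (hfin k)
  have hdiff : ∑' x : Λ, w x - Fintype.card κ * ∑' x : Λ, w (x + x)
      = ∑ k, ∑' u : Λ, (w (r k + u + u) - w (u + u)) := by
    have hk : ∀ k, ∑' u : Λ, (w (r k + u + u) - w (u + u))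
        = ∑' u : Λ, w (r k + u + u) - ∑' u : Λ, w (u + u) := fun k =>
      Summable.tsum_sub (summable_of_hasFiniteSupport (hfin k))
        (summable_of_hasFiniteSupport hfin0)
    rw [hsum, Finset.sum_congr rfl fun k _ => hk k, Finset.sum_sub_distrib]
    simp
  have hball : ∀ x : Λ, w x ≠ 0 → x ∈ (hΛ (4 / 3)).toFinset := fun x hx => by
    simpa using norm_le_of_tent_inv_ne_zero fun h => hx (weight_eq_zero h)
  set B := (hΛ (4 / 3)).toFinset with hB
  have hBcard : (B.card : ℝ) ≤ C2 * D := by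
    rw [hB, ← Set.ncard_eq_toFinset_card _ (hΛ _)]; exact hdb Λ hΛ
  set M := C1 * (1 + ‖s‖) * δ / D with hM
  have hM0 : 0 ≤ M := by have := norm_nonneg s; positivity
  have hone : ∀ k, ‖∑' u : Λ, (w (r k + u + u) - w (u + u))‖ ≤ 2 * (C2 * D) * M := by
    intro k
    let T : Finset Λ := B.preimage (fun u => r k + u + u) (hinj k).injOn ∪
      B.preimage (fun u => u + u) hinj0.injOn
    have hT : (T.card : ℝ) ≤ 2 * (C2 * D) := by
      have h1 : (B.preimage (fun u => r k + u + u) (hinj k).injOn).card ≤ B.card :=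
        Finset.card_le_card_of_injOn _ (fun u hu => by simpa using hu) (hinj k).injOn
      have h2 : (B.preimage (fun u => u + u) hinj0.injOn).card ≤ B.card :=
        Finset.card_le_card_of_injOn _ (fun u hu => by simpa using hu) hinj0.injOn
      have h3 : (T.card : ℝ) ≤ B.card + B.card := by
        exact_mod_cast (Finset.card_union_le _ _).trans (add_le_add h1 h2)
      linarith
    have hzero : ∀ u ∉ T, w (r k + u + u) - w (u + u) = 0 := by
      intro u hu
      simp only [T, Finset.mem_union, Finset.mem_preimage, not_or] at hu
      have h1 := not_imp_comm.1 (hball _) hu.1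
      have h2 := not_imp_comm.1 (hball _) hu.2
      rw [h1, h2, sub_zero]
    rw [tsum_eq_sum hzero]
    refine (norm_sum_le _ _).trans ?_
    have hterm : ∀ u ∈ T, ‖w (r k + u + u) - w (u + u)‖ ≤ M := by
      intro u _
      have hd : ‖((r k + u + u : Λ) : ι → ℂ) - (u + u : Λ)‖ ≤ δ := by
        have : ((r k + u + u : Λ) : ι → ℂ) - (u + u : Λ) = r k := by
          simp only [AddSubgroup.coe_add]; ring
        rw [this]; exact hr k
      by_cases h1 : tent ((r k + u + u : Λ) : ι → ℂ)⁻¹ = 0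
      · by_cases h2 : tent ((u + u : Λ) : ι → ℂ)⁻¹ = 0
        · simp only [w]; rw [weight_eq_zero h1, weight_eq_zero h2, sub_zero, norm_zero]; exact hM0
        · rw [norm_sub_rev]; exact hlip Λ hΛ s h0 h4 _ _ δ (by rwa [norm_sub_rev]) h2
      · exact hlip Λ hΛ s h0 h4 _ _ δ hd h1
    refine (Finset.sum_le_card_nsmul _ _ _ hterm).trans ?_
    rw [nsmul_eq_mul]
    gcongr
  change ‖∑' x : Λ, w x - Fintype.card κ * ∑' x : Λ, w (x + x)‖ ≤ _
  rw [hdiff]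
  refine (norm_sum_le _ _).trans ?_
  refine (Finset.sum_le_card_nsmul _ _ _ fun k _ => hone k).trans ?_
  rw [nsmul_eq_mul, hM, Finset.card_univ]
  apply le_of_eq
  field_simp

end Lattice

section IdealCount

open scoped nonZeroDivisors

variable {K : Type} [Field K] [NumberField K]

/-- The rational prime below a prime ideal. -/
noncomputable def ratPrime (P : Ideal (𝓞 K)) : ℕ := Ideal.absNorm (P.under ℤ)

lemma ratPrime_prime {P : Ideal (𝓞 K)} (hP : P.IsPrime) (h0 : P ≠ ⊥) : (ratPrime P).Prime :=
  have : NeZero P := ⟨h0⟩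
  Nat.absNorm_under_prime P

lemma ratPrime_mem (P : Ideal (𝓞 K)) : (ratPrime P : 𝓞 K) ∈ P := Int.absNorm_under_mem P

lemma ratPrime_dvd_absNorm (P : Ideal (𝓞 K)) : ratPrime P ∣ Ideal.absNorm P :=
  Int.absNorm_under_dvd_absNorm P

lemma ratPrime_eq_iff {P : Ideal (𝓞 K)} (hP : P.IsPrime) (h0 : P ≠ ⊥) {q : ℕ} (hq : q.Prime) :
    ratPrime P = q ↔ (q : 𝓞 K) ∈ P := by
  constructor
  · rintro rfl; exact ratPrime_mem P
  · intro h
    have h1 : ((q : ℤ) : 𝓞 K) ∈ P := by simpa using h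
    rw [Int.cast_mem_ideal_iff] at h1
    have h2 : ratPrime P ∣ q := by exact_mod_cast h1
    exact (Nat.prime_dvd_prime_iff_eq (ratPrime_prime hP h0) hq).1 h2

lemma card_primes_le {q : ℕ} (hq : q.Prime) (S : Finset (Ideal (𝓞 K)))
    (hS : ∀ P ∈ S, P.IsPrime ∧ P ≠ ⊥ ∧ ratPrime P = q) : S.card ≤ Module.finrank ℚ K := by
  have h1 : ∏ P ∈ S, P ∣ Ideal.span {(q : 𝓞 K)} := by
    refine Finset.prod_primes_dvd _ (fun P hP => ?_) (fun P hP => ?_)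
    · exact Ideal.prime_of_isPrime (hS P hP).2.1 (hS P hP).1
    · rw [Ideal.dvd_span_singleton, ← (hS P hP).2.2]
      exact ratPrime_mem P
  have h2 := map_dvd Ideal.absNorm h1
  have h3 : Ideal.absNorm (Ideal.span {(q : 𝓞 K)}) = q ^ Module.finrank ℚ K := by
    rw [Ideal.absNorm_span_natCast, RingOfIntegers.rank]
  have h4 : q ^ S.card ∣ ∏ P ∈ S, Ideal.absNorm P := by
    rw [← Finset.prod_const]
    exact Finset.prod_dvd_prod_of_dvd _ _ fun P hP => by
      rw [← (hS P hP).2.2]; exact ratPrime_dvd_absNorm P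
  rw [map_prod, h3] at h2
  exact (Nat.pow_dvd_pow_iff_le_right hq.one_lt).1 (h4.trans h2)

lemma exists_label (K : Type) [Field K] [NumberField K] :
    ∃ lab : Ideal (𝓞 K) → Fin (Module.finrank ℚ K), ∀ P Q : Ideal (𝓞 K),
      P.IsPrime → P ≠ ⊥ → Q.IsPrime → Q ≠ ⊥ → ratPrime P = ratPrime Q → lab P = lab Q → P = Q := by
  classical
  let S : ℕ → Set (Ideal (𝓞 K)) := fun q => {P | P.IsPrime ∧ P ≠ ⊥ ∧ ratPrime P = q}
  have hpos : 0 < Module.finrank ℚ K := Module.finrank_pos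
  have key : ∀ q : ℕ, ∃ f : Ideal (𝓞 K) → Fin (Module.finrank ℚ K), Set.InjOn f (S q) := by
    intro q
    by_cases hq : q.Prime
    · have hfin : (S q).Finite := by
        by_contra hinf
        obtain ⟨T, hT, hc⟩ := Set.Infinite.exists_subset_card_eq hinf (Module.finrank ℚ K + 1)
        have := card_primes_le hq T fun P hP => hT hP
        omega
      have hcard := card_primes_le hq hfin.toFinset fun P hP => by
        have : P ∈ S q := by simpa using hP
        exact this
      obtain ⟨e⟩ : Nonempty (hfin.toFinset ↪ Fin (Module.finrank ℚ K)) :=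
        Function.Embedding.nonempty_of_card_le (by simpa using hcard)
      refine ⟨fun P => if h : P ∈ hfin.toFinset then e ⟨P, h⟩ else ⟨0, hpos⟩, ?_⟩
      intro P hP Q hQ h
      have hP' : P ∈ hfin.toFinset := by simpa using hP
      have hQ' : Q ∈ hfin.toFinset := by simpa using hQ
      simp only [hP', hQ', dif_pos] at h
      simpa using e.injective h
    · exact ⟨fun _ => ⟨0, hpos⟩, fun P hP => absurd (hP.2.2 ▸ ratPrime_prime hP.1 hP.2.1) hq⟩
  choose f hf using key
  refine ⟨fun P => f (ratPrime P) P, fun P Q hP hP0 hQ hQ0 h1 h2 => ?_⟩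
  refine hf (ratPrime P) ⟨hP, hP0, rfl⟩ ⟨hQ, hQ0, h1.symm⟩ ?_
  simp only [h1] at h2 ⊢
  exact h2

open UniqueFactorizationMonoid in
lemma exists_tuple (K : Type) [Field K] [NumberField K] :
    ∃ g : (Ideal (𝓞 K))⁰ → Fin (Module.finrank ℚ K) → ℕ, Function.Injective g ∧
      ∀ J, 0 < ∏ i, g J i ∧ ∏ i, g J i ≤ Ideal.absNorm (J : Ideal (𝓞 K)) := by
  classical
  obtain ⟨lab, hlab⟩ := exists_label K
  let fac : (Ideal (𝓞 K))⁰ → Multiset (Ideal (𝓞 K)) := fun J => normalizedFactors (J : Ideal (𝓞 K))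
  have hfac : ∀ J, ∀ P ∈ fac J, P.IsPrime ∧ P ≠ ⊥ := fun J P hP => by
    have := prime_of_normalized_factor P hP
    exact ⟨Ideal.isPrime_of_prime this, this.ne_zero⟩
  let M : (Ideal (𝓞 K))⁰ → Fin (Module.finrank ℚ K) → Multiset ℕ := fun J i =>
    ((fac J).filter fun P => lab P = i).map ratPrime
  have hMp : ∀ J i, ∀ q ∈ M J i, Prime q := by
    intro J i q hq
    simp only [M, Multiset.mem_map, Multiset.mem_filter] at hq
    obtain ⟨P, ⟨hP, -⟩, rfl⟩ := hq
    exact (ratPrime_prime (hfac J P hP).1 (hfac J P hP).2).prime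
  have hprodJ : ∀ J : (Ideal (𝓞 K))⁰, (fac J).prod = J := fun J => by
    have := prod_normalizedFactors_eq (nonZeroDivisors.coe_ne_zero J)
    simpa using this
  refine ⟨fun J i => (M J i).prod, ?_, ?_⟩
  · intro J J' h
    have hM : M J = M J' := by
      funext i
      have := congrFun h i
      simp only at this
      rw [← normalizedFactors_prod_of_prime (hMp J i), this,
        normalizedFactors_prod_of_prime (hMp J' i)]
    have hcount : ∀ (J : (Ideal (𝓞 K))⁰) (P : Ideal (𝓞 K)), P.IsPrime → P ≠ ⊥ →
        (fac J).count P = (M J (lab P)).count (ratPrime P) := by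
      intro J P hP hP0
      rw [Multiset.count_map, Multiset.filter_filter, Multiset.count_eq_card_filter_eq]
      congr 1
      refine Multiset.filter_congr fun Q hQ => ?_
      constructor
      · rintro rfl; exact ⟨rfl, rfl⟩
      · rintro ⟨h1, h2⟩
        exact hlab P Q hP hP0 (hfac J Q hQ).1 (hfac J Q hQ).2 h1 h2.symm
    have hJJ : fac J = fac J' := by
      ext P
      by_cases hP : P.IsPrime ∧ P ≠ ⊥
      · rw [hcount J P hP.1 hP.2, hcount J' P hP.1 hP.2, hM]
      · rw [Multiset.count_eq_zero_of_notMem fun h => hP (hfac J P h),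
          Multiset.count_eq_zero_of_notMem fun h => hP (hfac J' P h)]
    exact Subtype.ext (by rw [← hprodJ J, ← hprodJ J', hJJ])
  · intro J
    have h1 : ∏ i, (M J i).prod = ((fac J).map ratPrime).prod := by
      simp only [M]
      have : ∀ s : Multiset (Ideal (𝓞 K)),
          ∏ i, ((s.filter fun P => lab P = i).map ratPrime).prod = (s.map ratPrime).prod := by
        intro s
        induction s using Multiset.induction_on with
        | empty => simp
        | cons a s ih =>
          rw [Multiset.map_cons, Multiset.prod_cons, ← ih]
          have : ∀ i, (((a ::ₘ s).filter fun P => lab P = i).map ratPrime).prod =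
              (if lab a = i then ratPrime a else 1) *
                ((s.filter fun P => lab P = i).map ratPrime).prod := by
            intro i
            by_cases h : lab a = i
            · rw [Multiset.filter_cons_of_pos (p := fun P => lab P = i) s h]; simp [h]
            · rw [Multiset.filter_cons_of_neg (p := fun P => lab P = i) s h]; simp [h]
          rw [Finset.prod_congr rfl fun i _ => this i, Finset.prod_mul_distrib]
          simp
      exact this _
    have h2 : ((fac J).map ratPrime).prod ∣ Ideal.absNorm (J : Ideal (𝓞 K)) := by
      conv_rhs => rw [← hprodJ J, map_multiset_prod]
      generalize fac J = s
      induction s using Multiset.induction_on with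
      | empty => simp
      | cons a s ih =>
        rw [Multiset.map_cons, Multiset.prod_cons, Multiset.map_cons, Multiset.prod_cons]
        exact mul_dvd_mul (ratPrime_dvd_absNorm a) ih
    have h3 : 0 < Ideal.absNorm (J : Ideal (𝓞 K)) := Ideal.absNorm_pos_of_nonZeroDivisors J
    rw [h1]
    exact ⟨Nat.pos_of_dvd_of_pos h2 h3, Nat.le_of_dvd h3 h2⟩

/-- The Riemann zeta series at a real exponent. -/
noncomputable def natZeta (σ : ℝ) : ℝ := ∑' m : ℕ, (m : ℝ) ^ (-σ)

lemma sum_ideal_rpow_le {σ : ℝ} (hσ : 1 < σ) (S : Finset (Ideal (𝓞 K))⁰) :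
    ∑ J ∈ S, (Ideal.absNorm (J : Ideal (𝓞 K)) : ℝ) ^ (-σ) ≤ natZeta σ ^ Module.finrank ℚ K := by
  classical
  obtain ⟨g, hg, hgJ⟩ := exists_tuple K
  have hsum : Summable fun m : ℕ => (m : ℝ) ^ (-σ) := Real.summable_nat_rpow.2 (by linarith)
  let B : Finset ℕ := S.biUnion fun J => Finset.univ.image (g J)
  calc ∑ J ∈ S, (Ideal.absNorm (J : Ideal (𝓞 K)) : ℝ) ^ (-σ)
      ≤ ∑ J ∈ S, ∏ i, (g J i : ℝ) ^ (-σ) := by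
        refine Finset.sum_le_sum fun J _ => ?_
        rw [Real.finsetProd_rpow _ _ (fun _ _ => by positivity)]
        have h1 : (0 : ℝ) < ∏ i, (g J i : ℝ) := by exact_mod_cast (hgJ J).1
        have h2 : ∏ i, (g J i : ℝ) ≤ Ideal.absNorm (J : Ideal (𝓞 K)) := by exact_mod_cast (hgJ J).2
        exact Real.rpow_le_rpow_of_nonpos h1 h2 (by linarith)
    _ = ∑ t ∈ S.image g, ∏ i, (t i : ℝ) ^ (-σ) := (Finset.sum_image (f := fun t : _ → ℕ => ∏ i, (t i : ℝ) ^ (-σ)) hg.injOn).symm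
    _ ≤ ∑ t ∈ Fintype.piFinset fun _ : Fin (Module.finrank ℚ K) => B, ∏ i, (t i : ℝ) ^ (-σ) := by
        refine Finset.sum_le_sum_of_subset_of_nonneg ?_ fun _ _ _ => by positivity
        intro t ht
        obtain ⟨J, hJ, rfl⟩ := Finset.mem_image.1 ht
        rw [Fintype.mem_piFinset]
        exact fun i => Finset.mem_biUnion.2 ⟨J, hJ, Finset.mem_image_of_mem _ (Finset.mem_univ _)⟩
    _ = (∑ m ∈ B, (m : ℝ) ^ (-σ)) ^ Module.finrank ℚ K := by
        rw [← Finset.prod_univ_sum (fun _ => B) (fun _ m => (m : ℝ) ^ (-σ))]; simp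
    _ ≤ natZeta σ ^ Module.finrank ℚ K := by
        gcongr
        exact hsum.sum_le_tsum _ fun _ _ => by positivity

lemma summable_ideal_rpow {σ : ℝ} (hσ : 1 < σ) :
    Summable fun J : (Ideal (𝓞 K))⁰ => (Ideal.absNorm (J : Ideal (𝓞 K)) : ℝ) ^ (-σ) :=
  summable_of_sum_le (fun _ => by positivity) (sum_ideal_rpow_le hσ)

lemma tsum_ideal_rpow_le {σ : ℝ} (hσ : 1 < σ) :
    ∑' J : (Ideal (𝓞 K))⁰, (Ideal.absNorm (J : Ideal (𝓞 K)) : ℝ) ^ (-σ) ≤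
      natZeta σ ^ Module.finrank ℚ K :=
  Real.tsum_le_of_sum_le (fun _ => by positivity) (sum_ideal_rpow_le hσ)

/-- The number of ideals of bounded norm is almost linear, uniformly in the field. -/
lemma card_ideal_le {σ : ℝ} (hσ : 1 < σ) {Y : ℝ} (hY : 0 < Y) (S : Finset (Ideal (𝓞 K))⁰)
    (hS : ∀ J ∈ S, (Ideal.absNorm (J : Ideal (𝓞 K)) : ℝ) ≤ Y) :
    (S.card : ℝ) ≤ Y ^ σ * natZeta σ ^ Module.finrank ℚ K := by
  refine le_trans ?_ (mul_le_mul_of_nonneg_left (sum_ideal_rpow_le hσ S) (by positivity))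
  rw [Finset.mul_sum, ← nsmul_one]
  refine Finset.card_nsmul_le_sum _ _ _ fun J hJ => ?_
  have h3 : (0 : ℝ) < Ideal.absNorm (J : Ideal (𝓞 K)) := by
    exact_mod_cast Ideal.absNorm_pos_of_nonZeroDivisors J
  rw [Real.rpow_neg h3.le, ← div_eq_mul_inv, one_le_div (by positivity)]
  exact Real.rpow_le_rpow h3.le (hS J hJ) (by linarith)

end IdealCount

/-- Reindexing of a weighted double sum over a group `G` and a group `U` acting on it, along the
involution `(g, u) ↦ (u g, u⁻¹)`. -/
lemma hasSum_reindex {G U : Type*} [CommGroup G] [CommGroup U] (j : U →* G) (P : G → Prop)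
    [DecidablePred P] (t : U → ℝ) (ht : ∀ u, 0 ≤ t u) (d : G → ℝ)
    (hd : ∀ g, P g → HasSum (fun u => if P (j u * g) then t u else 0) (d g))
    (hd0 : ∀ g, P g → 0 < d g) (F : G → ℂ) (hF : Summable fun g => ‖F g‖)
    (hFP : ∀ g, ¬ P g → F g = 0) :
    HasSum (fun g => ∑' u, if P g then F (j u * g) * ((t u⁻¹ / d (j u * g) : ℝ) : ℂ) else 0)
      (∑' g, F g) := by
  let E : G × U → ℂ := fun x => F x.1 * (((if P (j x.2 * x.1) then t x.2 else 0) / d x.1 : ℝ) : ℂ)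
  have h1 : ∀ g, HasSum (fun u => E (g, u)) (F g) := by
    intro g
    by_cases hg : P g
    · have := (Complex.hasSum_ofReal.2 ((hd g hg).div_const (d g))).mul_left (F g)
      rw [div_self (hd0 g hg).ne', Complex.ofReal_one, mul_one] at this
      exact this
    · simp only [E, hFP g hg, zero_mul]; exact hasSum_zero
  have h2 : ∀ g, HasSum (fun u => ‖E (g, u)‖) ‖F g‖ := by
    intro g
    by_cases hg : P g
    · have := ((hd g hg).div_const (d g)).mul_left ‖F g‖
      rw [div_self (hd0 g hg).ne', mul_one] at this
      refine this.congr_fun fun u => ?_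
      have h3 : 0 ≤ (if P (j u * g) then t u else 0) / d g := by
        have := (hd0 g hg).le
        have := ht u
        split_ifs <;> positivity
      simp only [E, norm_mul, Complex.norm_real, Real.norm_of_nonneg h3]
    · simp only [E, hFP g hg, zero_mul, norm_zero]; exact hasSum_zero
  have hE : Summable E := by
    refine Summable.of_norm ?_
    rw [summable_prod_of_nonneg fun _ => norm_nonneg _]
    refine ⟨fun g => (h2 g).summable, ?_⟩
    simpa only [fun g => (h2 g).tsum_eq] using hF
  have hsum : HasSum E (∑' g, F g) := by
    have := hE.hasSum
    rwa [hE.tsum_prod, tsum_congr fun g => (h1 g).tsum_eq] at this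
  let e : G × U ≃ G × U :=
    { toFun := fun x => (j x.2 * x.1, x.2⁻¹)
      invFun := fun x => (j x.2 * x.1, x.2⁻¹)
      left_inv := fun x => by simp
      right_inv := fun x => by simp }
  have hsum' : HasSum (E ∘ e) (∑' g, F g) := e.hasSum_iff.2 hsum
  have hs2 := hsum'.summable
  convert hsum'.prod_fiberwise (fun g => (hs2.prod_factor g).hasSum) using 1
  funext g
  refine tsum_congr fun u => ?_
  by_cases hg : P g <;> simp [E, e, hg]

section EtaFunction

open scoped nonZeroDivisors

variable {K : Type} [Field K] [NumberField K]

variable (K) in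
/-- The group of invertible fractional ideals. -/
abbrev FracIdeals := (FractionalIdeal (𝓞 K)⁰ K)ˣ

/-- The principal fractional ideal of a unit. -/
noncomputable abbrev principal : Kˣ →* FracIdeals K := toPrincipalIdeal (𝓞 K) K

/-- An integral element of the group of fractional ideals. -/
def IsInt (I : FracIdeals K) : Prop := (I : FractionalIdeal (𝓞 K)⁰ K) ≤ 1

/-- The ideal norm on the group of fractional ideals, as a real number. -/
noncomputable def fnorm (I : FracIdeals K) : ℝ :=
  (FractionalIdeal.absNorm (I : FractionalIdeal (𝓞 K)⁰ K) : ℝ)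

lemma fnorm_pos (I : FracIdeals K) : 0 < fnorm I := by
  have h1 := FractionalIdeal.absNorm_nonneg (I : FractionalIdeal (𝓞 K)⁰ K)
  have h2 : FractionalIdeal.absNorm (I : FractionalIdeal (𝓞 K)⁰ K) ≠ 0 := fun h =>
    I.ne_zero (FractionalIdeal.absNorm_eq_zero_iff.1 h)
  rw [fnorm]
  exact_mod_cast lt_of_le_of_ne h1 h2.symm

lemma fnorm_mul (I J : FracIdeals K) : fnorm (I * J) = fnorm I * fnorm J := by
  simp [fnorm]

noncomputable instance : Nonempty (Fin (Module.finrank ℚ K)) :=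
  Fin.pos_iff_nonempty.1 Module.finrank_pos

variable (K) in
/-- An enumeration of the complex embeddings. -/
noncomputable def embEquiv : Fin (Module.finrank ℚ K) ≃ (K →+* ℂ) :=
  Fintype.equivOfCardEq (by rw [Fintype.card_fin, Embeddings.card K ℂ])

variable (K) in
/-- The embedding of a number field in the product of its complex completions. -/
noncomputable def emb : K →+* (Fin (Module.finrank ℚ K) → ℂ) :=
  RingHom.pi fun i => embEquiv K i

lemma emb_apply (x : K) (i) : emb K x i = embEquiv K i x := rfl

lemma norm_emb (x : K) : ‖emb K x‖ = house x := by
  refine le_antisymm ?_ ?_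
  · rw [pi_norm_le_iff_of_nonneg (house_nonneg _)]
    exact fun i => norm_embedding_le_house x _
  · rw [house, pi_norm_le_iff_of_nonneg (norm_nonneg _)]
    intro σ
    have := norm_le_pi_norm (emb K x) ((embEquiv K).symm σ)
    rwa [emb_apply, Equiv.apply_symm_apply] at this

variable (K) in
lemma emb_injective : Function.Injective (emb K) := RingHom.injective _

lemma prod_norm_emb (x : K) :
    ∏ i, ‖emb K x i‖ = |(Algebra.norm ℚ x : ℝ)| := by
  have h := Algebra.norm_eq_prod_embeddings ℚ ℂ x
  have h2 : ∏ i, ‖emb K x i‖ = ‖∏ σ : K →ₐ[ℚ] ℂ, σ x‖ := by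
    rw [norm_prod]
    exact Fintype.prod_equiv ((embEquiv K).trans (RingHom.equivRatAlgHom K ℂ)) _ _ fun i => rfl
  rw [h2, ← h]
  simp

lemma fnorm_principal (x : Kˣ) : fnorm (principal x) = ∏ i, ‖emb K (x : K) i‖ := by
  rw [prod_norm_emb, fnorm, coe_toPrincipalIdeal,
    FractionalIdeal.absNorm_span_singleton]
  push_cast; rfl

lemma mem_inv_iff_isInt (I : FracIdeals K) (y : Kˣ) :
    (y : K) ∈ ((I⁻¹ : FracIdeals K) : FractionalIdeal (𝓞 K)⁰ K) ↔ IsInt (principal y * I) := by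
  rw [IsInt, Units.val_mul, coe_toPrincipalIdeal, ← FractionalIdeal.spanSingleton_le_iff_mem]
  constructor
  · intro h
    calc _ ≤ ((I⁻¹ : FracIdeals K) : FractionalIdeal (𝓞 K)⁰ K) * I := by gcongr
      _ = 1 := by simp
  · intro h
    calc FractionalIdeal.spanSingleton (𝓞 K)⁰ (y : K)
        = (FractionalIdeal.spanSingleton (𝓞 K)⁰ (y : K) * I) * ((I⁻¹ : FracIdeals K)) := by simp
      _ ≤ 1 * ((I⁻¹ : FracIdeals K)) := by gcongr
      _ = _ := one_mul _

/-- The inverse of a fractional ideal, embedded as a lattice. -/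
noncomputable def invLat (I : FracIdeals K) : AddSubgroup (Fin (Module.finrank ℚ K) → ℂ) :=
  (((I⁻¹ : FracIdeals K) : FractionalIdeal (𝓞 K)⁰ K) :
    Submodule (𝓞 K) K).toAddSubgroup.map (emb K).toAddMonoidHom

lemma mem_invLat {I : FracIdeals K} {v : Fin (Module.finrank ℚ K) → ℂ} : v ∈ invLat I ↔
    ∃ x : K, x ∈ ((I⁻¹ : FracIdeals K) : FractionalIdeal (𝓞 K)⁰ K) ∧
      emb K x = v := by
  simp [invLat, AddSubgroup.mem_map]

lemma invLat_locallyFin (I : FracIdeals K) : LocallyFin (invLat I) := by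
  intro R
  obtain ⟨d, hd, hd0⟩ : ∃ d ∈ (I : FractionalIdeal (𝓞 K)⁰ K), d ≠ 0 := by
    by_contra! h
    exact I.ne_zero (FractionalIdeal.eq_zero_iff.2 h)
  have hfin := Embeddings.finite_of_norm_le K ℂ (house d * R)
  have h2 : ({x : K | d * x ∈ {x : K | IsIntegral ℤ x ∧ ∀ φ : K →+* ℂ, ‖φ x‖ ≤ house d * R}}).Finite :=
    hfin.preimage (mul_right_injective₀ hd0).injOn
  refine Set.Finite.of_finite_image ((h2.image (emb K)).subset ?_)
    Subtype.val_injective.injOn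
  rintro _ ⟨⟨v, hv⟩, hvR, rfl⟩
  obtain ⟨x, hx, rfl⟩ := mem_invLat.1 hv
  refine ⟨x, ⟨?_, fun σ => ?_⟩, rfl⟩
  · have : d * x ∈ (1 : FractionalIdeal (𝓞 K)⁰ K) := by
      have := FractionalIdeal.mul_mem_mul hd hx
      simpa using this
    obtain ⟨z, hz⟩ := (FractionalIdeal.mem_one_iff _).1 this
    rw [← hz]
    exact RingOfIntegers.isIntegral_coe z
  · calc ‖σ (d * x)‖ ≤ house (d * x) := norm_embedding_le_house _ _
      _ ≤ house d * house x := house_mul_le _ _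
      _ ≤ house d * R := by
        gcongr
        · exact house_nonneg _
        · rw [← norm_emb]
          exact hvR

open scoped Classical in
lemma tsum_invLat (I : FracIdeals K) {E : Type*} [AddCommMonoid E] [TopologicalSpace E] [T2Space E]
    (h : (Fin (Module.finrank ℚ K) → ℂ) → E) (h0 : h 0 = 0) :
    ∑' v : invLat I, h v =
      ∑' y : Kˣ, if IsInt (principal y * I) then h (emb K (y : K)) else 0 := by
  let f : {y : Kˣ | IsInt (principal y * I)} → invLat I := fun y =>
    ⟨emb K (y : Kˣ), mem_invLat.2 ⟨_, (mem_inv_iff_isInt I y).2 y.2, rfl⟩⟩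
  have hf : Function.Injective f := fun y z hyz => by
    have := congrArg Subtype.val hyz
    exact Subtype.ext (Units.ext ((emb_injective K) this))
  have hs : Function.support (fun v : invLat I => h v) ⊆ Set.range f := by
    rintro ⟨v, hv⟩ hv0
    obtain ⟨x, hx, rfl⟩ := mem_invLat.1 hv
    have hx0 : x ≠ 0 := by
      rintro rfl
      exact hv0 (by simpa using h0)
    exact ⟨⟨Units.mk0 x hx0, (mem_inv_iff_isInt I _).1 hx⟩, rfl⟩
  rw [← hf.tsum_eq hs]
  change ∑' y : {y : Kˣ | IsInt (principal y * I)}, h (emb K ((y : Kˣ) : K)) = _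
  rw [tsum_subtype {y : Kˣ | IsInt (principal y * I)} fun y : Kˣ => h (emb K (y : K))]
  refine tsum_congr fun y => ?_
  simp [Set.indicator]

lemma finite_isInt_norm_le (I : FracIdeals K) (R : ℝ) :
    {y : Kˣ | IsInt (principal y * I) ∧ ‖emb K (y : K)‖ ≤ R}.Finite := by
  refine Set.Finite.of_finite_image (f := fun y : Kˣ => emb K (y : K))
    (((invLat_locallyFin I R).image Subtype.val).subset ?_)
    (fun y _ z _ h => Units.ext (emb_injective K h))
  rintro _ ⟨y, ⟨hy, hR⟩, rfl⟩
  exact ⟨⟨_, mem_invLat.2 ⟨_, (mem_inv_iff_isInt I y).2 hy, rfl⟩⟩, hR, rfl⟩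

lemma tent_zero {ι : Type} [Fintype ι] [Nonempty ι] : tent (0 : ι → ℂ) = 0 := by
  simp only [tent, zero_sub, norm_neg, norm_one]
  norm_num

lemma tent_inv_zero {ι : Type} [Fintype ι] [Nonempty ι] : tent (0⁻¹ : ι → ℂ) = 0 := by
  rw [show (0⁻¹ : ι → ℂ) = 0 from funext fun i => inv_zero, tent_zero]

lemma norm_le_of_tent_ne_zero {ι : Type} [Fintype ι] {x : ι → ℂ} (h : tent x ≠ 0) : ‖x‖ ≤ 2 := by
  have h1 := norm_sub_one_lt_of_tent_ne_zero h
  have h2 : ‖(1 : ι → ℂ)‖ ≤ 1 := (pi_norm_le_iff_of_nonneg zero_le_one).2 fun i => by simp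
  have h3 := norm_add_le (x - 1) 1
  rw [sub_add_cancel] at h3
  linarith

open scoped Classical in
/-- The weighted number of small elements of the inverse of a fractional ideal. -/
noncomputable def tentCount (I : FracIdeals K) : ℝ :=
  ∑' y : Kˣ, if IsInt (principal y * I) then tent (emb K (y : K)) else 0

open scoped Classical in
lemma summable_tentCount (I : FracIdeals K) :
    Summable fun y : Kˣ =>
      if IsInt (principal y * I) then tent (emb K (y : K)) else 0 := by
  refine summable_of_hasFiniteSupport ((finite_isInt_norm_le I 2).subset fun y hy => ?_)
  rw [Function.mem_support] at hy
  split_ifs at hy with h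
  · exact ⟨h, norm_le_of_tent_ne_zero hy⟩
  · exact absurd rfl hy

lemma tentCount_pos {I : FracIdeals K} (hI : IsInt I) : 0 < tentCount I := by
  classical
  refine (summable_tentCount I).tsum_pos (fun y => ?_) 1 ?_
  · split_ifs
    exacts [tent_nonneg _, le_rfl]
  · simp [hI, tent_one]

lemma tentSum_invLat (I : FracIdeals K) (x : Kˣ) :
    tentSum (invLat I) (emb K (x : K)) = tentCount (principal x * I) := by
  classical
  rw [tentSum, tsum_invLat I (fun v => tent (v * (emb K (x : K))⁻¹))
    (by rw [zero_mul, tent_zero]), tentCount, ← (Equiv.mulRight x).tsum_eq]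
  refine tsum_congr fun y => ?_
  have h : emb K ((y * x : Kˣ) : K) * (emb K (x : K))⁻¹ =
      emb K (y : K) := by
    funext i
    simp [emb_apply]
  rw [Equiv.coe_mulRight, h, map_mul, mul_assoc]

lemma emb_inv (x : Kˣ) :
    (emb K (x : K))⁻¹ = emb K ((x⁻¹ : Kˣ) : K) := by
  funext i; simp [emb_apply]

lemma weight_invLat (I : FracIdeals K) (s : ℂ) (x : Kˣ) :
    weight (invLat I) s (emb K (x : K)) = (fnorm (principal x) : ℂ) ^ (-s) *
      ((tent (emb K ((x⁻¹ : Kˣ) : K)) / tentCount (principal x * I) : ℝ) : ℂ) := by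
  rw [weight, tentSum_invLat, emb_inv, fnorm_principal]

/-- The fractional ideal attached to a nonzero ideal. -/
noncomputable def mkFrac (J : (Ideal (𝓞 K))⁰) : FracIdeals K :=
  Units.mk0 ((J : Ideal (𝓞 K)) : FractionalIdeal (𝓞 K)⁰ K)
    (FractionalIdeal.coeIdeal_ne_zero.2 (nonZeroDivisors.coe_ne_zero J))

lemma mkFrac_injective : Function.Injective (mkFrac (K := K)) := fun J J' h => by
  have := congrArg Units.val h
  exact Subtype.ext (FractionalIdeal.coeIdeal_injective this)

lemma isInt_iff {I : FracIdeals K} : IsInt I ↔ ∃ J, mkFrac J = I := by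
  constructor
  · intro h
    obtain ⟨J, hJ⟩ := FractionalIdeal.le_one_iff_exists_coeIdeal.1 h
    have hJ0 : J ≠ ⊥ := by
      rintro rfl
      exact I.ne_zero (by rw [← hJ]; simp)
    exact ⟨⟨J, mem_nonZeroDivisors_of_ne_zero hJ0⟩, Units.ext hJ⟩
  · rintro ⟨J, rfl⟩
    exact FractionalIdeal.coeIdeal_le_one

lemma fnorm_mkFrac (J : (Ideal (𝓞 K))⁰) : fnorm (mkFrac J) = Ideal.absNorm (J : Ideal (𝓞 K)) := by
  rw [fnorm, mkFrac, Units.val_mk0, FractionalIdeal.coeIdeal_absNorm]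
  push_cast; rfl

/-- The Dirichlet series of the Dedekind zeta function. -/
noncomputable def zetaSeries (K : Type) [Field K] [NumberField K] (s : ℂ) : ℂ :=
  ∑' J : (Ideal (𝓞 K))⁰, ((Ideal.absNorm (J : Ideal (𝓞 K)) : ℝ) : ℂ) ^ (-s)

lemma norm_ofReal_cpow_neg {u : ℝ} (hu : 0 < u) (s : ℂ) : ‖(u : ℂ) ^ (-s)‖ = u ^ (-s.re) := by
  rw [Complex.norm_cpow_eq_rpow_re_of_pos hu, Complex.neg_re]

lemma absNorm_pos (J : (Ideal (𝓞 K))⁰) : (0 : ℝ) < Ideal.absNorm (J : Ideal (𝓞 K)) := by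
  exact_mod_cast Ideal.absNorm_pos_of_nonZeroDivisors J

lemma one_le_absNorm (J : (Ideal (𝓞 K))⁰) : (1 : ℝ) ≤ Ideal.absNorm (J : Ideal (𝓞 K)) := by
  exact_mod_cast Ideal.absNorm_pos_of_nonZeroDivisors J

lemma summable_norm_zetaSeries {s : ℂ} (hs : 1 < s.re) :
    Summable fun J : (Ideal (𝓞 K))⁰ => ‖((Ideal.absNorm (J : Ideal (𝓞 K)) : ℝ) : ℂ) ^ (-s)‖ := by
  simp_rw [norm_ofReal_cpow_neg (absNorm_pos _)]
  exact summable_ideal_rpow hs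

/-- The local difference of weight sums attached to a fractional ideal. -/
noncomputable def weightDiff (I : FracIdeals K) (s : ℂ) : ℂ :=
  ∑' v : invLat I, weight (invLat I) s v -
    2 ^ Module.finrank ℚ K * ∑' v : invLat I, weight (invLat I) s (v + v : invLat I)

open scoped Classical in
/-- The term of the zeta series at a fractional ideal. -/
noncomputable def zetaTerm (s : ℂ) (I : FracIdeals K) : ℂ :=
  if IsInt I then (fnorm I : ℂ) ^ (-s) else 0

lemma hasSum_zetaTerm_norm {s : ℂ} (hs : 1 < s.re) :
    Summable (fun I : FracIdeals K => ‖zetaTerm s I‖) ∧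
      ∑' I : FracIdeals K, zetaTerm s I = zetaSeries K s := by
  have h1 : ∀ J : (Ideal (𝓞 K))⁰, zetaTerm s (mkFrac J) =
      ((Ideal.absNorm (J : Ideal (𝓞 K)) : ℝ) : ℂ) ^ (-s) := fun J => by
    rw [zetaTerm, if_pos (isInt_iff.2 ⟨J, rfl⟩), fnorm_mkFrac]
  have h2 : ∀ I : FracIdeals K, I ∉ Set.range mkFrac → zetaTerm s I = 0 := fun I hI => by
    rw [zetaTerm, if_neg fun h => hI (isInt_iff.1 h)]
  constructor
  · rw [← mkFrac_injective.summable_iff fun I hI => by rw [h2 I hI, norm_zero]]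
    exact (summable_norm_zetaSeries hs).congr fun J => by rw [Function.comp_apply, h1]
  · rw [zetaSeries, ← mkFrac_injective.tsum_eq fun I hI => by
      by_contra h
      exact hI (h2 I h)]
    exact tsum_congr h1

lemma ofReal_mul_cpow {a b : ℝ} (ha : 0 < a) (hb : 0 < b) (s : ℂ) :
    ((a * b : ℝ) : ℂ) ^ s = (a : ℂ) ^ s * (b : ℂ) ^ s := by
  rw [Complex.ofReal_mul, Complex.mul_cpow_ofReal_nonneg ha.le hb.le]

variable (K) in
/-- The rational number two as a unit. -/
noncomputable def twoUnit : Kˣ := Units.mk0 2 two_ne_zero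

lemma fnorm_two : fnorm (principal (twoUnit K)) = 2 ^ Module.finrank ℚ K := by
  rw [fnorm_principal]
  have : ∀ i, ‖emb K (twoUnit K : K) i‖ = 2 := fun i => by
    rw [twoUnit, Units.val_mk0, emb_apply, map_ofNat]
    simp
  simp [this]

open scoped Classical in
lemma tsum_zetaTerm_tent {I : FracIdeals K} (s : ℂ) (c : Kˣ) :
    ∑' u : Kˣ, zetaTerm s (principal u * I) * ((tent (emb K
        ((((c * u)⁻¹ : Kˣ)) : K)) / tentCount (principal (c * u) * I) : ℝ) : ℂ) =
      (fnorm (principal c) : ℂ) ^ s * (fnorm I : ℂ) ^ (-s) *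
        ∑' v : invLat I, weight (invLat I) s (emb K (c : K) * v) := by
  rw [tsum_invLat I (fun v => weight (invLat I) s (emb K (c : K) * v))
    (weight_eq_zero (by rw [mul_zero, tent_inv_zero])), ← tsum_mul_left]
  refine tsum_congr fun u => ?_
  by_cases h : IsInt (principal u * I)
  · rw [zetaTerm, if_pos h, if_pos h, ← map_mul (emb K), ← Units.val_mul,
      weight_invLat, map_mul principal c u, fnorm_mul, fnorm_mul,
      ofReal_mul_cpow (fnorm_pos _) (fnorm_pos _), ofReal_mul_cpow (fnorm_pos _) (fnorm_pos _)]
    have h1 : (fnorm (principal c) : ℂ) ^ s * (fnorm (principal c) : ℂ) ^ (-s) = 1 := by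
      rw [← Complex.cpow_add _ _ (by exact_mod_cast (fnorm_pos (principal c)).ne')]
      simp
    linear_combination (-1 : ℂ) * ((fnorm (principal u) : ℂ) ^ (-s) * (fnorm I : ℂ) ^ (-s) *
      ((tent (emb K ((((c * u)⁻¹ : Kˣ)) : K)) /
        tentCount (principal c * principal u * I) : ℝ) : ℂ)) * h1
  · rw [zetaTerm, if_neg h, if_neg h, zero_mul, mul_zero]

lemma IsInt.mul {I J : FracIdeals K} (hI : IsInt I) (hJ : IsInt J) : IsInt (I * J) := by
  obtain ⟨a, rfl⟩ := isInt_iff.1 hI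
  obtain ⟨b, rfl⟩ := isInt_iff.1 hJ
  exact isInt_iff.2 ⟨a * b, Units.ext (by simp [mkFrac])⟩

lemma isInt_principal {x : Kˣ} (hx : IsIntegral ℤ (x : K)) : IsInt (principal x) := by
  rw [IsInt, coe_toPrincipalIdeal, FractionalIdeal.spanSingleton_le_iff_mem,
    FractionalIdeal.mem_one_iff]
  exact ⟨⟨x, hx⟩, rfl⟩

lemma isInt_two : IsInt (principal (twoUnit K)) := isInt_principal (by
  have : IsIntegral ℤ ((2 : ℤ) : K) := isIntegral_algebraMap
  simpa [twoUnit] using this)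

lemma fnorm_cpow_mul_cpow_neg (I : FracIdeals K) (s : ℂ) :
    (fnorm I : ℂ) ^ s * (fnorm I : ℂ) ^ (-s) = 1 := by
  rw [← Complex.cpow_add _ _ (by exact_mod_cast (fnorm_pos I).ne')]
  simp

lemma tsum_zetaTerm_one (I : FracIdeals K) (s : ℂ) :
    ∑' u : Kˣ, zetaTerm s (principal u * I) * ((tent (emb K ((u⁻¹ : Kˣ) : K)) /
        tentCount (principal u * I) : ℝ) : ℂ) =
      (fnorm I : ℂ) ^ (-s) * ∑' v : invLat I, weight (invLat I) s v := by
  have h1 := tsum_zetaTerm_tent (I := I) s 1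
  simp only [one_mul, map_one, Units.val_one] at h1
  have h1' : fnorm (1 : FracIdeals K) = 1 := by simp [fnorm]
  rw [h1', Complex.ofReal_one, Complex.one_cpow, one_mul] at h1
  exact h1

lemma tsum_zetaTerm_two (I : FracIdeals K) (s : ℂ) :
    ∑' u : Kˣ, zetaTerm s ((principal (twoUnit K))⁻¹ * (principal u * I)) *
      ((tent (emb K ((u⁻¹ : Kˣ) : K)) / tentCount (principal u * I) : ℝ) : ℂ) =
      (fnorm (principal (twoUnit K)) : ℂ) ^ s * ((fnorm I : ℂ) ^ (-s) *
        ∑' v : invLat I, weight (invLat I) s (v + v : invLat I)) := by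
  have h2 := tsum_zetaTerm_tent (I := I) s (twoUnit K)
  rw [← (Equiv.mulLeft (twoUnit K)).tsum_eq]
  simp only [Equiv.coe_mulLeft]
  have h3 : ∀ u : Kˣ, (principal (twoUnit K))⁻¹ * (principal (twoUnit K * u) * I) =
      principal u * I := by
    intro u
    rw [map_mul, mul_assoc, inv_mul_cancel_left]
  simp only [h3]
  have h4 : ∀ v : Fin (Module.finrank ℚ K) → ℂ, emb K (twoUnit K : K) * v = v + v := by
    intro v
    funext i
    rw [Pi.mul_apply, twoUnit, Units.val_mk0, emb_apply, map_ofNat, two_mul]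
    rfl
  simp only [h4] at h2
  rw [h2, mul_assoc]
  rfl

open scoped Classical in
lemma hasSum_tent_reindex (F : FracIdeals K → ℂ) (hF : Summable fun I => ‖F I‖)
    (hF0 : ∀ I, ¬ IsInt I → F I = 0) :
    HasSum (fun I => ∑' u : Kˣ, if IsInt I then F (principal u * I) *
      ((tent (emb K ((u⁻¹ : Kˣ) : K)) / tentCount (principal u * I) : ℝ) : ℂ)
        else 0) (∑' I, F I) :=
  hasSum_reindex principal IsInt (fun u : Kˣ => tent (emb K (u : K)))
    (fun _ => tent_nonneg _) tentCount (fun I _ => (summable_tentCount I).hasSum)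
    (fun _ hI => tentCount_pos hI) F hF hF0

lemma hasSum_mkFrac {f : FracIdeals K → ℂ} {a : ℂ} (h : HasSum f a)
    (h0 : ∀ I, ¬ IsInt I → f I = 0) : HasSum (fun J => f (mkFrac J)) a :=
  (mkFrac_injective.hasSum_iff fun I hI => h0 I fun h => hI (isInt_iff.1 h)).2 h

end EtaFunction

section EtaFunction
open scoped nonZeroDivisors
variable {K : Type} [Field K] [NumberField K]
lemma hasSum_tent_reindex_mkFrac (F : FracIdeals K → ℂ) (hF : Summable fun I => ‖F I‖)
    (hF0 : ∀ I, ¬ IsInt I → F I = 0) :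
    HasSum (fun J => ∑' u : Kˣ, F (principal u * mkFrac J) *
      ((tent (emb K ((u⁻¹ : Kˣ) : K)) /
        tentCount (principal u * mkFrac J) : ℝ) : ℂ)) (∑' I, F I) := by
  classical
  refine (hasSum_mkFrac (hasSum_tent_reindex F hF hF0) fun I hI => ?_).congr_fun fun J => ?_
  · simp only [hI, if_false, tsum_zero]
  · exact tsum_congr fun u => (if_pos (isInt_iff.2 ⟨J, rfl⟩)).symm

lemma hasSum_weight {s : ℂ} (hs : 1 < s.re) :
    HasSum (fun J : (Ideal (𝓞 K))⁰ => (fnorm (mkFrac J) : ℂ) ^ (-s) *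
      ∑' v : invLat (mkFrac J), weight (invLat (mkFrac J)) s v) (zetaSeries K s) := by
  obtain ⟨hF1, hF1s⟩ := hasSum_zetaTerm_norm (K := K) hs
  rw [← hF1s]
  exact (hasSum_tent_reindex_mkFrac (zetaTerm s) hF1 fun g hg => if_neg hg).congr_fun
    fun J => (tsum_zetaTerm_one _ _).symm

lemma hasSum_weight_two {s : ℂ} (hs : 1 < s.re) :
    HasSum (fun J : (Ideal (𝓞 K))⁰ => (fnorm (principal (twoUnit K)) : ℂ) ^ s *
      ((fnorm (mkFrac J) : ℂ) ^ (-s) *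
      ∑' v : invLat (mkFrac J), weight (invLat (mkFrac J)) s (v + v : invLat (mkFrac J))))
      (zetaSeries K s) := by
  obtain ⟨hF1, hF1s⟩ := hasSum_zetaTerm_norm (K := K) hs
  have hF2 : Summable fun I : FracIdeals K => ‖zetaTerm s ((principal (twoUnit K))⁻¹ * I)‖ :=
    hF1.comp_injective (mul_right_injective (principal (twoUnit K))⁻¹)
  have hF2s : ∑' I : FracIdeals K, zetaTerm s ((principal (twoUnit K))⁻¹ * I) =
      zetaSeries K s := by
    rw [← hF1s]; exact (Equiv.mulLeft (principal (twoUnit K))⁻¹).tsum_eq (zetaTerm s)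
  rw [← hF2s]
  have hF0 : ∀ I : FracIdeals K, ¬ IsInt I → zetaTerm s ((principal (twoUnit K))⁻¹ * I) = 0 := by
    intro g hg
    refine if_neg fun h => hg ?_
    have := isInt_two.mul h
    rwa [mul_inv_cancel_left] at this
  exact (hasSum_tent_reindex_mkFrac _ hF2 hF0).congr_fun fun J => (tsum_zetaTerm_two _ _).symm

/-- The zeta series times its factor at two, as a series of weight differences over ideals. -/
lemma hasSum_weightDiff {s : ℂ} (hs : 1 < s.re) :
    HasSum (fun J : (Ideal (𝓞 K))⁰ =>
        ((Ideal.absNorm (J : Ideal (𝓞 K)) : ℝ) : ℂ) ^ (-s) * weightDiff (mkFrac J) s)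
      ((1 - 2 ^ Module.finrank ℚ K * ((2 ^ Module.finrank ℚ K : ℝ) : ℂ) ^ (-s)) *
        zetaSeries K s) := by
  set two := principal (twoUnit K) with htwo
  have H := (hasSum_weight (K := K) hs).sub
    ((hasSum_weight_two hs).mul_left (2 ^ Module.finrank ℚ K * (fnorm two : ℂ) ^ (-s)))
  have hval : zetaSeries K s - 2 ^ Module.finrank ℚ K * (fnorm two : ℂ) ^ (-s) * zetaSeries K s =
      (1 - 2 ^ Module.finrank ℚ K * ((2 ^ Module.finrank ℚ K : ℝ) : ℂ) ^ (-s)) *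
        zetaSeries K s := by
    rw [htwo, fnorm_two]; ring
  rw [hval] at H
  refine H.congr_fun fun J => ?_
  rw [weightDiff, fnorm_mkFrac, mul_sub]
  linear_combination ((2 : ℂ) ^ Module.finrank ℚ K *
      ((Ideal.absNorm (J : Ideal (𝓞 K)) : ℝ) : ℂ) ^ (-s) *
        (∑' v : invLat (mkFrac J), weight (invLat (mkFrac J)) s (v + v : invLat (mkFrac J)))) *
          fnorm_cpow_mul_cpow_neg two s

end EtaFunction

/-- A number field has a `ℚ`-basis of algebraic integers all of whose conjugates are at most
`Q` in absolute value. -/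
def HasSmallBasis (K : Type) [Field K] [NumberField K] (Q : ℝ) : Prop :=
  ∃ b : Module.Basis (Fin (Module.finrank ℚ K)) ℚ K, ∀ i, IsIntegral ℤ (b i) ∧ house (b i) ≤ Q

section SmallBasis

open scoped nonZeroDivisors

variable {K : Type} [Field K] [NumberField K]

lemma HasSmallBasis.one_le {Q : ℝ} (h : HasSmallBasis K Q) : 1 ≤ Q := by
  obtain ⟨b, hb⟩ := h
  have i : Fin (Module.finrank ℚ K) := Classical.arbitrary _
  exact (one_le_house_of_isIntegral (hb i).1 (b.ne_zero i)).trans (hb i).2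

lemma house_ratCast_mul (q : ℚ) (x : K) : house ((q : K) * x) = |(q : ℝ)| * house x := by
  rw [← norm_emb, ← norm_emb, map_mul]
  have : emb K (q : K) * emb K x = (q : ℂ) • emb K x := by
    funext i
    simp [emb_apply]
  rw [this, norm_smul, Complex.norm_ratCast]

/-- Box principle: the inverse of an ideal of large norm has a small element. -/
lemma exists_small_mem_inv {Q : ℝ} (h : HasSmallBasis K Q) (J : (Ideal (𝓞 K))⁰) :
    ∃ x : Kˣ, IsInt (principal x * mkFrac J) ∧ house (x : K) ≤ Module.finrank ℚ K * Q *
      (Ideal.absNorm (J : Ideal (𝓞 K)) : ℝ) ^ (-(1 : ℝ) / Module.finrank ℚ K) := by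
  have hQ : 1 ≤ Q := h.one_le
  unfold HasSmallBasis at h
  set n := Module.finrank ℚ K with hn
  obtain ⟨b, hb⟩ := h
  have hn0 : 0 < n := Module.finrank_pos
  have hn0' : (0 : ℝ) < n := by exact_mod_cast hn0
  set N := Ideal.absNorm (J : Ideal (𝓞 K)) with hN
  have hN0 : 0 < N := Ideal.absNorm_pos_of_nonZeroDivisors J
  have hN0' : (0 : ℝ) < N := by exact_mod_cast hN0
  obtain ⟨J', hJ'⟩ : (J : Ideal (𝓞 K)) ∣ Ideal.span {(N : 𝓞 K)} := by
    rw [Ideal.dvd_span_singleton]; exact Ideal.absNorm_mem _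
  have hJ'N : N * Ideal.absNorm J' = N ^ n := by
    have := congrArg Ideal.absNorm hJ'
    rw [Ideal.absNorm_span_natCast, RingOfIntegers.rank, map_mul] at this
    exact this.symm
  have hJN : Ideal.absNorm J' = N ^ (n - 1) := by
    have : N * Ideal.absNorm J' = N * N ^ (n - 1) := by
      rw [hJ'N, ← pow_succ', Nat.sub_add_cancel hn0]
    exact Nat.eq_of_mul_eq_mul_left hN0 this
  let B : Fin n → 𝓞 K := fun i => ⟨b i, (hb i).1⟩
  set y : ℝ := (N : ℝ) ^ (((n - 1 : ℕ) : ℝ) / n) with hy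
  have hy0 : 0 ≤ y := by positivity
  have hyn : y ^ n = (N : ℝ) ^ (n - 1) := by
    rw [hy, ← Real.rpow_mul_natCast hN0'.le, div_mul_cancel₀ _ hn0'.ne', Real.rpow_natCast]
  set M := ⌊y⌋₊ with hM
  let g : (Fin n → Fin (M + 1)) → 𝓞 K ⧸ J' := fun c =>
    Ideal.Quotient.mk J' (∑ i, ((c i : ℕ) : 𝓞 K) * B i)
  have hcard : Nat.card (𝓞 K ⧸ J') = N ^ (n - 1) := by
    rw [← hJN, Ideal.absNorm_apply, Submodule.cardQuot_apply]
  have hfin : Finite (𝓞 K ⧸ J') := Nat.finite_of_card_ne_zero (by rw [hcard]; positivity)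
  obtain ⟨c, c', hcc, hgc⟩ : ∃ c c', c ≠ c' ∧ g c = g c' := by
    by_contra! hinj
    have h1 := Nat.card_le_card_of_injective g fun c c' h => by
      by_contra hne
      exact hinj c c' hne h
    rw [hcard] at h1
    simp only [Nat.card_eq_fintype_card, Fintype.card_fun, Fintype.card_fin] at h1
    have h2 : y ^ n < ((M + 1 : ℕ) : ℝ) ^ n := by
      refine pow_lt_pow_left₀ ?_ hy0 hn0.ne'
      push_cast
      exact Nat.lt_floor_add_one y
    rw [hyn] at h2
    have h3 : N ^ (n - 1) < (M + 1) ^ n := by exact_mod_cast h2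
    omega
  let z : 𝓞 K := ∑ i, (((c i : ℕ) : ℤ) - ((c' i : ℕ) : ℤ) : ℤ) * B i
  have hzJ : z ∈ J' := by
    have := Ideal.Quotient.eq.1 hgc
    rw [← Finset.sum_sub_distrib] at this
    convert this using 1
    refine Finset.sum_congr rfl fun i _ => ?_
    push_cast; ring
  have hzcoe : (z : K) = ∑ i, (((((c i : ℕ) : ℤ) - ((c' i : ℕ) : ℤ) : ℤ) : ℚ) : K) * b i := by
    simp only [z, map_sum, map_mul, map_intCast]
    exact Finset.sum_congr rfl fun i _ => by rw [Rat.cast_intCast]; rfl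
  have hz0 : (z : K) ≠ 0 := by
    rw [hzcoe]
    intro h0
    have h1 : ∑ i, ((((c i : ℕ) : ℤ) - ((c' i : ℕ) : ℤ) : ℤ) : ℚ) • b i = 0 := by
      rw [← h0]
      exact Finset.sum_congr rfl fun i _ => Rat.smul_def _ _
    have h2 := Fintype.linearIndependent_iff.1 b.linearIndependent _ h1
    refine hcc (funext fun i => Fin.ext ?_)
    have := h2 i
    rw [Int.cast_eq_zero] at this
    omega
  have hNK : (N : K) ≠ 0 := by exact_mod_cast hN0.ne'
  refine ⟨Units.mk0 ((z : K) / N) (div_ne_zero hz0 hNK), ?_, ?_⟩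
  · rw [IsInt, Units.val_mul, coe_toPrincipalIdeal, Units.val_mk0, mkFrac, Units.val_mk0]
    rw [FractionalIdeal.spanSingleton_mul_le_iff]
    intro w hw
    obtain ⟨w', hw', rfl⟩ := (FractionalIdeal.mem_coeIdeal _).1 hw
    have h1 : w' * z ∈ Ideal.span {(N : 𝓞 K)} := by
      rw [hJ']; exact Ideal.mul_mem_mul hw' hzJ
    obtain ⟨t, ht⟩ := Ideal.mem_span_singleton'.1 h1
    refine (FractionalIdeal.mem_one_iff _).2 ⟨t, ?_⟩
    have h2 : (t : K) * N = w' * z := by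
      have := congrArg (algebraMap (𝓞 K) K) ht
      simpa using this
    change (t : K) = z / N * w'
    field_simp
    linear_combination h2
  · have h1 : house (z : K) ≤ n * (y * Q) := by
      rw [hzcoe]
      refine (house_sum_le_sum_house _ _).trans ?_
      calc _ ≤ ∑ i : Fin n, y * Q := by
            refine Finset.sum_le_sum fun i _ => ?_
            rw [house_ratCast_mul]
            refine mul_le_mul ?_ (hb i).2 (house_nonneg _) hy0
            have h1 : |((c i : ℕ) : ℤ) - ((c' i : ℕ) : ℤ)| ≤ M := by
              rw [abs_le]; have := (c i).2; have := (c' i).2; omega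
            calc _ ≤ (M : ℝ) := by exact_mod_cast h1
              _ ≤ y := Nat.floor_le hy0
        _ = _ := by simp
    have h2 : (z : K) / N = (((N : ℚ)⁻¹ : ℚ) : K) * z := by push_cast; field_simp
    rw [Units.val_mk0, h2, house_ratCast_mul]
    have h3 : |(((N : ℚ)⁻¹ : ℚ) : ℝ)| = (N : ℝ)⁻¹ := by
      push_cast; rw [abs_of_nonneg (by positivity)]
    rw [h3]
    calc (N : ℝ)⁻¹ * house (z : K) ≤ (N : ℝ)⁻¹ * (n * (y * Q)) := by gcongr
      _ = n * Q * ((N : ℝ)⁻¹ * y) := by ring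
      _ = _ := by
        rw [hy, ← Real.rpow_neg_one, ← Real.rpow_add hN0']
        congr 2
        rw [Nat.cast_sub hn0]
        push_cast
        field_simp
        ring

/-- Representatives modulo two in a group with a finite integral basis. -/
lemma bijective_digits {M ι : Type*} [AddCommGroup M] [Fintype ι] (e : Module.Basis ι ℤ M)
    (w : (ι → Fin 2) → M) :
    Function.Bijective fun x : (ι → Fin 2) × M =>
      (∑ i, ((x.1 i : ℕ) : ℤ) • e i - (w x.1 + w x.1)) + x.2 + x.2 := by
  have hrepr : ∀ (x : (ι → Fin 2) × M) (i : ι),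
      e.repr ((∑ i, ((x.1 i : ℕ) : ℤ) • e i - (w x.1 + w x.1)) + x.2 + x.2) i =
        ((x.1 i : ℕ) : ℤ) + 2 * (e.repr (x.2 - w x.1) i) := by
    intro x i
    have : (∑ i, ((x.1 i : ℕ) : ℤ) • e i - (w x.1 + w x.1)) + x.2 + x.2 =
        ∑ i, ((x.1 i : ℕ) : ℤ) • e i + (2 : ℤ) • (x.2 - w x.1) := by
      rw [two_smul]; abel
    rw [this, map_add, Finsupp.add_apply, e.repr_sum_self, map_smul, Finsupp.smul_apply,
      smul_eq_mul]
  constructor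
  · rintro ⟨k, v⟩ ⟨k', v'⟩ h
    have h1 : ∀ i, ((k i : ℕ) : ℤ) + 2 * (e.repr (v - w k) i) =
        ((k' i : ℕ) : ℤ) + 2 * (e.repr (v' - w k') i) := fun i => by
      have := congrArg (fun t => e.repr t i) h
      simp only at this
      rwa [hrepr ⟨k, v⟩ i, hrepr ⟨k', v'⟩ i] at this
    have hk : k = k' := funext fun i => Fin.ext (by
      have := h1 i; have := (k i).2; have := (k' i).2; omega)
    subst hk
    have hv : v - w k = v' - w k := e.ext_elem fun i => by have := h1 i; omega
    rw [sub_left_inj] at hv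
    rw [hv]
  · intro m
    let k : ι → Fin 2 := fun i => ⟨(e.repr m i % 2).toNat, by omega⟩
    refine ⟨⟨k, ∑ i, (e.repr m i / 2) • e i + w k⟩, e.ext_elem fun i => ?_⟩
    rw [hrepr, add_sub_cancel_right, e.repr_sum_self]
    simp only [k]
    omega

lemma exists_small_translate {Q : ℝ} (h : HasSmallBasis K Q) (I : FracIdeals K) (x₀ : Kˣ)
    (hx₀ : IsInt (principal x₀ * I)) (x : K) :
    ∃ y ∈ ((I⁻¹ : FracIdeals K) : FractionalIdeal (𝓞 K)⁰ K),
      house (x - (y + y)) ≤ Module.finrank ℚ K * Q * house (x₀ : K) := by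
  obtain ⟨b, hb⟩ := h
  have hm := (mem_inv_iff_isInt I x₀).2 hx₀
  let c := b.repr (x / x₀)
  refine ⟨∑ i, (round (c i / 2) : K) * b i * x₀, ?_, ?_⟩
  · refine Submodule.sum_mem _ fun i _ => ?_
    have h1 : IsIntegral ℤ ((round (c i / 2) : K) * b i) :=
      IsIntegral.mul (isIntegral_algebraMap (R := ℤ)) (hb i).1
    exact Submodule.smul_mem _ (⟨_, h1⟩ : 𝓞 K) hm
  · have h1 : x - (∑ i, (round (c i / 2) : K) * b i * x₀ + ∑ i, (round (c i / 2) : K) * b i * x₀) =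
        ∑ i, ((c i - 2 * round (c i / 2) : ℚ) : K) * (b i * x₀) := by
      have h2 : x = ∑ i, ((c i : ℚ) : K) * (b i * x₀) := by
        have := b.sum_repr (x / x₀)
        rw [eq_div_iff (Units.ne_zero x₀)] at this
        rw [← this, Finset.sum_mul]
        exact Finset.sum_congr rfl fun i _ => by rw [Rat.smul_def]; ring
      conv_lhs => rw [h2]
      rw [← Finset.sum_add_distrib, ← Finset.sum_sub_distrib]
      refine Finset.sum_congr rfl fun i _ => ?_
      push_cast; ring
    rw [h1]
    refine (house_sum_le_sum_house _ _).trans ?_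
    calc _ ≤ ∑ i : Fin (Module.finrank ℚ K), Q * house (x₀ : K) := by
          refine Finset.sum_le_sum fun i _ => ?_
          rw [house_ratCast_mul]
          have h2 : |c i - 2 * round (c i / 2)| ≤ 1 := by
            have := abs_sub_round (c i / 2)
            rw [abs_le] at this ⊢
            constructor <;> linarith
          have h3 : |((c i - 2 * round (c i / 2) : ℚ) : ℝ)| ≤ 1 := by exact_mod_cast h2
          calc _ ≤ 1 * house (b i * x₀) := by
                gcongr; exact house_nonneg _
            _ ≤ house (b i) * house (x₀ : K) := by rw [one_mul]; exact house_mul_le _ _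
            _ ≤ _ := by
                gcongr
                · exact house_nonneg _
                · exact (hb i).2
      _ = _ := by simp [mul_assoc]

/-- Uniform bound for the weight differences. -/
lemma exists_norm_weightDiff_le (n : ℕ) : ∃ C : ℝ, 0 < C ∧
    ∀ (K : Type) [Field K] [NumberField K], Module.finrank ℚ K = n → ∀ Q : ℝ, HasSmallBasis K Q →
      ∀ (J : (Ideal (𝓞 K))⁰) (s : ℂ), 0 ≤ s.re → s.re ≤ 4 →
        ‖weightDiff (mkFrac J) s‖ ≤ C * Q ^ 2 * (1 + ‖s‖) *
          (Ideal.absNorm (J : Ideal (𝓞 K)) : ℝ) ^ (-(1 : ℝ) / n) := by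
  obtain ⟨C, hC, hmain⟩ := exists_norm_weight_sum_sub_le (Fin n)
  refine ⟨C * 2 ^ n * (n + 1) ^ 2, by positivity, ?_⟩
  intro K _ _ hn Q hQ J s h0 h4
  subst hn
  obtain ⟨x₀, hx₀, hx₀h⟩ := exists_small_mem_inv hQ J
  have hQ1 := hQ.one_le
  set I := mkFrac J
  set δ := Module.finrank ℚ K * Q * house (x₀ : K) with hδ
  let L : Submodule (𝓞 K) K := ((I⁻¹ : FracIdeals K) : FractionalIdeal (𝓞 K)⁰ K)
  let e : Module.Basis _ ℤ L :=
    fractionalIdealBasis K ((I⁻¹ : FracIdeals K) : FractionalIdeal (𝓞 K)⁰ K)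
  let e' := e.reindex (Fintype.equivFinOfCardEq (n := Module.finrank ℚ K) (by
    rw [← Module.finrank_eq_card_chooseBasisIndex, fractionalIdeal_rank, RingOfIntegers.rank]))
  let f : L → invLat I := fun x =>
    ⟨emb K x, mem_invLat.2 ⟨x, x.2, rfl⟩⟩
  have hfadd : ∀ x y, f (x + y) = f x + f y := fun x y => Subtype.ext (map_add (emb K) (x : K) y)
  have hfb : Function.Bijective f := by
    constructor
    · intro x y h
      exact Subtype.ext (emb_injective K (congrArg Subtype.val h))
    · rintro ⟨v, hv⟩
      obtain ⟨x, hx, rfl⟩ := mem_invLat.1 hv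
      exact ⟨⟨x, hx⟩, rfl⟩
  choose w hw hwh using fun k : Fin (Module.finrank ℚ K) → Fin 2 =>
    exists_small_translate hQ I x₀ hx₀ (∑ i, ((k i : ℕ) : ℤ) • e' i : L)
  let w' : (Fin (Module.finrank ℚ K) → Fin 2) →
      L := fun k => ⟨w k, hw k⟩
  have hbij := bijective_digits e' w'
  let r : (Fin (Module.finrank ℚ K) → Fin 2) → invLat I := fun k =>
    f (∑ i, ((k i : ℕ) : ℤ) • e' i - (w' k + w' k))
  have hr : ∀ k, ‖r k‖ ≤ δ := fun k => by
    have : ‖r k‖ = house (((∑ i, ((k i : ℕ) : ℤ) • e' i :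
      L) : K) - (w k + w k)) := by
      rw [← norm_emb]; rfl
    rw [this]; exact hwh k
  have hrb : Function.Bijective fun p : (Fin (Module.finrank ℚ K) → Fin 2) × invLat I =>
      r p.1 + p.2 + p.2 := by
    have h1 : (fun p : (Fin (Module.finrank ℚ K) → Fin 2) × invLat I => r p.1 + p.2 + p.2) ∘
        (Prod.map id f) = f ∘ fun x : (Fin (Module.finrank ℚ K) → Fin 2) ×
          L =>
        (∑ i, ((x.1 i : ℕ) : ℤ) • e' i - (w' x.1 + w' x.1)) + x.2 + x.2 := by
      funext x
      simp only [Function.comp_apply, Prod.map, id, hfadd, r]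
    have h2 := hfb.comp hbij
    rw [← h1] at h2
    exact (Function.Bijective.of_comp_iff _ (Function.bijective_id.prodMap hfb)).1 h2
  have := hmain (invLat I) (invLat_locallyFin I) (Fin (Module.finrank ℚ K) → Fin 2) r δ hr hrb s h0 h4
  have hcard : Fintype.card (Fin (Module.finrank ℚ K) → Fin 2) = 2 ^ Module.finrank ℚ K := by simp
  rw [hcard] at this
  push_cast at this
  refine this.trans ?_
  set N := (Ideal.absNorm (J : Ideal (𝓞 K)) : ℝ)
  set n := Module.finrank ℚ K
  have hδ2 : δ ≤ (n + 1) ^ 2 * Q ^ 2 * N ^ (-(1 : ℝ) / n) := by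
    calc δ ≤ n * Q * (n * Q * N ^ (-(1 : ℝ) / n)) := by rw [hδ]; gcongr
      _ = (n : ℝ) ^ 2 * Q ^ 2 * N ^ (-(1 : ℝ) / n) := by ring
      _ ≤ _ := by gcongr; linarith
  calc C * 2 ^ n * (1 + ‖s‖) * δ
      ≤ C * 2 ^ n * (1 + ‖s‖) * ((n + 1) ^ 2 * Q ^ 2 * N ^ (-(1 : ℝ) / n)) := by gcongr
    _ = _ := by ring

end SmallBasis

section WeightAnalytic

lemma differentiable_weight {ι : Type} [Fintype ι] (Λ : AddSubgroup (ι → ℂ)) (x : ι → ℂ) :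
    Differentiable ℂ fun s => weight Λ s x := by
  by_cases h : tent x⁻¹ = 0
  · simp only [weight_eq_zero h]
    exact differentiable_const _
  · have hpos : 0 < ∏ i, ‖x i‖ := (nearOne_of_tent_inv_ne_zero h).prod_pos
    have hne : ((∏ i, ‖x i‖ : ℝ) : ℂ) ≠ 0 := by exact_mod_cast hpos.ne'
    unfold weight
    exact (differentiable_id.neg.const_cpow (Or.inl hne)).mul_const _

lemma differentiable_tsum_weight {ι : Type} [Fintype ι] {Λ : AddSubgroup (ι → ℂ)} {κ : Type*}
    {f : κ → ι → ℂ} (hf : {k | tent (f k)⁻¹ ≠ 0}.Finite) :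
    Differentiable ℂ fun s => ∑' k, weight Λ s (f k) := by
  have : (fun s => ∑' k, weight Λ s (f k)) = fun s => ∑ k ∈ hf.toFinset, weight Λ s (f k) := by
    funext s
    refine tsum_eq_sum fun k hk => weight_eq_zero ?_
    simpa using hk
  rw [this]
  exact Differentiable.fun_sum fun k _ => differentiable_weight Λ (f k)

end WeightAnalytic

section EtaFun

open scoped nonZeroDivisors

variable {K : Type} [Field K] [NumberField K]

lemma differentiable_weightDiff (I : FracIdeals K) : Differentiable ℂ (weightDiff I) := by
  have h := invLat_locallyFin I (4 / 3)
  refine Differentiable.sub (differentiable_tsum_weight (h.subset fun v hv => ?_))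
    (Differentiable.const_mul (differentiable_tsum_weight (f := fun v : invLat I =>
      ((v + v : invLat I) : Fin (Module.finrank ℚ K) → ℂ))
      ((h.preimage (f := fun v : invLat I => v + v) ?_).subset fun v hv => ?_)) _)
  · exact norm_le_of_tent_inv_ne_zero hv
  · intro v _ w _ hvw
    simp only [← two_nsmul] at hvw
    refine Subtype.ext ?_
    have := congrArg Subtype.val hvw
    simp only [AddSubgroup.coe_nsmul] at this
    exact smul_right_injective _ (two_ne_zero (α := ℕ)) this
  · exact norm_le_of_tent_inv_ne_zero hv

/-- The analytic continuation of `(1 - 2 ^ (n (1 - s))) * ζ_K s` slightly beyond `Re s = 1`. -/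
noncomputable def etaFun (K : Type) [Field K] [NumberField K] (s : ℂ) : ℂ :=
  ∑' J : (Ideal (𝓞 K))⁰,
    ((Ideal.absNorm (J : Ideal (𝓞 K)) : ℝ) : ℂ) ^ (-s) * weightDiff (mkFrac J) s

lemma etaFun_eq {s : ℂ} (hs : 1 < s.re) :
    etaFun K s = (1 - 2 ^ Module.finrank ℚ K *
      ((2 ^ Module.finrank ℚ K : ℝ) : ℂ) ^ (-s)) * zetaSeries K s :=
  (hasSum_weightDiff hs).tsum_eq

lemma one_sub_inv_finrank_nonneg : 0 ≤ 1 - 1 / (Module.finrank ℚ K : ℝ) := by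
  have : (1 : ℝ) ≤ Module.finrank ℚ K := by exact_mod_cast (Module.finrank_pos (R := ℚ) (M := K))
  rw [sub_nonneg, div_le_one (by linarith)]
  exact this

/-- Termwise bound for the series defining `etaFun`. -/
lemma exists_norm_etaFun_term_le (n : ℕ) : ∃ C : ℝ, 0 < C ∧
    ∀ (K : Type) [Field K] [NumberField K], Module.finrank ℚ K = n → ∀ Q : ℝ, HasSmallBasis K Q →
      ∀ (J : (Ideal (𝓞 K))⁰) (σ : ℝ) (s : ℂ), 0 ≤ σ → σ ≤ s.re → s.re ≤ 4 →
        ‖((Ideal.absNorm (J : Ideal (𝓞 K)) : ℝ) : ℂ) ^ (-s) * weightDiff (mkFrac J) s‖ ≤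
          C * Q ^ 2 * (1 + ‖s‖) *
            (Ideal.absNorm (J : Ideal (𝓞 K)) : ℝ) ^ (-(σ + (1 : ℝ) / n)) := by
  obtain ⟨C, hC, h⟩ := exists_norm_weightDiff_le n
  refine ⟨C, hC, fun K _ _ hn Q hQ J σ s h0 hσ h4 => ?_⟩
  rw [norm_mul, norm_ofReal_cpow_neg (absNorm_pos J)]
  have h1 := h K hn Q hQ J s (h0.trans hσ) h4
  have h2 : (Ideal.absNorm (J : Ideal (𝓞 K)) : ℝ) ^ (-s.re) ≤
      (Ideal.absNorm (J : Ideal (𝓞 K)) : ℝ) ^ (-σ) :=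
    Real.rpow_le_rpow_of_exponent_le (one_le_absNorm J) (by linarith)
  have h3 := absNorm_pos J
  calc _ ≤ (Ideal.absNorm (J : Ideal (𝓞 K)) : ℝ) ^ (-σ) * (C * Q ^ 2 * (1 + ‖s‖) *
          (Ideal.absNorm (J : Ideal (𝓞 K)) : ℝ) ^ (-(1 : ℝ) / n)) := by gcongr
    _ = C * Q ^ 2 * (1 + ‖s‖) * ((Ideal.absNorm (J : Ideal (𝓞 K)) : ℝ) ^ (-σ) *
          (Ideal.absNorm (J : Ideal (𝓞 K)) : ℝ) ^ (-(1 : ℝ) / n)) := by ring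
    _ = _ := by
      rw [← Real.rpow_add h3]
      congr 2
      ring

lemma exists_norm_etaFun_le (n : ℕ) : ∃ C : ℝ, 0 < C ∧
    ∀ (K : Type) [Field K] [NumberField K], Module.finrank ℚ K = n → ∀ Q : ℝ, HasSmallBasis K Q →
      ∀ s : ℂ, 1 - 1 / (2 * n : ℝ) ≤ s.re → s.re ≤ 4 →
        ‖etaFun K s‖ ≤ C * Q ^ 2 * (1 + ‖s‖) := by
  obtain ⟨C, hC, h⟩ := exists_norm_etaFun_term_le n
  rcases Nat.eq_zero_or_pos n with rfl | hn0
  · refine ⟨1, one_pos, fun K _ _ hn => ?_⟩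
    exact absurd hn (Module.finrank_pos (R := ℚ) (M := K)).ne'
  have hn0' : (1 : ℝ) ≤ n := by exact_mod_cast hn0
  refine ⟨C * (natZeta (1 + 1 / (2 * n : ℝ)) ^ n + 1), ?_, ?_⟩
  · have : 0 ≤ natZeta (1 + 1 / (2 * n : ℝ)) := tsum_nonneg fun _ => by positivity
    positivity
  intro K _ _ hn Q hQ s hs h4
  have hσ : (1 : ℝ) < 1 + 1 / (2 * n : ℝ) := by
    have : 0 < 1 / (2 * n : ℝ) := by positivity
    linarith
  have h1 : ∀ J : (Ideal (𝓞 K))⁰,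
      ‖((Ideal.absNorm (J : Ideal (𝓞 K)) : ℝ) : ℂ) ^ (-s) * weightDiff (mkFrac J) s‖ ≤
        C * Q ^ 2 * (1 + ‖s‖) * (Ideal.absNorm (J : Ideal (𝓞 K)) : ℝ) ^ (-(1 + 1 / (2 * n : ℝ))) := by
    intro J
    convert h K hn Q hQ J (1 - 1 / (2 * n : ℝ)) s ?_ hs h4 using 3
    · field_simp; ring
    · rw [sub_nonneg, div_le_one (by linarith)]; linarith
  refine (tsum_of_norm_bounded (((summable_ideal_rpow hσ).hasSum).mul_left _) h1).trans ?_
  have h2 := tsum_ideal_rpow_le (K := K) hσ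
  rw [hn] at h2
  have hQ1 := hQ.one_le
  calc _ ≤ C * Q ^ 2 * (1 + ‖s‖) * natZeta (1 + 1 / (2 * n : ℝ)) ^ n := by gcongr
    _ ≤ C * Q ^ 2 * (1 + ‖s‖) * (natZeta (1 + 1 / (2 * n : ℝ)) ^ n + 1) := by gcongr; linarith
    _ = _ := by ring

lemma differentiableAt_etaFun {Q : ℝ} (hQ : HasSmallBasis K Q) {s : ℂ}
    (hs : 1 - 1 / (Module.finrank ℚ K : ℝ) < s.re) (h4 : s.re < 4) :
    DifferentiableAt ℂ (etaFun K) s := by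
  obtain ⟨C, hC, h⟩ := exists_norm_etaFun_term_le (Module.finrank ℚ K)
  have hn := one_sub_inv_finrank_nonneg (K := K)
  obtain ⟨σ, hσ1, hσ2⟩ := exists_between hs
  let U : Set ℂ := {z | σ < z.re} ∩ {z | z.re < 4} ∩ {z | ‖z‖ < ‖s‖ + 1}
  have hU : IsOpen U := ((isOpen_lt continuous_const Complex.continuous_re).inter
    (isOpen_lt Complex.continuous_re continuous_const)).inter
    (isOpen_lt continuous_norm continuous_const)
  have hsU : s ∈ U := ⟨⟨hσ2, h4⟩, by simp [Set.mem_ofPred_eq]⟩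
  refine DifferentiableOn.differentiableAt ?_ (hU.mem_nhds hsU)
  have hQ1 := hQ.one_le
  refine Complex.differentiableOn_tsum_of_summable_norm
    (u := fun J : (Ideal (𝓞 K))⁰ => C * Q ^ 2 * (1 + (‖s‖ + 1)) *
      (Ideal.absNorm (J : Ideal (𝓞 K)) : ℝ) ^ (-(σ + (1 : ℝ) / Module.finrank ℚ K)))
    ((summable_ideal_rpow (by linarith)).mul_left _) (fun J => ?_) hU fun J z hz => ?_
  · have hne : ((Ideal.absNorm (J : Ideal (𝓞 K)) : ℝ) : ℂ) ≠ 0 := by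
      exact_mod_cast (absNorm_pos J).ne'
    exact ((differentiable_id.neg.const_cpow (Or.inl hne)).mul
      (differentiable_weightDiff _)).differentiableOn
  · refine (h K rfl Q hQ J σ z (by linarith) hz.1.1.le hz.1.2.le).trans ?_
    have := hz.2
    rw [Set.mem_ofPred_eq] at this
    gcongr

end EtaFun

section LowerBound

open scoped nonZeroDivisors

variable {K : Type} [Field K] [NumberField K]

lemma absNorm_span_eq_prod_norm_emb (x : 𝓞 K) :
    (Ideal.absNorm (Ideal.span {x}) : ℝ) = ∏ i, ‖emb K (x : K) i‖ := by
  rw [prod_norm_emb, Ideal.absNorm_span_singleton, ← Algebra.coe_norm_int, Nat.cast_natAbs,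
    Rat.cast_intCast, Int.cast_abs]

lemma norm_emb_mem_of_house_sub_le {x : K} {R : ℝ} (r : ℕ) (hr : (r : ℝ) = R)
    (h : house (x - r) ≤ R / 8) (i) :
    7 / 8 * R ≤ ‖emb K x i‖ ∧ ‖emb K x i‖ ≤ 9 / 8 * R := by
  have h1 : ‖emb K x i - r‖ ≤ R / 8 := by
    have := (norm_embedding_le_house (x - r) (embEquiv K i)).trans h
    rwa [map_sub, map_natCast] at this
  have h2 := abs_norm_sub_norm_le (emb K x i) r
  rw [Complex.norm_natCast, hr, abs_le] at h2
  constructor <;> linarith [h2.1, h2.2]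

/-- Algebraic integers close to the same natural number generate different ideals. -/
lemma eq_of_span_eq_of_house_sub_le {x y : 𝓞 K} {R : ℝ} (hR : 0 < R) (r : ℕ) (hr : (r : ℝ) = R)
    (hx : house ((x : K) - r) ≤ R / 8) (hy : house ((y : K) - r) ≤ R / 8)
    (h : Ideal.span {x} = Ideal.span {y}) : x = y := by
  obtain ⟨u, hu⟩ := Ideal.span_singleton_eq_span_singleton.1 h
  by_contra hne
  have hu1 : ((u : 𝓞 K) : K) - 1 ≠ 0 := by
    intro h0
    have : (u : 𝓞 K) = 1 := RingOfIntegers.ext (by rw [sub_eq_zero] at h0; simpa using h0)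
    rw [this, mul_one] at hu
    exact hne hu
  have h1 : 1 ≤ house (((u : 𝓞 K) : K) - 1) :=
    one_le_house_of_isIntegral ((u : 𝓞 K).2.sub isIntegral_one) hu1
  have h2 : house (((u : 𝓞 K) : K) - 1) ≤ 1 / 2 := by
    rw [← norm_emb, pi_norm_le_iff_of_nonneg (by norm_num)]
    intro i
    have hxi := norm_emb_mem_of_house_sub_le r hr hx i
    have h3 : emb K (x : K) i * emb K (((u : 𝓞 K) : K) - 1) i =
        emb K ((y : K) - r) i - emb K ((x : K) - r) i := by
      have : (y : K) = x * (u : 𝓞 K) := by rw [← hu]; simp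
      simp only [emb_apply]
      rw [← map_mul, ← map_sub, this]
      congr 1
      ring
    have h4 : ‖emb K (x : K) i * emb K (((u : 𝓞 K) : K) - 1) i‖ ≤ R / 8 + R / 8 := by
      rw [h3]
      refine (norm_sub_le _ _).trans (add_le_add ?_ ?_)
      · exact (norm_embedding_le_house _ (embEquiv K i)).trans hy
      · exact (norm_embedding_le_house _ (embEquiv K i)).trans hx
    rw [norm_mul] at h4
    nlinarith [norm_nonneg (emb K (((u : 𝓞 K) : K) - 1) i), hxi.1]
  linarith

lemma geom_le_tsum_ideal {Q : ℝ} (hQ : HasSmallBasis K Q) {s : ℝ} (hs : 1 < s) (L : ℕ) :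
    (8 * Module.finrank ℚ K * Q) ^ (-(Module.finrank ℚ K : ℝ)) *
      (9 / 8 : ℝ) ^ (-(Module.finrank ℚ K * s)) *
      ∑ k ∈ Finset.range L, ((2 : ℝ) ^ (Module.finrank ℚ K * (1 - s))) ^ k ≤
      ∑' J : (Ideal (𝓞 K))⁰, (Ideal.absNorm (J : Ideal (𝓞 K)) : ℝ) ^ (-s) := by
  have hQ1 := hQ.one_le
  unfold HasSmallBasis at hQ
  set n := Module.finrank ℚ K with hn
  obtain ⟨b, hb⟩ := hQ
  have hn0 : 0 < n := Module.finrank_pos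
  have hn0' : (0 : ℝ) < n := by exact_mod_cast hn0
  let B : Fin n → 𝓞 K := fun i => ⟨b i, (hb i).1⟩
  let M : ℕ → ℕ := fun k => ⌊(2 : ℝ) ^ k / (8 * n * Q)⌋₊
  let T := Σ k : Fin L, Fin n → Fin (M k + 1)
  let x : T → 𝓞 K := fun t => ((2 ^ (t.1 : ℕ) : ℕ) : 𝓞 K) + ∑ i, ((t.2 i : ℕ) : 𝓞 K) * B i
  have hxcoe : ∀ t, (x t : K) - ((2 ^ (t.1 : ℕ) : ℕ) : K) =
      ∑ i, (((t.2 i : ℕ) : ℚ) : K) * b i := by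
    intro t
    simp only [x, map_add, map_sum, map_mul, map_natCast, add_sub_cancel_left]
    exact Finset.sum_congr rfl fun i _ => by rw [Rat.cast_natCast]; rfl
  have hR : ∀ t : T, ((2 ^ (t.1 : ℕ) : ℕ) : ℝ) = 2 ^ (t.1 : ℕ) := fun t => by push_cast; rfl
  have hxh : ∀ t, house ((x t : K) - ((2 ^ (t.1 : ℕ) : ℕ) : K)) ≤ 2 ^ (t.1 : ℕ) / 8 := by
    intro t
    rw [hxcoe]
    refine (house_sum_le_sum_house _ _).trans ?_
    calc _ ≤ ∑ i : Fin n, 2 ^ (t.1 : ℕ) / (8 * n * Q) * Q := by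
          refine Finset.sum_le_sum fun i _ => ?_
          rw [house_ratCast_mul]
          refine mul_le_mul ?_ (hb i).2 (house_nonneg _) (by positivity)
          rw [Rat.cast_natCast, abs_of_nonneg (by positivity)]
          calc ((t.2 i : ℕ) : ℝ) ≤ (M t.1 : ℝ) := by exact_mod_cast Nat.lt_succ_iff.1 (t.2 i).2
            _ ≤ _ := Nat.floor_le (by positivity)
      _ = _ := by
        rw [Finset.sum_const, Finset.card_univ, Fintype.card_fin, nsmul_eq_mul]
        field_simp
  have hbd := fun t i => norm_emb_mem_of_house_sub_le _ (hR t) (hxh t) i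
  have hNle : ∀ t, (Ideal.absNorm (Ideal.span {x t}) : ℝ) ≤ (9 / 8 * 2 ^ (t.1 : ℕ)) ^ n := by
    intro t
    rw [absNorm_span_eq_prod_norm_emb]
    calc _ ≤ ∏ i : Fin n, (9 / 8 * 2 ^ (t.1 : ℕ) : ℝ) :=
          Finset.prod_le_prod (fun _ _ => norm_nonneg _) fun i _ => (hbd t i).2
      _ = _ := by simp
  have hNge : ∀ t, (7 / 8 * 2 ^ (t.1 : ℕ)) ^ n ≤ (Ideal.absNorm (Ideal.span {x t}) : ℝ) := by
    intro t
    rw [absNorm_span_eq_prod_norm_emb]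
    calc (7 / 8 * 2 ^ (t.1 : ℕ) : ℝ) ^ n = ∏ i : Fin n, (7 / 8 * 2 ^ (t.1 : ℕ) : ℝ) := by simp
      _ ≤ _ := Finset.prod_le_prod (fun _ _ => by positivity) fun i _ => (hbd t i).1
  have hNpos : ∀ t, (0 : ℝ) < Ideal.absNorm (Ideal.span {x t}) := fun t =>
    lt_of_lt_of_le (by positivity) (hNge t)
  let f : T → (Ideal (𝓞 K))⁰ := fun t => ⟨Ideal.span {x t}, mem_nonZeroDivisors_iff_ne_zero.2
    fun h0 => by
      have := hNpos t
      rw [h0] at this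
      simp at this⟩
  have hlt : ∀ t t' : T, (t.1 : ℕ) < t'.1 → f t ≠ f t' := by
    intro t t' hk h
    have h1 : Ideal.span {x t} = Ideal.span {x t'} := congrArg Subtype.val h
    have h2 := (hNge t').trans_eq (by rw [h1]) |>.trans (hNle t)
    have h3 := lt_of_pow_lt_pow_left₀ n (by positivity) (lt_of_le_of_lt h2
      (pow_lt_pow_left₀ (show (9 / 8 * 2 ^ (t.1 : ℕ) : ℝ) < 5 / 4 * 2 ^ (t.1 : ℕ) by
        have : (0 : ℝ) < 2 ^ (t.1 : ℕ) := by positivity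
        linarith) (by positivity) hn0.ne'))
    have h4 : (2 : ℝ) ^ ((t.1 : ℕ) + 1) ≤ 2 ^ (t'.1 : ℕ) := pow_le_pow_right₀ (by norm_num) hk
    rw [pow_succ] at h4
    have : (0 : ℝ) < 2 ^ (t.1 : ℕ) := by positivity
    linarith
  have hf : Function.Injective f := by
    rintro ⟨k, m⟩ ⟨k', m'⟩ h
    have hk : k = k' := by
      rcases lt_trichotomy k k' with h1 | h1 | h1
      · exact absurd h (hlt _ _ h1)
      · exact h1
      · exact absurd h.symm (hlt _ _ h1)
    subst hk
    have h1 := eq_of_span_eq_of_house_sub_le (by positivity) _ (hR ⟨k, m⟩) (hxh ⟨k, m⟩) (hxh ⟨k, m'⟩)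
      (congrArg Subtype.val h)
    have h2 : ∑ i, (((m i : ℕ) : ℚ)) • b i = ∑ i, (((m' i : ℕ) : ℚ)) • b i := by
      have e1 := hxcoe ⟨k, m⟩
      have e2 := hxcoe ⟨k, m'⟩
      rw [h1, e2] at e1
      simp only [Rat.smul_def]
      exact e1.symm
    have h3 : ∑ i, (((m i : ℕ) : ℚ) - ((m' i : ℕ) : ℚ)) • b i = 0 := by
      simp only [sub_smul, Finset.sum_sub_distrib, h2, sub_self]
    have h4 := Fintype.linearIndependent_iff.1 b.linearIndependent _ h3
    have h5 : m = m' := funext fun i => Fin.ext (by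
      have := h4 i
      rw [sub_eq_zero] at this
      exact_mod_cast this)
    rw [h5]
  have hsum : ∑ t : T, (Ideal.absNorm ((f t : Ideal (𝓞 K))) : ℝ) ^ (-s) ≤
      ∑' J : (Ideal (𝓞 K))⁰, (Ideal.absNorm (J : Ideal (𝓞 K)) : ℝ) ^ (-s) := by
    have := (summable_ideal_rpow (K := K) hs).sum_le_tsum (Finset.univ.map ⟨f, hf⟩)
      fun _ _ => by positivity
    rwa [Finset.sum_map] at this
  refine le_trans ?_ hsum
  rw [Fintype.sum_sigma, ← Fin.sum_univ_eq_sum_range, Finset.mul_sum]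
  refine Finset.sum_le_sum fun k _ => ?_
  have h1 : ∀ m : Fin n → Fin (M k + 1), (9 / 8 * 2 ^ (k : ℕ) : ℝ) ^ (-(n * s)) ≤
      (Ideal.absNorm ((f ⟨k, m⟩ : Ideal (𝓞 K))) : ℝ) ^ (-s) := by
    intro m
    have h2 : (9 / 8 * 2 ^ (k : ℕ) : ℝ) ^ (-(n * s)) = ((9 / 8 * 2 ^ (k : ℕ) : ℝ) ^ n) ^ (-s) := by
      rw [← Real.rpow_natCast_mul (by positivity)]
      ring_nf
    rw [h2]
    exact Real.rpow_le_rpow_of_nonpos (hNpos ⟨k, m⟩) (hNle ⟨k, m⟩) (by linarith)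
  refine le_trans ?_ (Finset.sum_le_sum fun m _ => h1 m)
  rw [Finset.sum_const, Finset.card_univ, Fintype.card_fun, Fintype.card_fin, Fintype.card_fin,
    nsmul_eq_mul]
  have h2 : ((2 : ℝ) ^ (k : ℕ) / (8 * n * Q)) ^ n ≤ ((M k + 1 : ℕ) ^ n : ℕ) := by
    push_cast
    exact pow_le_pow_left₀ (by positivity) (Nat.lt_floor_add_one _).le n
  calc _ = ((2 : ℝ) ^ (k : ℕ) / (8 * n * Q)) ^ n * (9 / 8 * 2 ^ (k : ℕ) : ℝ) ^ (-(n * s)) := by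
        rw [Real.mul_rpow (x := 9 / 8) (by norm_num) (by positivity), div_pow,
          Real.rpow_neg (x := 8 * n * Q) (by positivity), Real.rpow_natCast,
          ← Real.rpow_natCast_mul (by norm_num), ← Real.rpow_mul_natCast (by norm_num), ← pow_mul,
          ← Real.rpow_natCast 2 (_ * n)]
        have : (2 : ℝ) ^ (n * (1 - s) * (k : ℕ)) = 2 ^ (((k : ℕ) * n : ℕ) : ℝ) *
            2 ^ ((k : ℕ) * -(n * s)) := by
          rw [← Real.rpow_add (by norm_num)]
          congr 1
          push_cast; ring
        rw [this]
        ring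
    _ ≤ _ := by gcongr

/-- Lower bound for `etaFun` at `1`. -/
lemma le_norm_etaFun_one {Q : ℝ} (hQ : HasSmallBasis K Q) :
    (16 * Module.finrank ℚ K * Q) ^ (-(Module.finrank ℚ K : ℝ)) ≤ ‖etaFun K 1‖ := by
  have hQ1 := hQ.one_le
  have hdiff : DifferentiableAt ℂ (etaFun K) 1 := by
    refine differentiableAt_etaFun hQ ?_ (by norm_num)
    have : (0 : ℝ) < Module.finrank ℚ K := by
      exact_mod_cast (Module.finrank_pos (R := ℚ) (M := K))
    simp [this]
  set n := Module.finrank ℚ K with hn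
  have hn0 : 0 < n := Module.finrank_pos
  have hn0' : (0 : ℝ) < n := by exact_mod_cast hn0
  have hlim : Filter.Tendsto (fun t : ℝ => ‖etaFun K (t : ℂ)‖) (nhdsWithin 1 (Set.Ioi 1))
      (nhds ‖etaFun K 1‖) := by
    have h1 : ContinuousAt (fun t : ℝ => ‖etaFun K (t : ℂ)‖) 1 := by
      have h0 : ContinuousAt (etaFun K) ((1 : ℝ) : ℂ) := by simpa using hdiff.continuousAt
      exact (h0.comp Complex.continuous_ofReal.continuousAt).norm
    have h2 := h1.tendsto
    rw [Complex.ofReal_one] at h2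
    exact h2.mono_left nhdsWithin_le_nhds
  refine ge_of_tendsto hlim ?_
  have hmem : Set.Ioo (1 : ℝ) 2 ∈ nhdsWithin (1 : ℝ) (Set.Ioi 1) :=
    Ioo_mem_nhdsGT (by norm_num)
  filter_upwards [hmem] with s hs
  have hs1 : 1 < s := hs.1
  set r : ℝ := (2 : ℝ) ^ (n * (1 - s)) with hr
  have hr1 : r < 1 := Real.rpow_lt_one_of_one_lt_of_neg (by norm_num)
    (mul_neg_of_pos_of_neg hn0' (by linarith))
  have hr0 : 0 ≤ r := by positivity
  have hzeta : zetaSeries K s = ((∑' J : (Ideal (𝓞 K))⁰,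
      (Ideal.absNorm (J : Ideal (𝓞 K)) : ℝ) ^ (-s) : ℝ) : ℂ) := by
    rw [zetaSeries, Complex.ofReal_tsum]
    refine tsum_congr fun J => ?_
    rw [Complex.ofReal_cpow (absNorm_pos J).le]
    push_cast; rfl
  have hfac : (1 - 2 ^ n * ((2 ^ n : ℝ) : ℂ) ^ (-(s : ℂ))) = ((1 - r : ℝ) : ℂ) := by
    have h1 : r = 2 ^ n * (2 ^ n : ℝ) ^ (-s) := by
      rw [hr, ← Real.rpow_natCast, ← Real.rpow_mul (by norm_num), ← Real.rpow_add (by norm_num)]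
      ring_nf
    rw [h1]
    push_cast [Complex.ofReal_cpow (show (0 : ℝ) ≤ 2 ^ n by positivity)]
    rfl
  rw [etaFun_eq (by simpa using hs1), hzeta, hfac, ← Complex.ofReal_mul, Complex.norm_real,
    Real.norm_of_nonneg (mul_nonneg (by linarith) (tsum_nonneg fun _ => by positivity))]
  set Z := ∑' J : (Ideal (𝓞 K))⁰, (Ideal.absNorm (J : Ideal (𝓞 K)) : ℝ) ^ (-s)
  set c := (8 * n * Q) ^ (-(n : ℝ)) * (9 / 8 : ℝ) ^ (-(n * s)) with hc
  have hgeom : c * (∑' k : ℕ, r ^ k) ≤ Z := by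
    rw [← tsum_mul_left]
    refine Real.tsum_le_of_sum_range_le (fun _ => by positivity) fun L => ?_
    rw [← Finset.mul_sum]
    exact geom_le_tsum_ideal hQ hs1 L
  rw [tsum_geometric_of_lt_one hr0 hr1, ← div_eq_mul_inv, div_le_iff₀ (by linarith)] at hgeom
  have h2c : (16 * n * Q) ^ (-(n : ℝ)) ≤ c := by
    have h1 : (16 * n * Q : ℝ) = (8 * n * Q) * 2 := by ring
    rw [h1, Real.mul_rpow (by positivity) (by norm_num), hc]
    gcongr
    have h2 : (9 / 8 : ℝ) ^ (-(n * s)) = ((9 / 8 : ℝ) ^ s) ^ (-(n : ℝ)) := by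
      rw [← Real.rpow_mul (by norm_num)]; ring_nf
    rw [h2]
    refine Real.rpow_le_rpow_of_nonpos (by positivity) ?_ (by linarith)
    calc (9 / 8 : ℝ) ^ s ≤ (9 / 8 : ℝ) ^ (2 : ℝ) :=
          Real.rpow_le_rpow_of_exponent_le (by norm_num) hs.2.le
      _ ≤ 2 := by norm_num
  linarith [mul_comm Z (1 - r)]

end LowerBound

section Sieve

open scoped nonZeroDivisors

variable {K : Type} [Field K] [NumberField K]

lemma finite_primesAbove (K : Type) [Field K] [NumberField K] (q : ℕ) :
    {P : Ideal (𝓞 K) | P.IsPrime ∧ P ≠ ⊥ ∧ ratPrime P = q}.Finite := by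
  by_cases hq : q.Prime
  · by_contra hinf
    obtain ⟨T, hT, hc⟩ := Set.Infinite.exists_subset_card_eq hinf (Module.finrank ℚ K + 1)
    have := card_primes_le hq T fun P hP => hT hP
    omega
  · convert Set.finite_empty
    ext P
    simp only [Set.mem_ofPred_eq, Set.mem_empty_iff_false, iff_false]
    exact fun hP => hq (hP.2.2 ▸ ratPrime_prime hP.1 hP.2.1)

/-- The nonzero prime ideals of `𝓞 K` above a rational prime. -/
noncomputable def primesAbove (K : Type) [Field K] [NumberField K] (q : ℕ) :
    Finset (Ideal (𝓞 K)) := (finite_primesAbove K q).toFinset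

lemma mem_primesAbove {q : ℕ} {P : Ideal (𝓞 K)} :
    P ∈ primesAbove K q ↔ P.IsPrime ∧ P ≠ ⊥ ∧ ratPrime P = q := by simp [primesAbove]

lemma card_primesAbove_le (K : Type) [Field K] [NumberField K] {q : ℕ} (hq : q.Prime) :
    (primesAbove K q).card ≤ Module.finrank ℚ K :=
  card_primes_le hq _ fun _ => mem_primesAbove.1

lemma le_absNorm_of_mem_primesAbove {q : ℕ} {P : Ideal (𝓞 K)} (h : P ∈ primesAbove K q) :
    q ≤ Ideal.absNorm P := by
  obtain ⟨-, h0, rfl⟩ := mem_primesAbove.1 h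
  exact Nat.le_of_dvd (Nat.pos_of_ne_zero (Ideal.absNorm_eq_zero_iff.not.2 h0))
    (ratPrime_dvd_absNorm P)

open scoped Classical in
/-- The part of the zeta series over ideals without prime factors in a given set. -/
noncomputable def sieveSum (T : Finset (Ideal (𝓞 K))) (s : ℂ) : ℂ :=
  ∑' J : (Ideal (𝓞 K))⁰, if ∀ P ∈ T, ¬ P ∣ (J : Ideal (𝓞 K)) then
    ((Ideal.absNorm (J : Ideal (𝓞 K)) : ℝ) : ℂ) ^ (-s) else 0

lemma summable_ite_zetaSeries {s : ℂ} (hs : 1 < s.re) (p : (Ideal (𝓞 K))⁰ → Prop)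
    [DecidablePred p] :
    Summable fun J : (Ideal (𝓞 K))⁰ => if p J then
      ((Ideal.absNorm (J : Ideal (𝓞 K)) : ℝ) : ℂ) ^ (-s) else 0 := by
  refine Summable.of_norm_bounded (summable_norm_zetaSeries hs) fun J => ?_
  split_ifs
  · exact le_rfl
  · simp

lemma sieveSum_insert {s : ℂ} (hs : 1 < s.re) {T : Finset (Ideal (𝓞 K))} [DecidableEq (Ideal (𝓞 K))]
    (hT : ∀ P ∈ T, P.IsPrime ∧ P ≠ ⊥) {P : Ideal (𝓞 K)} (hP : P.IsPrime) (hP0 : P ≠ ⊥)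
    (hPT : P ∉ T) :
    sieveSum (insert P T) s = (1 - ((Ideal.absNorm P : ℝ) : ℂ) ^ (-s)) * sieveSum T s := by
  classical
  let N : (Ideal (𝓞 K))⁰ → ℂ := fun J => ((Ideal.absNorm (J : Ideal (𝓞 K)) : ℝ) : ℂ) ^ (-s)
  let P' : (Ideal (𝓞 K))⁰ := ⟨P, mem_nonZeroDivisors_iff_ne_zero.2 hP0⟩
  have h1 : sieveSum T s = sieveSum (insert P T) s + ∑' J : (Ideal (𝓞 K))⁰,
      if (∀ Q ∈ T, ¬ Q ∣ (J : Ideal (𝓞 K))) ∧ P ∣ (J : Ideal (𝓞 K)) then N J else 0 := by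
    rw [sieveSum, sieveSum, ← (summable_ite_zetaSeries hs _).tsum_add (summable_ite_zetaSeries hs _)]
    refine tsum_congr fun J => ?_
    simp only [Finset.forall_mem_insert]
    by_cases ha : ∀ Q ∈ T, ¬ Q ∣ (J : Ideal (𝓞 K)) <;> by_cases hb : P ∣ (J : Ideal (𝓞 K)) <;>
      simp [ha, hb]
  have hinj : Function.Injective fun J : (Ideal (𝓞 K))⁰ => P' * J := fun a b h =>
    Subtype.ext (mul_left_cancel₀ hP0 (congrArg Subtype.val h))
  have h2 : (∑' J : (Ideal (𝓞 K))⁰,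
      if (∀ Q ∈ T, ¬ Q ∣ (J : Ideal (𝓞 K))) ∧ P ∣ (J : Ideal (𝓞 K)) then N J else 0) =
      ((Ideal.absNorm P : ℝ) : ℂ) ^ (-s) * sieveSum T s := by
    rw [← hinj.tsum_eq, sieveSum, ← tsum_mul_left]
    · refine tsum_congr fun J => ?_
      have e1 : (∀ Q ∈ T, ¬ Q ∣ ((P' * J : (Ideal (𝓞 K))⁰) : Ideal (𝓞 K))) ↔
          ∀ Q ∈ T, ¬ Q ∣ (J : Ideal (𝓞 K)) := by
        refine forall₂_congr fun Q hQ => not_congr ?_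
        rw [Submonoid.coe_mul, (Ideal.prime_of_isPrime (hT Q hQ).2 (hT Q hQ).1).dvd_mul]
        refine or_iff_right fun hd => hPT ?_
        have : P = Q := (hP.isMaximal hP0).eq_of_le (hT Q hQ).1.ne_top (Ideal.le_of_dvd hd)
        rwa [this]
      have e2 : P ∣ ((P' * J : (Ideal (𝓞 K))⁰) : Ideal (𝓞 K)) := Dvd.intro _ rfl
      simp only [e1, e2, and_true]
      split_ifs
      · simp only [N, Submonoid.coe_mul, map_mul]
        push_cast
        exact Complex.mul_cpow_ofReal_nonneg (by positivity) (by positivity) _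
      · simp
    · intro J hJ
      rw [Function.mem_support] at hJ
      split_ifs at hJ with h
      · obtain ⟨J', hJ'⟩ := h.2
        have h0 : J' ≠ 0 := by
          rintro rfl
          exact (mem_nonZeroDivisors_iff_ne_zero.1 J.2) (by rw [hJ', mul_zero])
        exact ⟨⟨J', mem_nonZeroDivisors_iff_ne_zero.2 h0⟩, Subtype.ext hJ'.symm⟩
      · exact absurd rfl hJ
  rw [h2] at h1
  linear_combination -h1

lemma sieveSum_eq {s : ℂ} (hs : 1 < s.re) {T : Finset (Ideal (𝓞 K))}
    (hT : ∀ P ∈ T, P.IsPrime ∧ P ≠ ⊥) :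
    sieveSum T s = (∏ P ∈ T, (1 - ((Ideal.absNorm P : ℝ) : ℂ) ^ (-s))) * zetaSeries K s := by
  classical
  induction T using Finset.induction_on with
  | empty => simp [sieveSum, zetaSeries]
  | insert P T hP ih =>
    rw [Finset.forall_mem_insert] at hT
    rw [sieveSum_insert hs hT.2 hT.1.1 hT.1.2 hP, ih hT.2, Finset.prod_insert hP, mul_assoc]

/-- The product of the inverse Euler factors at the primes above a finite set of rational primes. -/
noncomputable def eulerInv (K : Type) [Field K] [NumberField K] (S : Finset ℕ) (s : ℂ) : ℂ :=
  ∏ q ∈ S, ∏ P ∈ primesAbove K q, (1 - ((Ideal.absNorm P : ℝ) : ℂ) ^ (-s))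

/-- The nonzero prime ideals above a finite set of rational primes. -/
noncomputable def primesAboveSet (K : Type) [Field K] [NumberField K] (S : Finset ℕ) :
    Finset (Ideal (𝓞 K)) :=
  haveI := Classical.decEq (Ideal (𝓞 K))
  S.biUnion (primesAbove K)

lemma mem_primesAboveSet {S : Finset ℕ} {P : Ideal (𝓞 K)} :
    P ∈ primesAboveSet K S ↔ P.IsPrime ∧ P ≠ ⊥ ∧ ratPrime P ∈ S := by
  classical
  simp only [primesAboveSet, Finset.mem_biUnion, mem_primesAbove]
  constructor
  · rintro ⟨q, hq, h1, h2, rfl⟩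
    exact ⟨h1, h2, hq⟩
  · rintro ⟨h1, h2, h3⟩
    exact ⟨_, h3, h1, h2, rfl⟩

lemma sieveSum_primesAboveSet {s : ℂ} (hs : 1 < s.re) (S : Finset ℕ) :
    sieveSum (primesAboveSet K S) s = eulerInv K S s * zetaSeries K s := by
  classical
  rw [sieveSum_eq hs fun P hP => ⟨(mem_primesAboveSet.1 hP).1, (mem_primesAboveSet.1 hP).2.1⟩,
    eulerInv, primesAboveSet, Finset.prod_biUnion]
  intro q _ q' _ hne
  refine Finset.disjoint_left.2 fun P hP hP' => hne ?_
  rw [← (mem_primesAbove.1 hP).2.2, (mem_primesAbove.1 hP').2.2]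

lemma norm_sieveSum_le (T : Finset (Ideal (𝓞 K))) {s : ℂ} (hs : 2 ≤ s.re) :
    ‖sieveSum T s‖ ≤ natZeta 2 ^ Module.finrank ℚ K := by
  classical
  refine (tsum_of_norm_bounded (summable_ideal_rpow (K := K) (σ := 2) (by norm_num)).hasSum
    fun J => ?_).trans (tsum_ideal_rpow_le (by norm_num))
  split_ifs
  · rw [norm_ofReal_cpow_neg (absNorm_pos J)]
    exact Real.rpow_le_rpow_of_exponent_le (one_le_absNorm J) (by linarith)
  · rw [norm_zero]; positivity

lemma norm_sieveSum_sub_one_le {T : Finset (Ideal (𝓞 K))} {X : ℕ} (hX : 0 < X)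
    (hT : ∀ P : Ideal (𝓞 K), P.IsPrime → P ≠ ⊥ → ratPrime P ≤ X → P ∈ T)
    (hT' : ∀ P ∈ T, P.IsPrime)
    {s : ℂ} (hs : s.re = 3) :
    ‖sieveSum T s - 1‖ ≤ natZeta 2 ^ Module.finrank ℚ K / X := by
  classical
  have hX' : (0 : ℝ) < X := by exact_mod_cast hX
  have h1 : sieveSum T s - 1 = ∑' J : (Ideal (𝓞 K))⁰,
      if (∀ P ∈ T, ¬ P ∣ (J : Ideal (𝓞 K))) ∧ J ≠ 1 then
        ((Ideal.absNorm (J : Ideal (𝓞 K)) : ℝ) : ℂ) ^ (-s) else 0 := by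
    rw [sieveSum, (summable_ite_zetaSeries (by rw [hs]; norm_num) _).tsum_eq_add_tsum_ite 1]
    have : ∀ P ∈ T, ¬ P ∣ ((1 : (Ideal (𝓞 K))⁰) : Ideal (𝓞 K)) := fun P hP h =>
      (hT' P hP).ne_top (Ideal.isUnit_iff.1 (isUnit_of_dvd_one h))
    rw [if_pos this]
    simp only [OneMemClass.coe_one, map_one, Nat.cast_one, Complex.ofReal_one, Complex.one_cpow,
      add_sub_cancel_left]
    refine tsum_congr fun J => ?_
    by_cases hJ : J = 1 <;> simp [hJ]
  rw [h1]
  have h2 := ((summable_ideal_rpow (K := K) (σ := 2) (by norm_num)).hasSum).mul_left (X : ℝ)⁻¹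
  refine (tsum_of_norm_bounded h2 fun J => ?_).trans ?_
  · have hN1 := absNorm_pos J
    split_ifs with h
    · have hlt : (X : ℝ) ≤ Ideal.absNorm (J : Ideal (𝓞 K)) := by
        have hJtop : (J : Ideal (𝓞 K)) ≠ ⊤ := fun h' => h.2 (Subtype.ext (h'.trans Ideal.one_eq_top.symm))
        obtain ⟨P, hPm, hJP⟩ := Ideal.exists_le_maximal _ hJtop
        have hP0 : P ≠ ⊥ := by
          rintro rfl
          exact (mem_nonZeroDivisors_iff_ne_zero.1 J.2) (le_bot_iff.1 hJP)
        have h3 : X < ratPrime P := by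
          by_contra hle
          exact h.1 P (hT P hPm.isPrime hP0 (not_lt.1 hle)) (Ideal.dvd_iff_le.2 hJP)
        have h4 : ratPrime P ∣ Ideal.absNorm (J : Ideal (𝓞 K)) :=
          (ratPrime_dvd_absNorm P).trans (map_dvd _ (Ideal.dvd_iff_le.2 hJP))
        have h5 := Nat.le_of_dvd (by exact_mod_cast hN1) h4
        exact_mod_cast h3.le.trans h5
      rw [norm_ofReal_cpow_neg hN1, hs]
      have : (Ideal.absNorm (J : Ideal (𝓞 K)) : ℝ) ^ (-3 : ℝ) =
          (Ideal.absNorm (J : Ideal (𝓞 K)) : ℝ)⁻¹ * (Ideal.absNorm (J : Ideal (𝓞 K)) : ℝ) ^ (-2 : ℝ) := by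
        rw [← Real.rpow_neg_one, ← Real.rpow_add hN1]; norm_num
      rw [this]
      gcongr
    · rw [norm_zero]; positivity
  · rw [div_eq_inv_mul]
    gcongr
    exact tsum_ideal_rpow_le (by norm_num)

lemma differentiable_eulerInv (S : Finset ℕ) : Differentiable ℂ (eulerInv K S) := by
  unfold eulerInv
  refine Differentiable.fun_finsetProd fun q _ => Differentiable.fun_finsetProd fun P hP => ?_
  have hne : ((Ideal.absNorm P : ℝ) : ℂ) ≠ 0 := by
    have := Ideal.absNorm_eq_zero_iff.not.2 (mem_primesAbove.1 hP).2.1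
    exact_mod_cast this
  exact (differentiable_const _).sub (differentiable_id.neg.const_cpow (Or.inl hne))

lemma norm_eulerInv_le {S : Finset ℕ} (hS : ∀ q ∈ S, q.Prime) {σ : ℝ} (hσ : 0 ≤ σ) {s : ℂ}
    (hs : σ ≤ s.re) :
    ‖eulerInv K S s‖ ≤ Real.exp (Module.finrank ℚ K * ∑ q ∈ S, (q : ℝ) ^ (-σ)) := by
  rw [eulerInv, norm_prod, Finset.mul_sum, Real.exp_sum]
  refine Finset.prod_le_prod (fun _ _ => norm_nonneg _) fun q hq => ?_
  rw [norm_prod]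
  have hq1 : (1 : ℝ) ≤ q := by exact_mod_cast (hS q hq).one_le
  calc _ ≤ ∏ P ∈ primesAbove K q, Real.exp ((q : ℝ) ^ (-σ)) := by
        refine Finset.prod_le_prod (fun _ _ => norm_nonneg _) fun P hP => ?_
        have h1 : (q : ℝ) ≤ Ideal.absNorm P := by exact_mod_cast le_absNorm_of_mem_primesAbove hP
        have h2 : ‖((Ideal.absNorm P : ℝ) : ℂ) ^ (-s)‖ ≤ (q : ℝ) ^ (-σ) := by
          rw [norm_ofReal_cpow_neg (by linarith)]
          calc _ ≤ (Ideal.absNorm P : ℝ) ^ (-σ) :=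
                Real.rpow_le_rpow_of_exponent_le (by linarith) (by linarith)
            _ ≤ _ := Real.rpow_le_rpow_of_nonpos (by linarith) h1 (by linarith)
        calc _ ≤ ‖(1 : ℂ)‖ + ‖((Ideal.absNorm P : ℝ) : ℂ) ^ (-s)‖ := norm_sub_le _ _
          _ ≤ (q : ℝ) ^ (-σ) + 1 := by rw [norm_one]; linarith
          _ ≤ _ := Real.add_one_le_exp _
    _ = Real.exp ((primesAbove K q).card * (q : ℝ) ^ (-σ)) := by
        rw [Finset.prod_const, ← Real.exp_nat_mul]
    _ ≤ _ := by
        gcongr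
        exact_mod_cast card_primesAbove_le K (hS q hq)

lemma exp_neg_two_mul_le {x : ℝ} (h0 : 0 ≤ x) (h1 : x ≤ 1 / 2) : Real.exp (-(2 * x)) ≤ 1 - x := by
  have h2 := Real.add_one_le_exp (2 * x)
  rw [Real.exp_neg, inv_le_comm₀ (Real.exp_pos _) (by linarith)]
  refine le_trans ?_ h2
  rw [inv_le_iff_one_le_mul₀ (by linarith)]
  nlinarith

lemma le_norm_eulerInv_one {S : Finset ℕ} (hS : ∀ q ∈ S, q.Prime) {σ : ℝ} (hσ : σ ≤ 1) :
    Real.exp (-(2 * Module.finrank ℚ K * ∑ q ∈ S, (q : ℝ) ^ (-σ))) ≤ ‖eulerInv K S 1‖ := by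
  rw [eulerInv, norm_prod, Finset.mul_sum, ← Finset.sum_neg_distrib, Real.exp_sum]
  refine Finset.prod_le_prod (fun _ _ => (Real.exp_pos _).le) fun q hq => ?_
  rw [norm_prod]
  have hq2 : (2 : ℝ) ≤ q := by exact_mod_cast (hS q hq).two_le
  have hqσ : (q : ℝ)⁻¹ ≤ (q : ℝ) ^ (-σ) := by
    rw [← Real.rpow_neg_one]
    exact Real.rpow_le_rpow_of_exponent_le (by linarith) (by linarith)
  calc _ ≤ Real.exp ((primesAbove K q).card * -(2 * (q : ℝ)⁻¹)) := by
        rw [Real.exp_le_exp]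
        have h1 : ((primesAbove K q).card : ℝ) ≤ Module.finrank ℚ K := by
          exact_mod_cast card_primesAbove_le K (hS q hq)
        have h2 : ((primesAbove K q).card : ℝ) * (q : ℝ)⁻¹ ≤
            Module.finrank ℚ K * (q : ℝ) ^ (-σ) := by gcongr
        linarith
    _ = ∏ P ∈ primesAbove K q, Real.exp (-(2 * (q : ℝ)⁻¹)) := by
        rw [Finset.prod_const, ← Real.exp_nat_mul]
    _ ≤ _ := by
        refine Finset.prod_le_prod (fun _ _ => (Real.exp_pos _).le) fun P hP => ?_
        have h1 : (q : ℝ) ≤ Ideal.absNorm P := by exact_mod_cast le_absNorm_of_mem_primesAbove hP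
        have h2 : ‖((Ideal.absNorm P : ℝ) : ℂ) ^ (-1 : ℂ)‖ ≤ (q : ℝ)⁻¹ := by
          rw [norm_ofReal_cpow_neg (by linarith), Complex.one_re, Real.rpow_neg_one]
          gcongr
        have h3 : (q : ℝ)⁻¹ ≤ 1 / 2 := by
          rw [one_div]; gcongr
        have h4 := norm_sub_norm_le (1 : ℂ) (((Ideal.absNorm P : ℝ) : ℂ) ^ (-1 : ℂ))
        rw [norm_one] at h4
        have h5 := exp_neg_two_mul_le (by positivity) h3
        linarith

end Sieve

section Contra

open scoped nonZeroDivisors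

variable {E K : Type} [Field E] [NumberField E] [Field K] [NumberField K]

/-- The factor by which the Dedekind zeta function of a field of degree `n` is multiplied
in `etaFun` is `1 - twoFactor n`. -/
noncomputable def twoFactor (n : ℕ) (s : ℂ) : ℂ := 2 ^ n * ((2 ^ n : ℝ) : ℂ) ^ (-s)

lemma twoFactor_mul (n p : ℕ) (s : ℂ) : twoFactor (p * n) s = twoFactor n s ^ p := by
  have h : ∀ k : ℕ, ((2 ^ (k * n) : ℝ) : ℂ) ^ (-s) = (((2 ^ n : ℝ) : ℂ) ^ (-s)) ^ k := by
    intro k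
    induction k with
    | zero => simp
    | succ k ih =>
      rw [pow_succ, ← ih, ← Complex.mul_cpow_ofReal_nonneg (by positivity) (by positivity),
        ← Complex.ofReal_mul, ← pow_add, Nat.succ_mul]
  rw [twoFactor, twoFactor, h, mul_pow, ← pow_mul, mul_comm n p]

lemma norm_twoFactor (n : ℕ) (s : ℂ) : ‖twoFactor n s‖ = (2 : ℝ) ^ (n * (1 - s.re)) := by
  rw [twoFactor, norm_mul, norm_ofReal_cpow_neg (by positivity), norm_pow, Complex.norm_ofNat,
    ← Real.rpow_natCast, ← Real.rpow_mul (by norm_num), ← Real.rpow_add (by norm_num)]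
  ring_nf

lemma differentiable_twoFactor (n : ℕ) : Differentiable ℂ (twoFactor n) := by
  have hne : ((2 ^ n : ℝ) : ℂ) ≠ 0 := by norm_num
  exact (differentiable_id.neg.const_cpow (Or.inl hne)).const_mul _

lemma twoFactor_one (n : ℕ) : twoFactor n 1 = 1 := by
  rw [twoFactor, Complex.cpow_neg_one]
  push_cast
  exact mul_inv_cancel₀ (pow_ne_zero _ two_ne_zero)

/-- The comparison function of a field extension of degree `p`, up to the factors at `S`. -/
noncomputable def compareFun (E K : Type) [Field E] [NumberField E] [Field K] [NumberField K]
    (p : ℕ) (S : Finset ℕ) (s : ℂ) : ℂ :=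
  ((∑ i ∈ Finset.range p, twoFactor (Module.finrank ℚ E) s ^ i) * etaFun E s * eulerInv E S s) ^ p -
    (1 - twoFactor (Module.finrank ℚ E) s ^ p) ^ (p - 1) * (etaFun K s * eulerInv K S s)

lemma eulerInv_union {S T : Finset ℕ} (h : Disjoint S T) (s : ℂ) :
    eulerInv K (S ∪ T) s = eulerInv K S s * eulerInv K T s := Finset.prod_union h

lemma compareFun_eq {p : ℕ} (hp : 1 ≤ p) (hEK : Module.finrank ℚ K = p * Module.finrank ℚ E)
    (S : Finset ℕ) {s : ℂ} (hs : 1 < s.re) :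
    compareFun E K p S s = (1 - twoFactor (Module.finrank ℚ E) s ^ p) ^ p *
      (sieveSum (primesAboveSet E S) s ^ p - sieveSum (primesAboveSet K S) s) := by
  rw [compareFun, sieveSum_primesAboveSet hs, sieveSum_primesAboveSet hs, etaFun_eq hs,
    etaFun_eq hs, hEK]
  change ((∑ i ∈ Finset.range p, twoFactor (Module.finrank ℚ E) s ^ i) *
    ((1 - twoFactor (Module.finrank ℚ E) s) * zetaSeries E s) * eulerInv E S s) ^ p -
    (1 - twoFactor (Module.finrank ℚ E) s ^ p) ^ (p - 1) *
      ((1 - twoFactor (p * Module.finrank ℚ E) s) * zetaSeries K s * eulerInv K S s) = _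
  rw [twoFactor_mul, ← mul_assoc (∑ i ∈ Finset.range p, twoFactor (Module.finrank ℚ E) s ^ i),
    geom_sum_mul_neg]
  obtain ⟨r, rfl⟩ : ∃ r, p = r + 1 := ⟨p - 1, by omega⟩
  rw [Nat.add_sub_cancel]
  generalize 1 - twoFactor (Module.finrank ℚ E) s ^ (r + 1) = m
  ring

/-- On the line `Re s = 3` the comparison function is small. -/
lemma exists_norm_compareFun_le_div (n p : ℕ) (hp : 1 ≤ p) : ∃ C : ℝ, 1 ≤ C ∧
    ∀ (E K : Type) [Field E] [NumberField E] [Field K] [NumberField K],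
      Module.finrank ℚ E = n → Module.finrank ℚ K = p * n →
      ∀ X : ℕ, C ≤ X → ∀ S : Finset ℕ, (∀ q ∈ S, q.Prime ∧ q ≤ X) →
      (∀ q : ℕ, q.Prime → q ≤ X → q ∉ S → ∀ s : ℂ,
        ∏ P ∈ primesAbove K q, (1 - ((Ideal.absNorm P : ℝ) : ℂ) ^ (-s)) =
          (∏ P ∈ primesAbove E q, (1 - ((Ideal.absNorm P : ℝ) : ℂ) ^ (-s))) ^ p) →
      ∀ s : ℂ, s.re = 3 → ‖compareFun E K p S s‖ ≤ C / X := by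
  have hz : 0 ≤ natZeta 2 := tsum_nonneg fun _ => by positivity
  set B := natZeta 2 ^ n with hB
  set B' := natZeta 2 ^ (p * n) with hB'
  have hB0 : 0 ≤ B := by positivity
  have hB'0 : 0 ≤ B' := by positivity
  refine ⟨1 + 2 * B + 2 ^ p * ((p * 2 ^ p * B + B') * (2 * B) ^ p), ?_, ?_⟩
  · have : 0 ≤ 2 * B + 2 ^ p * ((p * 2 ^ p * B + B') * (2 * B) ^ p) := by positivity
    linarith
  intro E K _ _ _ _ hE hK X hX S hS hpr s hs
  have hC0 : 0 ≤ 2 ^ p * ((p * 2 ^ p * B + B') * (2 * B) ^ p) := by positivity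
  have hX1 : (1 : ℝ) ≤ X := by linarith
  have hX0 : 0 < X := by exact_mod_cast (by linarith : (0 : ℝ) < X)
  have hs1 : 1 < s.re := by rw [hs]; norm_num
  rw [compareFun_eq hp (by rw [hE, hK]) S hs1, hE]
  let T : Finset ℕ := (Finset.range (X + 1)).filter fun q => q.Prime ∧ q ∉ S
  have hdisj : Disjoint S T := Finset.disjoint_left.2 fun q hq hq' =>
    (Finset.mem_filter.1 hq').2.2 hq
  have hall : ∀ q : ℕ, q.Prime → q ≤ X → q ∈ S ∪ T := by
    intro q hq hqX
    by_cases hqS : q ∈ S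
    · exact Finset.mem_union_left _ hqS
    · exact Finset.mem_union_right _ (Finset.mem_filter.2 ⟨Finset.mem_range.2 (by omega), hq, hqS⟩)
  have hKT : eulerInv K T s = eulerInv E T s ^ p := by
    rw [eulerInv, eulerInv, ← Finset.prod_pow]
    refine Finset.prod_congr rfl fun q hq => ?_
    obtain ⟨h1, h2, h3⟩ := Finset.mem_filter.1 hq
    exact hpr q h2 (by have := Finset.mem_range.1 h1; omega) h3 s
  set a := sieveSum (primesAboveSet E (S ∪ T)) s with ha
  set b := sieveSum (primesAboveSet K (S ∪ T)) s with hb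
  set z := sieveSum (primesAboveSet E S) s with hz1
  set w := sieveSum (primesAboveSet K S) s with hw1
  have haz : a = eulerInv E T s * z := by
    rw [ha, hz1, sieveSum_primesAboveSet hs1, sieveSum_primesAboveSet hs1, eulerInv_union hdisj]
    ring
  have hbw : b = eulerInv E T s ^ p * w := by
    rw [hb, hw1, sieveSum_primesAboveSet hs1, sieveSum_primesAboveSet hs1, eulerInv_union hdisj,
      ← hKT]
    ring
  have ha1 : ‖a - 1‖ ≤ B / X := by
    rw [hB, ← hE]
    exact norm_sieveSum_sub_one_le hX0 (fun P h1 h2 h3 => mem_primesAboveSet.2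
      ⟨h1, h2, hall _ (ratPrime_prime h1 h2) h3⟩) (fun P hP => (mem_primesAboveSet.1 hP).1) hs
  have hb1 : ‖b - 1‖ ≤ B' / X := by
    rw [hB', ← hK]
    exact norm_sieveSum_sub_one_le hX0 (fun P h1 h2 h3 => mem_primesAboveSet.2
      ⟨h1, h2, hall _ (ratPrime_prime h1 h2) h3⟩) (fun P hP => (mem_primesAboveSet.1 hP).1) hs
  have hzB : ‖z‖ ≤ B := by
    rw [hB, ← hE]
    exact norm_sieveSum_le _ (by rw [hs]; norm_num)
  have hBX : B / X ≤ 1 / 2 := by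
    rw [div_le_iff₀ (by linarith)]; linarith
  have ha2 : 1 / 2 ≤ ‖a‖ := by
    have := norm_sub_norm_le (1 : ℂ) (1 - a)
    rw [norm_one, sub_sub_cancel, norm_sub_rev] at this
    linarith
  have ha3 : ‖a‖ ≤ 2 := by
    have := norm_add_le (a - 1) 1
    rw [norm_one, sub_add_cancel] at this
    linarith
  have ha0 : a ≠ 0 := fun h => by rw [h, norm_zero] at ha2; linarith
  have key : z ^ p - w = (a ^ p - b) * (z / a) ^ p := by
    have hP0 : eulerInv E T s ≠ 0 := fun h => ha0 (by rw [haz, h, zero_mul])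
    have hz0 : z ≠ 0 := fun h => ha0 (by rw [haz, h, mul_zero])
    rw [hbw, haz, mul_pow, ← mul_sub, div_mul_cancel_right₀ hz0, inv_pow]
    field_simp
  have hap : ‖a ^ p - 1‖ ≤ p * 2 ^ p * (B / X) := by
    rw [← geom_sum_mul, norm_mul]
    refine mul_le_mul ?_ ha1 (norm_nonneg _) (by positivity)
    refine (norm_sum_le _ _).trans ?_
    calc _ ≤ ∑ i ∈ Finset.range p, (2 : ℝ) ^ p := by
          refine Finset.sum_le_sum fun i hi => ?_
          rw [norm_pow]
          exact (pow_le_pow_left₀ (norm_nonneg _) ha3 i).trans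
            (pow_le_pow_right₀ (by norm_num) (Finset.mem_range.1 hi).le)
      _ = _ := by simp
  have hab : ‖a ^ p - b‖ ≤ (p * 2 ^ p * B + B') / X := by
    calc ‖a ^ p - b‖ = ‖(a ^ p - 1) - (b - 1)‖ := by congr 1; ring
      _ ≤ ‖a ^ p - 1‖ + ‖b - 1‖ := norm_sub_le _ _
      _ ≤ p * 2 ^ p * (B / X) + B' / X := add_le_add hap hb1
      _ = _ := by ring
  have hza : ‖z / a‖ ≤ 2 * B := by
    rw [norm_div, div_le_iff₀ (by linarith)]
    nlinarith
  have hm : ‖1 - twoFactor n s ^ p‖ ≤ 2 := by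
    have h1 : ‖twoFactor n s‖ ≤ 1 := by
      rw [norm_twoFactor, hs]
      refine Real.rpow_le_one_of_one_le_of_nonpos (by norm_num) ?_
      have : (0 : ℝ) ≤ n := by positivity
      linarith
    refine (norm_sub_le _ _).trans ?_
    rw [norm_one, norm_pow]
    linarith [pow_le_one₀ (n := p) (norm_nonneg _) h1]
  rw [key, norm_mul, norm_mul, norm_pow, norm_pow]
  calc _ ≤ 2 ^ p * ((p * 2 ^ p * B + B') / X * (2 * B) ^ p) := by gcongr
    _ = (2 ^ p * ((p * 2 ^ p * B + B') * (2 * B) ^ p)) / X := by ring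
    _ ≤ _ := by gcongr; linarith

/-- Growth of the comparison function in a strip. -/
lemma exists_norm_compareFun_le (n p : ℕ) (hn : 1 ≤ n) (hp : 1 ≤ p) : ∃ C : ℝ, 1 ≤ C ∧
    ∀ (E K : Type) [Field E] [NumberField E] [Field K] [NumberField K],
      Module.finrank ℚ E = n → Module.finrank ℚ K = p * n →
      ∀ Q : ℝ, HasSmallBasis E Q → HasSmallBasis K Q → ∀ S : Finset ℕ, (∀ q ∈ S, q.Prime) →
      ∀ σ : ℝ, 1 - 1 / (2 * (p * n : ℕ) : ℝ) ≤ σ → ∀ s : ℂ, σ ≤ s.re → s.re ≤ 4 →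
        ‖compareFun E K p S s‖ ≤ C * Q ^ (2 * p) * (1 + ‖s‖) ^ p *
          Real.exp ((p * n : ℕ) * p * ∑ q ∈ S, (q : ℝ) ^ (-σ)) := by
  obtain ⟨C₁, hC₁, h₁⟩ := exists_norm_etaFun_le n
  obtain ⟨C₂, hC₂, h₂⟩ := exists_norm_etaFun_le (p * n)
  refine ⟨1 + ((p * 2 ^ p * C₁) ^ p + (1 + 2 ^ p) ^ (p - 1) * C₂), ?_, ?_⟩
  · have : 0 ≤ (p * 2 ^ p * C₁) ^ p + (1 + 2 ^ p) ^ (p - 1) * C₂ := by positivity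
    linarith
  intro E K _ _ _ _ hE hK Q hQE hQK S hS σ hσ s hs h4
  have hpn : 1 ≤ p * n := Nat.mul_pos hp hn
  have hpn' : (1 : ℝ) ≤ (p * n : ℕ) := by exact_mod_cast hpn
  have hn' : (1 : ℝ) ≤ n := by exact_mod_cast hn
  have hnpn : (n : ℝ) ≤ (p * n : ℕ) := by exact_mod_cast Nat.le_mul_of_pos_left n hp
  have hσ0 : 0 ≤ σ := by
    refine le_trans ?_ hσ
    rw [sub_nonneg, div_le_one (by linarith)]; linarith
  have hQ1 := hQE.one_le
  set W := Real.exp ((p * n : ℕ) * ∑ q ∈ S, (q : ℝ) ^ (-σ)) with hW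
  have hsum : 0 ≤ ∑ q ∈ S, (q : ℝ) ^ (-σ) := Finset.sum_nonneg fun _ _ => by positivity
  have hW1 : 1 ≤ W := Real.one_le_exp (by positivity)
  have hWE : ‖eulerInv E S s‖ ≤ W := by
    refine (norm_eulerInv_le hS hσ0 hs).trans ?_
    rw [hE, hW]
    gcongr
  have hWK : ‖eulerInv K S s‖ ≤ W := by
    refine (norm_eulerInv_le hS hσ0 hs).trans ?_
    rw [hK, hW]
  have hu : ‖twoFactor n s‖ ≤ 2 := by
    rw [norm_twoFactor]
    calc (2 : ℝ) ^ (n * (1 - s.re)) ≤ 2 ^ (1 : ℝ) := by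
          refine Real.rpow_le_rpow_of_exponent_le (by norm_num) ?_
          have h5 : 1 - s.re ≤ 1 / (2 * (p * n : ℕ) : ℝ) := by linarith
          calc (n : ℝ) * (1 - s.re) ≤ n * (1 / (2 * (p * n : ℕ) : ℝ)) := by gcongr
            _ ≤ (p * n : ℕ) * (1 / (2 * (p * n : ℕ) : ℝ)) := by gcongr
            _ ≤ 1 := by
              rw [mul_one_div, div_le_one (by linarith)]; linarith
      _ = 2 := by norm_num
  have hG : ‖∑ i ∈ Finset.range p, twoFactor n s ^ i‖ ≤ p * 2 ^ p := by
    refine (norm_sum_le _ _).trans ?_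
    calc _ ≤ ∑ i ∈ Finset.range p, (2 : ℝ) ^ p := by
          refine Finset.sum_le_sum fun i hi => ?_
          rw [norm_pow]
          exact (pow_le_pow_left₀ (norm_nonneg _) hu i).trans
            (pow_le_pow_right₀ (by norm_num) (Finset.mem_range.1 hi).le)
      _ = _ := by simp
  have hm : ‖1 - twoFactor n s ^ p‖ ≤ 1 + 2 ^ p := by
    refine (norm_sub_le _ _).trans ?_
    rw [norm_one, norm_pow]
    gcongr
  have hHE := h₁ E hE Q hQE s (by
    refine le_trans ?_ (hσ.trans hs)
    gcongr) h4
  have hHK := h₂ K hK Q hQK s (hσ.trans hs) h4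
  have hY : 1 ≤ Q ^ 2 * (1 + ‖s‖) * W := by
    have h1 : 1 ≤ Q ^ 2 := one_le_pow₀ hQ1
    have h2 : 1 ≤ 1 + ‖s‖ := by linarith [norm_nonneg s]
    exact one_le_mul_of_one_le_of_one_le (one_le_mul_of_one_le_of_one_le h1 h2) hW1
  rw [compareFun, hE]
  refine (norm_sub_le _ _).trans ?_
  rw [norm_pow, norm_mul, norm_mul, norm_mul, norm_mul, norm_pow]
  calc _ ≤ (p * 2 ^ p * (C₁ * Q ^ 2 * (1 + ‖s‖)) * W) ^ p +
        (1 + 2 ^ p) ^ (p - 1) * (C₂ * Q ^ 2 * (1 + ‖s‖) * W) := by gcongr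
    _ = (p * 2 ^ p * C₁) ^ p * (Q ^ 2 * (1 + ‖s‖) * W) ^ p +
        (1 + 2 ^ p) ^ (p - 1) * C₂ * (Q ^ 2 * (1 + ‖s‖) * W) := by
        rw [← mul_pow (p * 2 ^ p * C₁) (Q ^ 2 * (1 + ‖s‖) * W)]
        congr 1
        · congr 1; ring
        · ring
    _ ≤ (p * 2 ^ p * C₁) ^ p * (Q ^ 2 * (1 + ‖s‖) * W) ^ p +
        (1 + 2 ^ p) ^ (p - 1) * C₂ * (Q ^ 2 * (1 + ‖s‖) * W) ^ p := by
        have := le_self_pow₀ hY (by omega : p ≠ 0)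
        gcongr
    _ = ((p * 2 ^ p * C₁) ^ p + (1 + 2 ^ p) ^ (p - 1) * C₂) * (Q ^ 2 * (1 + ‖s‖) * W) ^ p := by
        ring
    _ ≤ (1 + ((p * 2 ^ p * C₁) ^ p + (1 + 2 ^ p) ^ (p - 1) * C₂)) *
        (Q ^ 2 * (1 + ‖s‖) * W) ^ p := by
        refine mul_le_mul_of_nonneg_right ?_ (by positivity)
        linarith
    _ = _ := by
        have hWp : W ^ p = Real.exp ((p * n : ℕ) * p * ∑ q ∈ S, (q : ℝ) ^ (-σ)) := by
          rw [hW, ← Real.exp_nat_mul]; ring_nf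
        rw [← hWp, mul_pow _ W, mul_pow (Q ^ 2), ← pow_mul]
        ring

/-- If the Euler factors of `K` at all primes up to `X` outside `S` are `p`-th powers of those of
a subfield `E`, then `S` contains many primes. -/
lemma exists_mul_log_le_sum (n p : ℕ) (hn : 1 ≤ n) (hp : 2 ≤ p) :
    ∃ ε : ℝ, 0 < ε ∧ ∃ A : ℝ, 0 < A ∧ ∃ X₀ : ℝ,
    ∀ (E K : Type) [Field E] [NumberField E] [Field K] [NumberField K],
      Module.finrank ℚ E = n → Module.finrank ℚ K = p * n →
      ∀ Q : ℝ, HasSmallBasis E Q → HasSmallBasis K Q →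
      ∀ X : ℕ, X₀ ≤ X → Q ^ A ≤ X → ∀ S : Finset ℕ, (∀ q ∈ S, q.Prime ∧ q ≤ X) →
      (∀ q : ℕ, q.Prime → q ≤ X → q ∉ S → ∀ s : ℂ,
        ∏ P ∈ primesAbove K q, (1 - ((Ideal.absNorm P : ℝ) : ℂ) ^ (-s)) =
          (∏ P ∈ primesAbove E q, (1 - ((Ideal.absNorm P : ℝ) : ℂ) ^ (-s))) ^ p) →
      ε * Real.log X ≤ ∑ q ∈ S, (q : ℝ) ^ (-(1 - 1 / (16 * (p * n : ℕ) : ℝ))) := by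
  obtain ⟨C₁, hC₁, h₁⟩ := exists_norm_compareFun_le_div n p (by omega)
  obtain ⟨C₂, hC₂, h₂⟩ := exists_norm_compareFun_le n p hn (by omega)
  have hpn : 1 ≤ p * n := Nat.mul_pos (by omega) hn
  have hpn' : (1 : ℝ) ≤ (p * n : ℕ) := by exact_mod_cast hpn
  have hn' : (1 : ℝ) ≤ n := by exact_mod_cast hn
  have hp' : (2 : ℝ) ≤ p := by exact_mod_cast hp
  set σ : ℝ := 1 - 1 / (16 * (p * n : ℕ) : ℝ) with hσdef
  have hσ1 : σ < 1 := by
    have : 0 < 1 / (16 * (p * n : ℕ) : ℝ) := by positivity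
    linarith
  have hσ0 : 0 ≤ σ := by
    rw [hσdef, sub_nonneg, div_le_one (by linarith)]; linarith
  have hσ2 : 1 - 1 / (2 * (p * n : ℕ) : ℝ) ≤ σ := by
    rw [hσdef]; gcongr; norm_num
  set θ : ℝ := (1 - σ) / (3 - σ) with hθdef
  have hθ0 : 0 < θ := div_pos (by linarith) (by linarith)
  have hθ1 : θ ≤ 1 := by rw [hθdef, div_le_one (by linarith)]; linarith
  set B : ℝ := (p * n : ℕ) * p + 2 * n * p with hB
  have hB0 : 0 < B := by positivity
  set D : ℝ := 2 * p + n * p with hD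
  have hD0 : 0 < D := by positivity
  set C : ℝ := C₂ * 3 ^ p * C₁ * (16 * n) ^ (n * p) with hC
  have hCpos : 0 < C := by positivity
  refine ⟨θ / (2 * B), by positivity, 4 * D / θ, by positivity, max C₁ (C ^ (4 / θ)), ?_⟩
  intro E K _ _ _ _ hE hK Q hQE hQK X hX hQX S hS hpr
  have hQ1 := hQE.one_le
  have hXC₁ : C₁ ≤ X := (le_max_left _ _).trans hX
  have hXC : C ^ (4 / θ) ≤ X := (le_max_right _ _).trans hX
  have hXpos : (0 : ℝ) < X := by linarith
  have hlogQ : D * Real.log Q ≤ θ / 4 * Real.log X := by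
    have := Real.log_le_log (by positivity) hQX
    rw [Real.log_rpow (by linarith)] at this
    calc D * Real.log Q = θ / 4 * (4 * D / θ * Real.log Q) := by field_simp
      _ ≤ _ := by gcongr
  have hlogC : Real.log C ≤ θ / 4 * Real.log X := by
    have := Real.log_le_log (by positivity) hXC
    rw [Real.log_rpow hCpos] at this
    calc Real.log C = θ / 4 * (4 / θ * Real.log C) := by field_simp
      _ ≤ _ := by gcongr
  have hSp : ∀ q ∈ S, q.Prime := fun q hq => (hS q hq).1
  set V := ∑ q ∈ S, (q : ℝ) ^ (-σ) with hV
  have hV0 : 0 ≤ V := Finset.sum_nonneg fun _ _ => by positivity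
  set a : ℝ := C₂ * 3 ^ p * Q ^ (2 * p) * Real.exp ((p * n : ℕ) * p * V) with ha
  have ha1 : 1 ≤ a := by
    rw [ha]
    refine one_le_mul_of_one_le_of_one_le (one_le_mul_of_one_le_of_one_le
      (one_le_mul_of_one_le_of_one_le hC₂ (one_le_pow₀ (by norm_num))) (one_le_pow₀ hQ1))
      (Real.one_le_exp (by positivity))
  let Φ : ℂ → ℂ := fun s => compareFun E K p S s / (s + 1) ^ p
  have hs1 : ∀ s : ℂ, σ ≤ s.re → 1 ≤ ‖s + 1‖ := by
    intro s hs
    refine le_trans ?_ (Complex.re_le_norm _)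
    simp only [Complex.add_re, Complex.one_re]
    linarith
  have hΦa : ∀ s : ℂ, σ ≤ s.re → s.re ≤ 4 → ‖Φ s‖ ≤ a := by
    intro s hs h4
    have h1 := hs1 s hs
    simp only [Φ, norm_div, norm_pow]
    rw [div_le_iff₀ (by positivity)]
    refine (h₂ E K hE hK Q hQE hQK S hSp σ hσ2 s hs h4).trans ?_
    have h3 : 1 + ‖s‖ ≤ 3 * ‖s + 1‖ := by
      have := norm_sub_le (s + 1) 1
      rw [add_sub_cancel_right, norm_one] at this
      linarith
    calc _ ≤ C₂ * Q ^ (2 * p) * (3 * ‖s + 1‖) ^ p * Real.exp ((p * n : ℕ) * p * V) := by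
          gcongr
      _ = _ := by rw [ha, mul_pow]; ring
  have hΦb : ∀ s : ℂ, s.re = 3 → ‖Φ s‖ ≤ C₁ / X := by
    intro s hs
    have h1 := hs1 s (by linarith)
    simp only [Φ, norm_div, norm_pow]
    refine (div_le_self (norm_nonneg _) (one_le_pow₀ h1)).trans ?_
    exact h₁ E K hE hK X hXC₁ S hS hpr s hs
  have hdiff : DiffContOnCl ℂ Φ (Complex.HadamardThreeLines.verticalStrip σ 3) := by
    apply DifferentiableOn.diffContOnCl
    intro s hs
    rw [Complex.HadamardThreeLines.verticalStrip, Complex.closure_preimage_re,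
      closure_Ioo (by linarith)] at hs
    obtain ⟨hs2, hs3⟩ : σ ≤ s.re ∧ s.re ≤ 3 := hs
    have hne : s + 1 ≠ 0 := fun h => by
      have := hs1 s hs2
      rw [h, norm_zero] at this; linarith
    have hEd : DifferentiableAt ℂ (etaFun E) s := by
      refine differentiableAt_etaFun hQE ?_ (by linarith)
      rw [hE]
      refine lt_of_lt_of_le ?_ hs2
      rw [hσdef]
      gcongr 1 - 1 / ?_
      have : (n : ℝ) ≤ (p * n : ℕ) := by exact_mod_cast Nat.le_mul_of_pos_left n (by omega)
      linarith
    have hKd : DifferentiableAt ℂ (etaFun K) s := by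
      refine differentiableAt_etaFun hQK ?_ (by linarith)
      rw [hK]
      refine lt_of_lt_of_le ?_ hs2
      rw [hσdef]
      gcongr 1 - 1 / ?_
      linarith
    have h2 := differentiable_twoFactor (Module.finrank ℚ E) s
    have h3 := differentiable_eulerInv (K := E) S s
    have h4 := differentiable_eulerInv (K := K) S s
    refine DifferentiableAt.differentiableWithinAt ?_
    simp only [Φ, compareFun]
    fun_prop (disch := exact pow_ne_zero _ hne)
  have hbdd : BddAbove ((norm ∘ Φ) '' Complex.HadamardThreeLines.verticalClosedStrip σ 3) := by
    refine ⟨a, ?_⟩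
    rintro _ ⟨s, hs, rfl⟩
    obtain ⟨hs2, hs3⟩ : σ ≤ s.re ∧ s.re ≤ 3 := hs
    exact hΦa s hs2 (by linarith)
  have hup := Complex.HadamardThreeLines.norm_le_interp_of_mem_verticalClosedStrip'
    (f := Φ) (l := σ) (u := 3) (z := 1) (by linarith) (a := a) (b := C₁ / X)
    (by (constructor <;> simp) <;> linarith) hdiff hbdd
    (fun s hs => hΦa s (le_of_eq hs.symm) (by rw [show s.re = σ from hs]; linarith))
    (fun s hs => hΦb s hs)
  rw [Complex.one_re, ← hθdef] at hup
  have hlow : ((16 * n * Q) ^ (-(n : ℝ)) * Real.exp (-(2 * n * V))) ^ p ≤ ‖Φ 1‖ := by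
    have h1 : Φ 1 = ((p : ℂ) / 2 * (etaFun E 1 * eulerInv E S 1)) ^ p := by
      simp only [Φ, compareFun, twoFactor_one, one_pow, sub_self]
      rw [zero_pow (by omega)]
      simp only [Finset.sum_const, Finset.card_range, nsmul_eq_mul, mul_one, zero_mul, sub_zero]
      rw [← div_pow]
      congr 1
      norm_num
      ring
    rw [h1, norm_pow, norm_mul, norm_mul]
    have h2 := le_norm_etaFun_one hQE
    have h3 := le_norm_eulerInv_one (K := E) hSp hσ1.le
    rw [hE] at h2 h3
    refine pow_le_pow_left₀ (by positivity) ?_ p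
    rw [norm_div, Complex.norm_natCast, Complex.norm_ofNat]
    have h4 : 1 ≤ (p : ℝ) / 2 := by linarith
    refine (mul_le_mul h2 h3 (by positivity) (norm_nonneg _)).trans ?_
    exact le_mul_of_one_le_left (by positivity) h4
  have hup2 : a ^ (1 - θ) * (C₁ / X) ^ θ ≤ a * (C₁ * (X : ℝ) ^ (-θ)) := by
    rw [Real.div_rpow (by linarith) hXpos.le, Real.rpow_neg hXpos.le, div_eq_mul_inv]
    gcongr
    · exact Real.rpow_le_self_of_one_le ha1 (by linarith)
    · exact Real.rpow_le_self_of_one_le hC₁ hθ1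
  have hfin := Real.log_le_log (by positivity) (hlow.trans (hup.trans hup2))
  have hlogl : Real.log (((16 * n * Q) ^ (-(n : ℝ)) * Real.exp (-(2 * n * V))) ^ p) =
      p * (-n * (Real.log (16 * n) + Real.log Q) - 2 * n * V) := by
    rw [Real.log_pow, Real.log_mul (by positivity) (by positivity), Real.log_exp,
      Real.log_rpow (by positivity), Real.log_mul (by positivity) (by positivity)]
    ring
  have hlogr : Real.log (a * (C₁ * (X : ℝ) ^ (-θ))) = Real.log (C₂ * 3 ^ p) +
      2 * p * Real.log Q + (p * n : ℕ) * p * V + Real.log C₁ - θ * Real.log X := by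
    rw [Real.log_mul (by positivity) (by positivity),
      Real.log_mul (x := C₁) (by positivity) (by positivity),
      Real.log_rpow hXpos, ha, Real.log_mul (by positivity) (by positivity), Real.log_exp,
      Real.log_mul (by positivity) (by positivity), Real.log_pow]
    push_cast
    ring
  rw [hlogl, hlogr] at hfin
  have hC' : Real.log C = Real.log (C₂ * 3 ^ p) + Real.log C₁ + n * p * Real.log (16 * n) := by
    rw [hC, Real.log_mul (by positivity) (by positivity),
      Real.log_mul (by positivity) (by positivity), Real.log_pow]
    push_cast; ring
  push_cast at hfin
  have hmain : θ / 2 * Real.log X ≤ B * V := by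
    rw [hB]
    push_cast
    rw [hD] at hlogQ
    linarith
  rw [div_mul_eq_mul_div, div_le_iff₀ (by positivity)]
  linarith

end Contra

section PGroups

variable {p : ℕ} [hp : Fact p.Prime] {G : Type*} [Group G] [Finite G]

lemma IsPGroup.exists_pow_notMem_pow_succ_mem (hG : IsPGroup p G) (A : Subgroup G) {g : G}
    (hg : g ∉ A) : ∃ m : ℕ, g ^ p ^ m ∉ A ∧ (g ^ p ^ m) ^ p ∈ A := by
  classical
  obtain ⟨k, hk⟩ := hG g
  have hex : ∃ m : ℕ, g ^ p ^ m ∈ A := ⟨k, by rw [hk]; exact A.one_mem⟩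
  have h1 := Nat.find_spec hex
  have h0 : Nat.find hex ≠ 0 := fun h => hg (by simpa [h] using h1)
  obtain ⟨m, hm⟩ := Nat.exists_eq_succ_of_ne_zero h0
  refine ⟨m, Nat.find_min hex (by omega), ?_⟩
  rw [← pow_mul, ← pow_succ]
  rwa [hm] at h1

lemma IsPGroup.exists_mem_center_of_normal (hG : IsPGroup p G) (N : Subgroup G) [N.Normal]
    (hN : N ≠ ⊥) : ∃ x ∈ N, x ≠ 1 ∧ x ∈ Subgroup.center G := by
  have : IsPGroup p (ConjAct G) := hG
  have hN' : Nontrivial N := (Subgroup.nontrivial_iff_ne_bot N).2 hN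
  have hcard : p ∣ Nat.card N := (hG.to_subgroup N).card_eq_or_dvd.resolve_left
    (fun h => by have := (Nat.card_eq_one_iff_unique.1 h).1; exact not_subsingleton N this)
  have h1 : (1 : N) ∈ MulAction.fixedPoints (ConjAct G) N := fun g => by
    simp
  obtain ⟨x, hx, hx1⟩ := this.exists_fixed_point_of_prime_dvd_card_of_fixed_point N hcard h1
  refine ⟨x, x.2, fun h => hx1 (Subtype.ext h.symm), Subgroup.mem_center_iff.2 fun g => ?_⟩
  have h2 := congrArg Subtype.val (hx (ConjAct.toConjAct g))
  rw [ConjAct.Subgroup.val_conj_smul, ConjAct.smul_def, ConjAct.ofConjAct_toConjAct] at h2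
  exact mul_inv_eq_iff_eq_mul.1 h2

lemma mem_zpowers_of_commute_of_pow_eq {a t : G} (hU : ∀ z : G, z ^ p = 1 → z ∈ Subgroup.zpowers a)
    (hc : Commute a t) {c : ℤ} (ht : t ^ p = a ^ (p * c)) : t ∈ Subgroup.zpowers a := by
  have h1 : (t * a ^ (-c)) ^ p = 1 := by
    rw [(hc.symm.zpow_right (-c)).mul_pow, ht, ← zpow_natCast, ← zpow_mul, ← zpow_add]
    ring_nf
    exact zpow_zero a
  have := Subgroup.mul_mem _ (hU _ h1) (Subgroup.zpow_mem_zpowers a c)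
  rwa [mul_assoc, ← zpow_add, neg_add_cancel, zpow_zero, mul_one] at this

lemma mem_zpowers_zpow_of_not_dvd {a : G} {k : ℕ} (ha : orderOf a = p ^ k) {c : ℤ}
    (hc : ¬ (p : ℤ) ∣ c) : a ∈ Subgroup.zpowers (a ^ c) := by
  have hcop : IsCoprime c ((p ^ k : ℕ) : ℤ) := by
    push_cast
    exact (((Nat.prime_iff_prime_int.1 hp.out).coprime_iff_not_dvd).2 hc).symm.pow_right
  obtain ⟨u, v, huv⟩ := hcop
  refine ⟨u, ?_⟩
  have h1 : a ^ (c * u + orderOf a * v) = a := by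
    rw [ha, mul_comm c, mul_comm _ v, huv, zpow_one]
  rw [zpow_add, zpow_mul, zpow_mul a (orderOf a), zpow_natCast, pow_orderOf_eq_one, one_zpow,
    mul_one] at h1
  exact h1

/-- A maximal normal cyclic subgroup containing all elements of order `p` is its own
centralizer. -/
lemma IsPGroup.mem_zpowers_of_commute (hG : IsPGroup p G) {a : G}
    [hn : (Subgroup.zpowers a).Normal]
    (hmax : ∀ b : G, (Subgroup.zpowers b).Normal → orderOf b ≤ orderOf a)
    (hU : ∀ z : G, z ^ p = 1 → z ∈ Subgroup.zpowers a) {g : G} (hg : Commute a g) :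
    g ∈ Subgroup.zpowers a := by
  by_contra hgA
  let A := Subgroup.zpowers a
  let C := Subgroup.centralizer (A : Set G)
  have hmemC : ∀ x : G, x ∈ C ↔ Commute a x := by
    intro x
    rw [Subgroup.mem_centralizer_iff]
    constructor
    · intro h; exact h a (Subgroup.mem_zpowers a)
    · rintro h _ ⟨i, rfl⟩; exact (h.zpow_left i).eq
  let π := QuotientGroup.mk' A
  have hNn : (C.map π).Normal := Subgroup.Normal.map inferInstance π (QuotientGroup.mk'_surjective A)
  have hN : C.map π ≠ ⊥ := by
    intro h
    have : π g ∈ C.map π := Subgroup.mem_map_of_mem _ ((hmemC g).2 hg)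
    rw [h, Subgroup.mem_bot] at this
    exact hgA ((QuotientGroup.eq_one_iff g).1 this)
  obtain ⟨x, hxC, hx1, hxZ⟩ := (hG.to_quotient A).exists_mem_center_of_normal (C.map π) hN
  obtain ⟨t₀, ht₀, rfl⟩ := hxC
  have ht₀A : t₀ ∉ A := fun h => hx1 ((QuotientGroup.eq_one_iff t₀).2 h)
  obtain ⟨m, hm1, hm2⟩ := hG.exists_pow_notMem_pow_succ_mem A ht₀A
  set t := t₀ ^ p ^ m with ht
  have htC : Commute a t := (hmemC t).1 (Subgroup.pow_mem _ ht₀ _)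
  have htZ : π t ∈ Subgroup.center (G ⧸ A) := by
    rw [ht, map_pow]; exact Subgroup.pow_mem _ hxZ _
  obtain ⟨c, hc⟩ := hm2
  obtain ⟨k, hk⟩ := (IsPGroup.iff_orderOf.1 hG) a
  by_cases hpc : (p : ℤ) ∣ c
  · obtain ⟨d, rfl⟩ := hpc
    exact hm1 (mem_zpowers_of_commute_of_pow_eq hU htC hc.symm)
  · have hat : a ∈ Subgroup.zpowers t := by
      have h1 := mem_zpowers_zpow_of_not_dvd hk hpc
      simp only at hc
      rw [hc] at h1
      exact (Subgroup.zpowers_le.2 (Subgroup.npow_mem_zpowers t p)) h1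
    have htn : (Subgroup.zpowers t).Normal := by
      refine ⟨?_⟩
      rintro _ ⟨i, rfl⟩ h
      simp only
      rw [← conj_zpow]
      refine Subgroup.zpow_mem _ ?_ i
      have h2 : t⁻¹ * (h * t * h⁻¹) ∈ A := by
        rw [← QuotientGroup.eq_one_iff]
        change π (t⁻¹ * (h * t * h⁻¹)) = 1
        have h3 := Subgroup.mem_center_iff.1 htZ (π h)
        simp only [map_mul, map_inv]
        rw [h3]; group
      have h4 := Subgroup.mul_mem _ (Subgroup.mem_zpowers t)
        ((Subgroup.zpowers_le.2 hat) h2)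
      rwa [mul_inv_cancel_left] at h4
    have hlt : Subgroup.zpowers a < Subgroup.zpowers t :=
      lt_of_le_of_ne (Subgroup.zpowers_le.2 hat) fun h => hm1 (by
        change t ∈ Subgroup.zpowers a
        rw [h]; exact Subgroup.mem_zpowers t)
    have := Set.ncard_lt_ncard (SetLike.coe_ssubset_coe.2 hlt)
    have h5 := hmax t htn
    rw [← Nat.card_zpowers, ← Nat.card_zpowers] at h5
    rw [← Nat.card_coe_set_eq, ← Nat.card_coe_set_eq] at this
    exact absurd h5 (not_le.2 this)

lemma conj_pow_of_conj_eq_zpow {a g : G} {r : ℤ} (h : g * a * g⁻¹ = a ^ r) (j : ℕ) (i : ℤ) :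
    g ^ j * a ^ i = a ^ (r ^ j * i) * g ^ j := by
  induction j generalizing i with
  | zero => simp
  | succ j ih =>
    have h1 : g * a ^ i = a ^ (r * i) * g := by
      rw [zpow_mul, ← h, conj_zpow]; group
    rw [pow_succ, mul_assoc, h1, ← mul_assoc, ih, mul_assoc]
    ring_nf

lemma mul_zpow_pow_of_conj_eq_zpow {a g : G} {r : ℤ} (h : g * a * g⁻¹ = a ^ r) (i : ℤ) (j : ℕ) :
    (g * a ^ i) ^ j = a ^ ((∑ l ∈ Finset.range j, r ^ (l + 1)) * i) * g ^ j := by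
  induction j with
  | zero => simp
  | succ j ih =>
    rw [pow_succ', ih, Finset.sum_range_succ']
    have h1 := conj_pow_of_conj_eq_zpow h 1
    simp only [pow_one] at h1
    rw [h1, mul_assoc, ← mul_assoc g, h1, ← mul_assoc, ← mul_assoc, ← zpow_add,
      mul_assoc, ← pow_succ']
    congr 2
    simp only [pow_succ r, add_mul, Finset.sum_mul, Finset.mul_sum, pow_zero, one_mul]
    rw [add_comm]
    congr 1
    exact Finset.sum_congr rfl fun l _ => by ring

lemma Int.sq_dvd_one_add_pow_sub (x : ℤ) (j : ℕ) : x ^ 2 ∣ (1 + x) ^ j - 1 - j * x := by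
  induction j with
  | zero => simp
  | succ j ih =>
    obtain ⟨c, hc⟩ := ih
    refine ⟨c * (1 + x) + j, ?_⟩
    have : (1 + x) ^ j = x ^ 2 * c + 1 + j * x := by linarith
    rw [pow_succ, this]
    push_cast
    ring

lemma exists_prime_pow_dvd_mul_add {k : ℕ} {u c : ℤ} (hu : ¬ (p : ℤ) ∣ u) (hc : (p : ℤ) ∣ c) :
    ∃ i : ℤ, (p : ℤ) ^ k ∣ p * u * i + c := by
  have hcop : IsCoprime u ((p : ℤ) ^ k) :=
    (((Nat.prime_iff_prime_int.1 hp.out).coprime_iff_not_dvd).2 hu).symm.pow_right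
  obtain ⟨x, y, hxy⟩ := hcop
  obtain ⟨d, rfl⟩ := hc
  refine ⟨-x * d, p * d * y, ?_⟩
  linear_combination (-(p : ℤ) * d) * hxy

lemma exists_prime_pow_dvd_sum_pow_mul_add {k : ℕ} {r c : ℤ} (h1 : (p : ℤ) ^ k ∣ r ^ p - 1)
    (h2 : ¬ (p : ℤ) ^ k ∣ r - 1) (h3 : (p : ℤ) ^ k ∣ (r - 1) * c) :
    (∃ i : ℤ, (p : ℤ) ^ k ∣ (∑ l ∈ Finset.range p, r ^ (l + 1)) * i + c) ∨
    (p = 2 ∧ 2 ≤ k ∧ (2 : ℤ) ^ k ∣ r + 1 ∧ (2 : ℤ) ^ k ∣ c - 2 ^ (k - 1)) := by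
  have hk : k ≠ 0 := by rintro rfl; simp at h2
  have hpp := Nat.prime_iff_prime_int.1 hp.out
  have hpr : (p : ℤ) ∣ r - 1 := by
    have h4 : (p : ℤ) ∣ r ^ p - 1 := (dvd_pow_self _ hk).trans h1
    have h5 : (p : ℤ) ∣ r ^ p - r := by
      rw [← ZMod.intCast_zmod_eq_zero_iff_dvd]
      push_cast
      rw [ZMod.pow_card, sub_self]
    have := dvd_sub h4 h5
    rwa [show r ^ p - 1 - (r ^ p - r) = r - 1 by ring] at this
  have hpc : (p : ℤ) ∣ c := by
    by_contra h
    exact h2 ((((hpp.coprime_iff_not_dvd).2 h).pow_left).dvd_of_dvd_mul_right h3)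
  obtain ⟨m, hm⟩ := hpr
  obtain rfl : r = 1 + p * m := by linarith
  rcases hp.out.eq_two_or_odd' with rfl | ⟨d, hd⟩
  · rw [Finset.sum_range_succ, Finset.sum_range_succ, Finset.sum_range_zero]
    push_cast at *
    by_cases hmo : (2 : ℤ) ∣ m
    · left
      obtain ⟨v, rfl⟩ := hmo
      obtain ⟨i, hi⟩ := exists_prime_pow_dvd_mul_add (p := 2) (k := k) (c := c)
        (u := (1 + 2 * (2 * v)) * (1 + 2 * v)) (by
          push_cast
          intro h
          rcases Int.prime_two.dvd_or_dvd h with h | h <;> omega) hpc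
      refine ⟨i, ?_⟩
      push_cast at hi
      convert hi using 1
      ring
    · obtain ⟨j, rfl⟩ : ∃ j, k = j + 1 := ⟨k - 1, by omega⟩
      have hcop : IsCoprime ((2 : ℤ) ^ j) m :=
        ((Int.prime_two.coprime_iff_not_dvd).2 hmo).pow_left
      have hcj : (2 : ℤ) ^ j ∣ c := by
        rw [show (1 + 2 * m - 1) * c = 2 * (m * c) by ring, pow_succ',
          mul_dvd_mul_iff_left (by norm_num)] at h3
        exact hcop.dvd_of_dvd_mul_left h3
      have hmj : (2 : ℤ) ^ j ∣ 2 * (1 + m) := by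
        rw [show (1 + 2 * m) ^ 2 - 1 = 2 * (m * (2 * (1 + m))) by ring, pow_succ',
          mul_dvd_mul_iff_left (by norm_num)] at h1
        exact hcop.dvd_of_dvd_mul_left h1
      obtain ⟨e, rfl⟩ := hcj
      obtain ⟨f, hf⟩ := hmj
      by_cases he : (2 : ℤ) ∣ e
      · left
        obtain ⟨e, rfl⟩ := he
        exact ⟨0, e, by ring⟩
      by_cases hff : (2 : ℤ) ∣ f
      · right
        refine ⟨trivial, ?_, ?_, ?_⟩
        · by_contra hj
          obtain rfl : j = 0 := by omega
          apply h2
          exact ⟨m, by ring⟩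
        · obtain ⟨f, rfl⟩ := hff
          exact ⟨f, by linear_combination hf⟩
        · rw [Nat.add_sub_cancel]
          obtain ⟨w, hw⟩ : (2 : ℤ) ∣ e - 1 := by omega
          exact ⟨w, by linear_combination (2 : ℤ) ^ j * hw⟩
      · left
        refine ⟨1, ?_⟩
        have h5 : (2 : ℤ) ∣ (1 + 2 * m) * f + e := by
          obtain ⟨w, hw⟩ : (2 : ℤ) ∣ e - 1 := by omega
          obtain ⟨w', hw'⟩ : (2 : ℤ) ∣ f - 1 := by omega
          exact ⟨w + w' + 1 + m * f, by linear_combination hw + hw'⟩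
        obtain ⟨w, hw⟩ := h5
        refine ⟨w, ?_⟩
        linear_combination (1 + 2 * m) * hf + (2 : ℤ) ^ j * hw
  · left
    have hS : ∃ w : ℤ, ∑ l ∈ Finset.range p, (1 + p * m) ^ (l + 1) = p * (1 + p * w) := by
      choose v hv using fun l : ℕ => Int.sq_dvd_one_add_pow_sub ((p : ℤ) * m) (l + 1)
      have h6 : ∑ l ∈ Finset.range p, ((l : ℤ) + 1) = p * (d + 1) := by
        have h7 : ∀ n : ℕ, (∑ l ∈ Finset.range n, ((l : ℤ) + 1)) * 2 = n * (n + 1) := by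
          intro n
          induction n with
          | zero => simp
          | succ n ih => rw [Finset.sum_range_succ, add_mul, ih]; push_cast; ring
        have h8 := h7 p
        have h9 : (p : ℤ) = 2 * d + 1 := by exact_mod_cast hd
        have h10 : (p : ℤ) * (p + 1) = p * (d + 1) * 2 := by
          linear_combination (p : ℤ) * h9
        linarith
      refine ⟨(d + 1) * m + m ^ 2 * ∑ l ∈ Finset.range p, v l, ?_⟩
      have h11 : ∀ l ∈ Finset.range p, (1 + (p : ℤ) * m) ^ (l + 1) =
          1 + ((l : ℤ) + 1) * (p * m) + (p * m) ^ 2 * v l := by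
        intro l _
        have := hv l
        push_cast at this
        linarith
      rw [Finset.sum_congr rfl h11, Finset.sum_add_distrib, Finset.sum_add_distrib,
        ← Finset.sum_mul, h6, ← Finset.mul_sum]
      simp only [Finset.sum_const, Finset.card_range, nsmul_eq_mul, mul_one]
      ring
    obtain ⟨w, hw⟩ := hS
    rw [hw]
    refine exists_prime_pow_dvd_mul_add ?_ hpc
    rw [Int.dvd_add_left (dvd_mul_right _ _)]
    exact fun h => hpp.not_isUnit (isUnit_of_dvd_one h)

lemma Subgroup.exists_conj_eq_zpow {a : G} [hn : (Subgroup.zpowers a).Normal] (g : G) :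
    ∃ r : ℤ, g * a * g⁻¹ = a ^ r := by
  obtain ⟨r, hr⟩ := hn.conj_mem a (Subgroup.mem_zpowers a) g
  exact ⟨r, hr.symm⟩

lemma IsPGroup.conj_eq_inv {a : G} [hn : (Subgroup.zpowers a).Normal]
    {k : ℕ} (hk : orderOf a = p ^ k)
    (hU : ∀ z : G, z ^ p = 1 → z ∈ Subgroup.zpowers a)
    (hC : ∀ g : G, Commute a g → g ∈ Subgroup.zpowers a) {g : G} (hg : g ∉ Subgroup.zpowers a)
    (hgp : g ^ p ∈ Subgroup.zpowers a) :
    p = 2 ∧ 2 ≤ k ∧ g * a * g⁻¹ = a⁻¹ ∧ g ^ 2 = a ^ 2 ^ (k - 1) := by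
  obtain ⟨r, hr⟩ := Subgroup.exists_conj_eq_zpow (a := a) g
  obtain ⟨c, hc⟩ := hgp
  simp only at hc
  have hone : ∀ i : ℤ, a ^ i = 1 ↔ (p : ℤ) ^ k ∣ i := fun i => by
    rw [← orderOf_dvd_iff_zpow_eq_one, hk]; push_cast; rfl
  have h1 : (p : ℤ) ^ k ∣ r ^ p - 1 := by
    have h := conj_pow_of_conj_eq_zpow hr p 1
    rw [← hc, ← zpow_add, ← zpow_add] at h
    rw [← hone, zpow_sub, zpow_one]
    rw [mul_one, add_comm, zpow_add, zpow_add, mul_left_inj, zpow_one] at h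
    rw [← h, mul_inv_cancel]
  have h2 : ¬ (p : ℤ) ^ k ∣ r - 1 := by
    rw [← hone, zpow_sub, zpow_one, mul_inv_eq_one, ← hr, mul_inv_eq_iff_eq_mul]
    exact fun h => hg (hC g h.symm)
  have h3 : (p : ℤ) ^ k ∣ (r - 1) * c := by
    have h : g * a ^ c * g⁻¹ = a ^ c := by
      rw [hc, ← pow_succ', pow_succ, mul_inv_cancel_right]
    rw [← conj_zpow, hr, ← zpow_mul] at h
    rw [← hone, sub_mul, one_mul, zpow_sub, h, mul_inv_cancel]
  rcases exists_prime_pow_dvd_sum_pow_mul_add h1 h2 h3 with ⟨i, hi⟩ | ⟨rfl, hk2, h4, h5⟩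
  · exfalso
    have h := mul_zpow_pow_of_conj_eq_zpow hr i p
    rw [← hc, ← zpow_add, (hone _).2 hi] at h
    have := Subgroup.mul_mem _ (hU _ h) (Subgroup.zpow_mem_zpowers a (-i))
    rw [mul_assoc, ← zpow_add, add_neg_cancel, zpow_zero, mul_one] at this
    exact hg this
  · refine ⟨rfl, hk2, ?_, ?_⟩
    · rw [hr, eq_inv_iff_mul_eq_one, ← zpow_add_one, hone]
      exact_mod_cast h4
    · rw [← hc, ← zpow_natCast, ← mul_inv_eq_one, ← zpow_sub, hone]
      exact_mod_cast h5

lemma nonempty_mulEquiv_quaternionGroup {a g : G} {n : ℕ} (hn : n ≠ 0)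
    (ha : orderOf a = 2 * n) (hg : g ∉ Subgroup.zpowers a) (hga : g * a * g⁻¹ = a⁻¹)
    (hg2 : g ^ 2 = a ^ n) (hG : ∀ x : G, x ∈ Subgroup.zpowers a ∨ g⁻¹ * x ∈ Subgroup.zpowers a) :
    Nonempty (G ≃* QuaternionGroup n) := by
  have : NeZero (2 * n) := ⟨by omega⟩
  let φ : ZMod (2 * n) → G := fun i => a ^ (i.cast : ℤ)
  have hφ : ∀ i : ℤ, φ (i : ZMod (2 * n)) = a ^ i := by
    intro i
    simp only [φ]
    rw [zpow_eq_zpow_iff_modEq, ha, ← ZMod.intCast_eq_intCast_iff]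
    simp
  have hadd : ∀ i j, φ (i + j) = φ i * φ j := by
    intro i j
    obtain ⟨i, rfl⟩ := ZMod.intCast_surjective i
    obtain ⟨j, rfl⟩ := ZMod.intCast_surjective j
    rw [← Int.cast_add, hφ, hφ, hφ, zpow_add]
  have hneg : ∀ i, φ (-i) * g = g * φ i := by
    intro i
    obtain ⟨i, rfl⟩ := ZMod.intCast_surjective i
    rw [← Int.cast_neg, hφ, hφ, zpow_neg, ← inv_zpow, ← hga, conj_zpow]
    group
  have hn' : φ n = g ^ 2 := by
    rw [hg2, ← zpow_natCast, ← hφ]; simp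
  have hmem : ∀ i, φ i ∈ Subgroup.zpowers a := fun i => Subgroup.zpow_mem_zpowers _ _
  let f : QuaternionGroup n → G := fun x => match x with
    | QuaternionGroup.a i => φ i
    | QuaternionGroup.xa i => g * φ i
  have hfa : ∀ i, f (QuaternionGroup.a i) = φ i := fun _ => rfl
  have hfx : ∀ i, f (QuaternionGroup.xa i) = g * φ i := fun _ => rfl
  have hmul : ∀ x y, f (x * y) = f x * f y := by
    rintro (i | i) (j | j)
    · rw [QuaternionGroup.a_mul_a, hfa, hfa, hfa, hadd]
    · rw [QuaternionGroup.a_mul_xa, hfa, hfx, hfx, sub_eq_neg_add, hadd, ← mul_assoc, ← hneg,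
        neg_neg, mul_assoc]
    · rw [QuaternionGroup.xa_mul_a, hfx, hfx, hfa, hadd, mul_assoc]
    · rw [QuaternionGroup.xa_mul_xa, hfx, hfx, hfa,
        show (n : ZMod (2 * n)) + j - i = n + (-i + j) by ring, hadd, hadd, hn', pow_two,
        mul_assoc g g, mul_assoc g (φ i), ← mul_assoc (φ i), ← neg_neg i, hneg, neg_neg, mul_assoc]
  have hinj : Function.Injective φ := by
    intro i j h
    obtain ⟨i, rfl⟩ := ZMod.intCast_surjective i
    obtain ⟨j, rfl⟩ := ZMod.intCast_surjective j
    rw [hφ, hφ, zpow_eq_zpow_iff_modEq, ha, ← ZMod.intCast_eq_intCast_iff] at h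
    exact h
  refine ⟨(MulEquiv.ofBijective (MulHom.mk f hmul) ⟨?_, ?_⟩).symm⟩
  · rintro (i | i) (j | j) h
    · exact congrArg _ (hinj h)
    · refine absurd ?_ hg
      have h' : φ i = g * φ j := h
      have : g = φ i * (φ j)⁻¹ := by rw [h', mul_inv_cancel_right]
      rw [this]; exact Subgroup.mul_mem _ (hmem _) (Subgroup.inv_mem _ (hmem _))
    · refine absurd ?_ hg
      have h' : g * φ i = φ j := h
      have : g = φ j * (φ i)⁻¹ := by rw [← h', mul_inv_cancel_right]
      rw [this]; exact Subgroup.mul_mem _ (hmem _) (Subgroup.inv_mem _ (hmem _))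
    · exact congrArg _ (hinj (mul_left_cancel (h : g * φ i = g * φ j)))
  · intro x
    rcases hG x with ⟨i, hi⟩ | ⟨i, hi⟩
    · exact ⟨QuaternionGroup.a i, (hφ i).trans hi⟩
    · refine ⟨QuaternionGroup.xa i, ?_⟩
      change g * φ i = x
      rw [hφ]; simp only at hi; rw [hi, mul_inv_cancel_left]

/-- A finite `p`-group which is neither cyclic nor generalized quaternion has, for every cyclic
subgroup, an element of order `p` outside it. -/
theorem IsPGroup.exists_orderOf_eq_prime_notMem (hG : IsPGroup p G) (hnc : ¬ IsCyclic G)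
    (hnq : ∀ n : ℕ, 1 ≤ n → IsEmpty (G ≃* QuaternionGroup (2 ^ n)))
    (H : Subgroup G) [hH : IsCyclic H] : ∃ z : G, orderOf z = p ∧ z ∉ H := by
  by_contra! hall
  have hnt : Nontrivial G := by
    by_contra h
    rw [not_nontrivial_iff_subsingleton] at h
    exact hnc inferInstance
  -- all elements of order `p` generate the same subgroup
  have hU0 : ∀ z w : G, orderOf z = p → w ^ p = 1 → w ∈ Subgroup.zpowers z := by
    intro z w hz hw
    rcases eq_or_ne w 1 with rfl | hw1
    · exact Subgroup.one_mem _
    have hw' := orderOf_eq_prime hw hw1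
    have : Fintype H := Fintype.ofFinite H
    classical
    let Z : Finset H := Finset.univ.filter fun x => x ^ p = 1
    have hZ : Z.card ≤ p := IsCyclic.card_pow_eq_one_le hp.out.pos
    let z' : H := ⟨z, hall z hz⟩
    have hz' : orderOf z' = p := by rw [← hz]; exact Subgroup.orderOf_mk z _
    let Y : Finset H := Finset.univ.filter fun x => x ∈ Subgroup.zpowers z'
    have hY : Y.card = p := by
      rw [← hz', ← Nat.card_zpowers, Nat.card_eq_fintype_card, Fintype.card_subtype]
    have hYZ : Y ⊆ Z := by
      intro x hx
      obtain ⟨i, rfl⟩ := (Finset.mem_filter.1 hx).2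
      refine Finset.mem_filter.2 ⟨Finset.mem_univ _, ?_⟩
      simp only
      rw [← zpow_natCast, ← zpow_mul, mul_comm, zpow_mul, zpow_natCast, ← hz', pow_orderOf_eq_one,
        one_zpow]
    have hmem : (⟨w, hall w hw'⟩ : H) ∈ Y := by
      rw [Finset.eq_of_subset_of_card_le hYZ (by rw [hY]; exact hZ)]
      exact Finset.mem_filter.2 ⟨Finset.mem_univ _, Subtype.ext hw⟩
    obtain ⟨i, hi⟩ := (Finset.mem_filter.1 hmem).2
    exact ⟨i, congrArg Subtype.val hi⟩
  -- a maximal normal cyclic subgroup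
  obtain ⟨a, han, hmax⟩ : ∃ a : G, (Subgroup.zpowers a).Normal ∧
      ∀ b : G, (Subgroup.zpowers b).Normal → orderOf b ≤ orderOf a := by
    obtain ⟨a, ha, hmax⟩ := Set.exists_max_image {a : G | (Subgroup.zpowers a).Normal} orderOf
      (Set.toFinite _) ⟨1, by rw [Set.mem_ofPred_eq, Subgroup.zpowers_one_eq_bot]; infer_instance⟩
    exact ⟨a, ha, hmax⟩
  have ha1 : a ≠ 1 := by
    rintro rfl
    have hZ := hG.center_nontrivial
    obtain ⟨⟨z, hz⟩, hz1⟩ := exists_ne (1 : Subgroup.center G)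
    have hzn : (Subgroup.zpowers z).Normal := by
      refine ⟨?_⟩
      rintro _ ⟨i, rfl⟩ h
      have := Subgroup.mem_center_iff.1 (Subgroup.zpow_mem _ hz i) h
      simp only
      rw [this, mul_inv_cancel_right]
      exact Subgroup.zpow_mem_zpowers z i
    have h1 := hmax z hzn
    rw [orderOf_one] at h1
    have h2 : orderOf z = 1 := le_antisymm h1 (orderOf_pos z)
    rw [orderOf_eq_one_iff] at h2
    exact hz1 (Subtype.ext h2)
  obtain ⟨k, hk⟩ := (IsPGroup.iff_orderOf.1 hG) a
  have hU : ∀ z : G, z ^ p = 1 → z ∈ Subgroup.zpowers a := by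
    intro z hz
    have hdvd := hG.dvd_orderOf ha1
    have hb : orderOf (a ^ (orderOf a / p)) = p :=
      orderOf_pow_orderOf_div (orderOf_pos a).ne' hdvd
    exact Subgroup.zpowers_le.2 (Subgroup.npow_mem_zpowers a _) (hU0 _ z hb hz)
  have hC : ∀ g : G, Commute a g → g ∈ Subgroup.zpowers a := fun g hg =>
    hG.mem_zpowers_of_commute hmax hU hg
  have hex : ∃ g₀, g₀ ∉ Subgroup.zpowers a := by
    by_contra! h
    exact hnc ⟨a, h⟩
  obtain ⟨g₀, hg₀⟩ := hex
  obtain ⟨m, hm1, hm2⟩ := hG.exists_pow_notMem_pow_succ_mem _ hg₀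
  obtain ⟨rfl, hk2, hg1, hg2⟩ := IsPGroup.conj_eq_inv hk hU hC hm1 hm2
  set g := g₀ ^ 2 ^ m with hg
  have hinv : ∀ x, x ∉ Subgroup.zpowers a → x * a * x⁻¹ = a⁻¹ := by
    intro x hx
    obtain ⟨j, hj1, hj2⟩ := hG.exists_pow_notMem_pow_succ_mem _ hx
    have h1 := (IsPGroup.conj_eq_inv hk hU hC hj1 hj2).2.2.1
    rcases Nat.eq_zero_or_pos j with rfl | hj
    · simpa using h1
    exfalso
    obtain ⟨j, rfl⟩ : ∃ i, j = i + 1 := ⟨j - 1, by omega⟩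
    set y := x ^ 2 ^ j with hy
    have hy2 : x ^ 2 ^ (j + 1) = y ^ 2 := by rw [hy, ← pow_mul, ← pow_succ]
    obtain ⟨s, hs⟩ := Subgroup.exists_conj_eq_zpow (a := a) y
    have h2 := conj_pow_of_conj_eq_zpow hs 2 1
    rw [hy2, mul_inv_eq_iff_eq_mul] at h1
    rw [zpow_one, h1, mul_left_inj, mul_one] at h2
    have h3 : a ^ (s ^ 2 + 1) = 1 := by rw [zpow_add_one, ← h2, inv_mul_cancel]
    rw [← orderOf_dvd_iff_zpow_eq_one, hk] at h3
    have h4 : (4 : ℤ) ∣ s ^ 2 + 1 := by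
      refine dvd_trans ?_ h3
      obtain ⟨i, rfl⟩ : ∃ i, k = 2 + i := ⟨k - 2, by omega⟩
      rw [pow_add]
      push_cast
      exact dvd_mul_right _ _
    rcases Int.even_or_odd s with ⟨v, hv⟩ | ⟨v, hv⟩
    · subst hv
      obtain ⟨w, hw⟩ := h4
      have : 4 * (w - v ^ 2) = 1 := by linear_combination -hw
      omega
    · subst hv
      obtain ⟨w, hw⟩ := h4
      have : 4 * (w - v ^ 2 - v) = 2 := by linear_combination -hw
      omega
  obtain ⟨e⟩ := nonempty_mulEquiv_quaternionGroup (a := a) (g := g) (n := 2 ^ (k - 1))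
    (by positivity) (by rw [hk, ← pow_succ']; congr 1; omega) hm1 hg1 hg2 (by
      intro x
      by_cases hx : x ∈ Subgroup.zpowers a
      · exact Or.inl hx
      refine Or.inr (hC _ ?_)
      have h1 := mul_inv_eq_iff_eq_mul.1 (hinv x hx)
      have h2 := mul_inv_eq_iff_eq_mul.1 hg1
      change a * (g⁻¹ * x) = g⁻¹ * x * a
      have h3 : a * g⁻¹ = g⁻¹ * a⁻¹ := by
        rw [mul_inv_eq_iff_eq_mul, mul_assoc, ← h2, inv_mul_cancel_left]
      rw [← mul_assoc, h3, mul_assoc, ← h1, mul_assoc])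
  exact (hnq (k - 1) (by omega)).false e

end PGroups

section Geom

open scoped nonZeroDivisors
open NumberField.InfinitePlace

variable {K : Type} [Field K] [NumberField K]

/-- A small basis bounds the discriminant. -/
lemma HasSmallBasis.abs_discr_le {Q : ℝ} (hQ : HasSmallBasis K Q) :
    (|discr K| : ℝ) ≤ ((Module.finrank ℚ K).factorial * Q ^ Module.finrank ℚ K) ^ 2 := by
  classical
  unfold HasSmallBasis at hQ
  set n := Module.finrank ℚ K with hn
  obtain ⟨b, hb⟩ := hQ
  have hcard : Fintype.card (Module.Free.ChooseBasisIndex ℤ (𝓞 K)) = Fintype.card (Fin n) := by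
    rw [Fintype.card_fin, hn, ← Module.finrank_eq_card_basis (integralBasis K)]
  let e : Module.Free.ChooseBasisIndex ℤ (𝓞 K) ≃ Fin n := Fintype.equivOfCardEq hcard
  let B := (integralBasis K).reindex e
  have hB : Algebra.discr ℚ B = discr K := by
    rw [coe_discr, ← Algebra.discr_reindex ℚ (integralBasis K) e]
    congr 1
    ext i
    simp [B]
  have hint : ∀ i j, ∃ m : ℤ, B.repr (b j) i = m := by
    intro i j
    refine ⟨(RingOfIntegers.basis K).repr ⟨b j, (hb j).1⟩ (e.symm i), ?_⟩
    have := integralBasis_repr_apply (K := K) ⟨b j, (hb j).1⟩ (e.symm i)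
    simp only [B, Module.Basis.repr_reindex_apply]
    exact this
  choose P hP using hint
  have hdet : Algebra.discr ℚ b = (Matrix.det (Matrix.of P) : ℤ) ^ 2 * (discr K : ℚ) := by
    have h1 : (b : Fin n → K) = Matrix.vecMul B
        (((Matrix.of P).map ((↑) : ℤ → ℚ)).map (algebraMap ℚ K)) := by
      ext j
      conv_lhs => rw [← B.sum_repr (b j)]
      simp only [Matrix.vecMul, dotProduct, Matrix.map_apply, Matrix.of_apply]
      refine Finset.sum_congr rfl fun i _ => ?_
      rw [hP, Algebra.smul_def, mul_comm]
    rw [h1, Algebra.discr_of_matrix_vecMul, hB]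
    congr 2
    exact (Int.cast_det (R := ℚ) (Matrix.of P)).symm
  have hne : Algebra.discr ℚ b ≠ 0 := Algebra.discr_not_zero_of_basis ℚ b
  have hP0 : (Matrix.det (Matrix.of P)) ≠ 0 := by
    intro h
    rw [hdet, h] at hne
    simp at hne
  have hle : (|discr K| : ℝ) ≤ ‖((Algebra.discr ℚ b : ℚ) : ℂ)‖ := by
    rw [hdet]
    rw [Rat.cast_mul, Rat.cast_pow, Rat.cast_intCast, Rat.cast_intCast, norm_mul, norm_pow, Complex.norm_intCast, Complex.norm_intCast]
    refine le_mul_of_one_le_left (by positivity) (one_le_pow₀ ?_)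
    exact_mod_cast Int.one_le_abs hP0
  refine hle.trans ?_
  have hcard2 : Fintype.card (Fin n) = Fintype.card (K →ₐ[ℚ] ℂ) := by
    rw [AlgHom.card, Fintype.card_fin]
  let f : Fin n ≃ (K →ₐ[ℚ] ℂ) := Fintype.equivOfCardEq hcard2
  have h2 := Algebra.discr_eq_det_embeddingsMatrixReindex_pow_two ℚ ℂ b f
  have h3 : ((Algebra.discr ℚ b : ℚ) : ℂ) = algebraMap ℚ ℂ (Algebra.discr ℚ b) := by simp
  rw [h3, h2, norm_pow]
  refine pow_le_pow_left₀ (norm_nonneg _) ?_ 2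
  have h4 := Matrix.det_le (A := Algebra.embeddingsMatrixReindex ℚ ℂ b f)
    (abv := NormedField.toAbsoluteValue ℂ) (x := Q) (fun i j => by
      refine le_trans ?_ (hb i).2
      exact norm_embedding_le_house (b i) (f j : K →+* ℂ))
  rw [Fintype.card_fin, nsmul_eq_mul] at h4
  exact h4

/-- Minkowski's theorem for boxes in an ideal. -/
lemma exists_ne_zero_mem_ideal_forall_lt (I : (Ideal (𝓞 K))⁰) (R : InfinitePlace K → ℝ)
    (hR : ∀ w, 0 < R w)
    (h : 2 ^ Module.finrank ℚ K * √|discr K| * (Ideal.absNorm (I : Ideal (𝓞 K)) : ℝ) <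
      ∏ w, R w ^ w.mult) :
    ∃ x : 𝓞 K, x ∈ (I : Ideal (𝓞 K)) ∧ x ≠ 0 ∧ ∀ w : InfinitePlace K, w (x : K) < R w := by
  classical
  let J : (FractionalIdeal (𝓞 K)⁰ K)ˣ := FractionalIdeal.mk0 K I
  let f : InfinitePlace K → NNReal := fun w => ⟨R w, (hR w).le⟩
  have hmink : mixedEmbedding.minkowskiBound K J <
      MeasureTheory.volume (mixedEmbedding.convexBodyLT K f) := by
    rw [mixedEmbedding.convexBodyLT_volume, mixedEmbedding.minkowskiBound,
      mixedEmbedding.volume_fundamentalDomain_fractionalIdealLatticeBasis,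
      mixedEmbedding.volume_fundamentalDomain_latticeBasis, mixedEmbedding.finrank]
    have h1 : FractionalIdeal.absNorm (J : FractionalIdeal (𝓞 K)⁰ K) =
        Ideal.absNorm (I : Ideal (𝓞 K)) := by
      simp only [J, FractionalIdeal.coe_mk0, FractionalIdeal.coeIdeal_absNorm]
    rw [h1]
    have h2 : ENNReal.ofReal (((Ideal.absNorm (I : Ideal (𝓞 K)) : ℚ) : ℝ)) *
        ((2 : ENNReal)⁻¹ ^ nrComplexPlaces K * (NNReal.sqrt ‖discr K‖₊ : ENNReal)) *
        2 ^ Module.finrank ℚ K ≤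
        ENNReal.ofReal (2 ^ Module.finrank ℚ K * √|discr K| *
          (Ideal.absNorm (I : Ideal (𝓞 K)) : ℝ)) := by
      have h3 : (NNReal.sqrt ‖discr K‖₊ : ENNReal) = ENNReal.ofReal √|discr K| := by
        rw [ENNReal.ofReal, ENNReal.coe_inj]
        ext
        rw [Real.coe_toNNReal _ (Real.sqrt_nonneg _)]
        simp [Int.norm_eq_abs]
      rw [h3, ENNReal.ofReal_mul (by positivity), ENNReal.ofReal_mul (by positivity),
        ENNReal.ofReal_pow (by norm_num), ENNReal.ofReal_ofNat, Rat.cast_natCast]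
      calc _ ≤ ENNReal.ofReal (Ideal.absNorm (I : Ideal (𝓞 K)) : ℝ) *
            (1 * ENNReal.ofReal √|discr K|) * 2 ^ Module.finrank ℚ K := by
            gcongr
            refine pow_le_one' ?_ _
            simp
        _ = _ := by ring
    refine lt_of_le_of_lt h2 ?_
    refine lt_of_lt_of_le ((ENNReal.ofReal_lt_ofReal_iff_of_nonneg (by positivity)).2 h) ?_
    have h4 : ENNReal.ofReal (∏ w, R w ^ w.mult) = ((∏ w, f w ^ w.mult : NNReal) : ENNReal) := by
      rw [ENNReal.ofReal, ENNReal.coe_inj]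
      ext
      rw [Real.coe_toNNReal _ (Finset.prod_nonneg fun w _ => pow_nonneg (hR w).le _)]
      push_cast
      rfl
    rw [h4, ENNReal.ofNNReal_finsetProd]
    simp only [ENNReal.coe_pow]
    refine le_mul_of_one_le_left' ?_
    exact_mod_cast mixedEmbedding.one_le_convexBodyLTFactor K
  obtain ⟨a, ha, ha0, hw⟩ := mixedEmbedding.exists_ne_zero_mem_ideal_lt K J hmink
  simp only [J, FractionalIdeal.coe_mk0, FractionalIdeal.mem_coeIdeal] at ha
  obtain ⟨x, hx, rfl⟩ := ha
  exact ⟨x, hx, fun h => ha0 (by rw [h, map_zero]), hw⟩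

end Geom

section Packing

open scoped nonZeroDivisors
open NumberField.InfinitePlace

variable {K : Type} [Field K] [NumberField K]

lemma prod_place_eq_absNorm_span (x : 𝓞 K) :
    ∏ w : InfinitePlace K, w (x : K) ^ w.mult = (Ideal.absNorm (Ideal.span {x}) : ℝ) := by
  rw [InfinitePlace.prod_eq_abs_norm, Ideal.absNorm_span_singleton]
  have h : Algebra.norm ℚ (x : K) = ((Algebra.norm ℤ x : ℤ) : ℚ) :=
    (Algebra.coe_norm_int x).symm
  rw [h]
  push_cast
  rw [Nat.cast_natAbs]
  push_cast
  rfl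

lemma house_le_of_forall_place_le {x : K} {B : ℝ} (h : ∀ w : InfinitePlace K, w x ≤ B) :
    house x ≤ B := by
  obtain ⟨w⟩ := (inferInstance : Nonempty (InfinitePlace K))
  have hB : 0 ≤ B := (apply_nonneg w x).trans (h w)
  rw [house, pi_norm_le_iff_of_nonneg hB]
  exact fun φ => h (InfinitePlace.mk φ)

/-- A torsion class is represented by an integral ideal whose `ℓ`-th power is principal. -/
lemma exists_mk0_eq_and_pow_eq_span {ℓ : ℕ} {c : ClassGroup (𝓞 K)} (hc : c ^ ℓ = 1) :
    ∃ (I : (Ideal (𝓞 K))⁰) (a : 𝓞 K), a ≠ 0 ∧ ClassGroup.mk0 I = c ∧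
      (I : Ideal (𝓞 K)) ^ ℓ = Ideal.span {a} := by
  obtain ⟨I, rfl⟩ := ClassGroup.mk0_surjective c
  rw [← map_pow, ClassGroup.mk0_eq_one_iff] at hc
  obtain ⟨a, ha⟩ := hc.principal
  rw [SubmonoidClass.coe_pow] at ha
  refine ⟨I, a, ?_, rfl, ha⟩
  rintro rfl
  have h0 : (I : Ideal (𝓞 K)) ^ ℓ ≠ 0 := pow_ne_zero _ (nonZeroDivisors.coe_ne_zero I)
  exact h0 (by rw [ha]; simp)

/-- The short element of `I * g` attached to a torsion class and an auxiliary ideal. -/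
lemma exists_short_element {ℓ : ℕ} (hℓ : 1 ≤ ℓ) (I g : (Ideal (𝓞 K))⁰) {a : 𝓞 K} (ha : a ≠ 0)
    (hI : (I : Ideal (𝓞 K)) ^ ℓ = Ideal.span {a}) {lam L : ℝ} (hlam : 0 < lam)
    (hL : lam ^ Module.finrank ℚ K = L) (hL2 : L = 2 ^ (Module.finrank ℚ K + 1) * √|discr K|) :
    ∃ (x : 𝓞 K) (J : (Ideal (𝓞 K))⁰) (u : InfinitePlace K → ℝ), x ≠ 0 ∧
      Ideal.span {x} = (J : Ideal (𝓞 K)) * I * g ∧ (Ideal.absNorm (J : Ideal (𝓞 K)) : ℝ) ≤ L ∧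
      (∀ w, -Real.log L ≤ u w ∧ u w < 0) ∧
      ∀ w : InfinitePlace K, w (x : K) ^ ℓ =
        w (a : K) * ((Ideal.absNorm (g : Ideal (𝓞 K)) : ℝ) ^ ((Module.finrank ℚ K : ℝ)⁻¹) * lam) ^ ℓ
          * Real.exp (u w) ^ ℓ := by
  classical
  set n := Module.finrank ℚ K with hn
  have hn0 : 0 < n := Module.finrank_pos
  have hg0 : (0:ℝ) < Ideal.absNorm (g : Ideal (𝓞 K)) := by exact_mod_cast absNorm_pos g
  have hI0 : (0:ℝ) < Ideal.absNorm (I : Ideal (𝓞 K)) := by exact_mod_cast absNorm_pos I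
  have ha' : (a : K) ≠ 0 := by simpa using ha
  have haw : ∀ w : InfinitePlace K, 0 < w (a : K) := fun w => w.pos_iff.2 ha'
  have hD : 0 < √|(discr K : ℝ)| := Real.sqrt_pos.2 (abs_pos.2 (by exact_mod_cast discr_ne_zero K))
  have hLpos : 0 < L := by rw [← hL]; positivity
  set ng : ℝ := (Ideal.absNorm (g : Ideal (𝓞 K)) : ℝ) ^ ((n : ℝ)⁻¹) with hng
  have hngpos : 0 < ng := Real.rpow_pos_of_pos hg0 _
  have hngn : ng ^ n = Ideal.absNorm (g : Ideal (𝓞 K)) :=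
    Real.rpow_inv_natCast_pow hg0.le hn0.ne'
  let R : InfinitePlace K → ℝ := fun w => w (a : K) ^ ((ℓ : ℝ)⁻¹) * (ng * lam)
  have hR : ∀ w, 0 < R w := fun w => by
    have := haw w
    positivity
  have hprod : ∏ w, R w ^ w.mult = Ideal.absNorm (I : Ideal (𝓞 K)) *
      Ideal.absNorm (g : Ideal (𝓞 K)) * L := by
    have h1 : ∏ w : InfinitePlace K, (w (a : K) ^ ((ℓ : ℝ)⁻¹)) ^ w.mult =
        Ideal.absNorm (I : Ideal (𝓞 K)) := by
      have h2 : ∀ w : InfinitePlace K, (w (a : K) ^ ((ℓ : ℝ)⁻¹)) ^ w.mult =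
          (w (a : K) ^ w.mult) ^ ((ℓ : ℝ)⁻¹) := fun w => by
        rw [← Real.rpow_natCast, ← Real.rpow_mul (haw w).le, mul_comm,
          Real.rpow_mul (haw w).le, Real.rpow_natCast]
      simp_rw [h2]
      rw [Real.finsetProd_rpow _ _ (fun w _ => pow_nonneg (haw w).le _),
        prod_place_eq_absNorm_span, ← hI, map_pow, Nat.cast_pow,
        Real.pow_rpow_inv_natCast hI0.le (by omega)]
    simp only [R]
    simp_rw [mul_pow _ (ng * lam)]
    rw [Finset.prod_mul_distrib, h1, Finset.prod_pow_eq_pow_sum,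
      InfinitePlace.sum_mult_eq, mul_pow ng lam, hngn, hL, mul_assoc]
  have hmink : 2 ^ n * √|(discr K : ℝ)| * (Ideal.absNorm ((I * g : (Ideal (𝓞 K))⁰) : Ideal (𝓞 K)) : ℝ) <
      ∏ w, R w ^ w.mult := by
    rw [hprod, hL2, Submonoid.coe_mul, map_mul, Nat.cast_mul, pow_succ]
    have : 0 < (2:ℝ) ^ n * √|(discr K : ℝ)| * (Ideal.absNorm (I : Ideal (𝓞 K)) *
      Ideal.absNorm (g : Ideal (𝓞 K))) := by positivity
    linarith
  obtain ⟨x, hx, hx0, hxw⟩ := exists_ne_zero_mem_ideal_forall_lt (I * g) R hR hmink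
  have hx0' : (x : K) ≠ 0 := by simpa using hx0
  have hxpos : ∀ w : InfinitePlace K, 0 < w (x : K) := fun w => w.pos_iff.2 hx0'
  obtain ⟨J, hJ⟩ := Ideal.dvd_span_singleton.2 hx
  have hJ0 : J ≠ 0 := by
    rintro rfl
    rw [mul_zero] at hJ
    exact hx0 (by simpa using hJ)
  have hJ' : Ideal.span {x} = J * I * g := by
    rw [hJ, Submonoid.coe_mul]; ring
  have hJpos : (1:ℝ) ≤ Ideal.absNorm J := by
    exact_mod_cast one_le_absNorm ⟨J, mem_nonZeroDivisors_of_ne_zero hJ0⟩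
  have hxn : ∏ w : InfinitePlace K, w (x : K) ^ w.mult = Ideal.absNorm J *
      (Ideal.absNorm (I : Ideal (𝓞 K)) * Ideal.absNorm (g : Ideal (𝓞 K))) := by
    rw [prod_place_eq_absNorm_span, hJ', map_mul, map_mul]
    push_cast; ring
  let u : InfinitePlace K → ℝ := fun w => Real.log (w (x : K) / R w)
  have hu0 : ∀ w, u w < 0 := fun w =>
    Real.log_neg (div_pos (hxpos w) (hR w)) ((div_lt_one (hR w)).2 (hxw w))
  have hsum : ∑ w, w.mult * u w = Real.log (Ideal.absNorm J / L) := by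
    have h1 : ∀ w : InfinitePlace K, w.mult * u w = Real.log ((w (x : K) / R w) ^ w.mult) :=
      fun w => (Real.log_pow _ _).symm
    simp_rw [h1]
    rw [← Real.log_prod (fun w _ => (pow_pos (div_pos (hxpos w) (hR w)) _).ne')]
    simp_rw [div_pow]
    rw [Finset.prod_div_distrib, hprod, hxn]
    congr 1
    field_simp
  have hlogJ : -Real.log L ≤ Real.log (Ideal.absNorm J / L) := by
    rw [Real.log_div (by positivity) hLpos.ne']
    have := Real.log_nonneg hJpos
    linarith
  have hmu : ∀ w : InfinitePlace K, w.mult * u w ≤ 0 := fun w =>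
    mul_nonpos_of_nonneg_of_nonpos (Nat.cast_nonneg _) (hu0 w).le
  refine ⟨x, ⟨J, mem_nonZeroDivisors_of_ne_zero hJ0⟩, u, hx0, hJ', ?_, fun w => ⟨?_, hu0 w⟩, ?_⟩
  · have h1 : Real.log (Ideal.absNorm J / L) ≤ 0 := hsum ▸ Finset.sum_nonpos fun w _ => hmu w
    have h2 := (Real.log_nonpos_iff (by positivity)).1 h1
    exact (div_le_one hLpos).1 h2
  · have h1 : ∑ v, v.mult * u v ≤ w.mult * u w := by
      have := Finset.single_le_sum (f := fun v : InfinitePlace K => -(v.mult * u v))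
        (fun v _ => neg_nonneg.2 (hmu v)) (Finset.mem_univ w)
      rw [Finset.sum_neg_distrib] at this
      linarith
    have h2 : (1:ℝ) ≤ w.mult := by exact_mod_cast w.mult_pos
    nlinarith [hu0 w]
  · intro w
    simp only [u]
    rw [Real.exp_log (div_pos (hxpos w) (hR w)), div_pow]
    have h1 : R w ^ ℓ = w (a : K) * (ng * lam) ^ ℓ := by
      simp only [R]
      rw [mul_pow _ (ng * lam), Real.rpow_inv_natCast_pow (haw w).le (by omega)]
    rw [h1, mul_div_cancel₀]
    rw [← h1]
    exact (pow_pos (hR w) _).ne'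

lemma eq_of_packing_eq {ℓ : ℕ} {Y lam : ℝ} (hlam : 0 < lam) (hY : 1 ≤ Y)
    {I I' g g' J : (Ideal (𝓞 K))⁰} {a a' x x' : 𝓞 K} (ha : a ≠ 0) (ha' : a' ≠ 0)
    (hx : x ≠ 0) (hx' : x' ≠ 0)
    (hI : (I : Ideal (𝓞 K)) ^ ℓ = Ideal.span {a}) (hI' : (I' : Ideal (𝓞 K)) ^ ℓ = Ideal.span {a'})
    (hg : (Ideal.absNorm (g : Ideal (𝓞 K)) : ℝ) ≤ Y)
    (hg' : (Ideal.absNorm (g' : Ideal (𝓞 K)) : ℝ) ≤ Y)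
    (hJ : Ideal.span {x} = (J : Ideal (𝓞 K)) * I * g)
    (hJ' : Ideal.span {x'} = (J : Ideal (𝓞 K)) * I' * g')
    {u u' : InfinitePlace K → ℝ} (huu : ∀ w, u w ≤ u' w + 1)
    (hw : ∀ w : InfinitePlace K, w (x : K) ^ ℓ =
        w (a : K) * ((Ideal.absNorm (g : Ideal (𝓞 K)) : ℝ) ^ ((Module.finrank ℚ K : ℝ)⁻¹) * lam) ^ ℓ
          * Real.exp (u w) ^ ℓ)
    (hw' : ∀ w : InfinitePlace K, w (x' : K) ^ ℓ =
        w (a' : K) * ((Ideal.absNorm (g' : Ideal (𝓞 K)) : ℝ) ^ ((Module.finrank ℚ K : ℝ)⁻¹) * lam) ^ ℓ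
          * Real.exp (u' w) ^ ℓ) :
    ∃ β : 𝓞 K, β ≠ 0 ∧ house (β : K) ≤ (Real.exp 1 * Y ^ 2) ^ ℓ ∧
      Ideal.span {β} * (g' : Ideal (𝓞 K)) ^ ℓ =
        Ideal.span {(Ideal.absNorm (g' : Ideal (𝓞 K)) : 𝓞 K)} ^ ℓ * (g : Ideal (𝓞 K)) ^ ℓ := by
  set n := Module.finrank ℚ K with hn
  have hn0 : 0 < n := Module.finrank_pos
  set N' : ℕ := Ideal.absNorm (g' : Ideal (𝓞 K)) with hN'
  have hgp : (1:ℝ) ≤ Ideal.absNorm (g : Ideal (𝓞 K)) := one_le_absNorm g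
  have hgp' : (1:ℝ) ≤ N' := one_le_absNorm g'
  obtain ⟨r, hr⟩ : (g' : Ideal (𝓞 K)) ∣ Ideal.span {(N' : 𝓞 K)} :=
    Ideal.dvd_span_singleton.2 (Ideal.absNorm_mem _)
  have hne : x' ^ ℓ * a ≠ 0 := mul_ne_zero (pow_ne_zero _ hx') ha
  have hdvd : x' ^ ℓ * a ∣ x ^ ℓ * a' * (N' : 𝓞 K) ^ ℓ := by
    rw [← Ideal.span_singleton_le_span_singleton, ← Ideal.dvd_iff_le]
    simp only [← Ideal.span_singleton_mul_span_singleton, ← Ideal.span_singleton_pow]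
    rw [hJ, hJ', ← hI, ← hI', hr]
    refine ⟨g ^ ℓ * r ^ ℓ, ?_⟩
    ring
  obtain ⟨β, hβ⟩ := hdvd
  have hN0 : (N' : 𝓞 K) ≠ 0 := by
    have : N' ≠ 0 := by rintro h; rw [h] at hgp'; norm_num at hgp'
    exact_mod_cast this
  have hβ0 : β ≠ 0 := by
    rintro rfl
    rw [mul_zero] at hβ
    exact mul_ne_zero (mul_ne_zero (pow_ne_zero _ hx) ha') (pow_ne_zero _ hN0) hβ
  refine ⟨β, hβ0, house_le_of_forall_place_le fun w => ?_, ?_⟩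
  · have haw : 0 < w (a : K) := w.pos_iff.2 (by simpa using ha)
    have haw' : 0 < w (a' : K) := w.pos_iff.2 (by simpa using ha')
    have h1 := congrArg (fun y : 𝓞 K => w (y : K)) hβ
    simp only [map_mul, map_pow, map_natCast] at h1
    rw [show w ((N' : K)) = N' by
      rw [← w.norm_embedding_eq, map_natCast, Complex.norm_natCast], hw, hw'] at h1
    set ng : ℝ := (Ideal.absNorm (g : Ideal (𝓞 K)) : ℝ) ^ ((n : ℝ)⁻¹) with hng
    set ng' : ℝ := (N' : ℝ) ^ ((n : ℝ)⁻¹) with hng'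
    have hb : ng ≤ Y := by
      refine le_trans ?_ hg
      conv_rhs => rw [← Real.rpow_one (Ideal.absNorm (g : Ideal (𝓞 K)) : ℝ)]
      refine Real.rpow_le_rpow_of_exponent_le hgp (inv_le_one_of_one_le₀ ?_)
      exact_mod_cast hn0
    have hb0 : 0 ≤ ng := by positivity
    have hb' : 1 ≤ ng' := Real.one_le_rpow hgp' (by positivity)
    have h2 : (ng' * Real.exp (u' w)) ^ ℓ * w (β : K) = (ng * Real.exp (u w) * N') ^ ℓ := by
      have h3 : (w (a : K) * w (a' : K) * lam ^ ℓ) *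
          ((ng' * Real.exp (u' w)) ^ ℓ * w (β : K)) =
          (w (a : K) * w (a' : K) * lam ^ ℓ) * (ng * Real.exp (u w) * N') ^ ℓ := by
        simp only [mul_pow] at h1 ⊢
        linear_combination -h1
      refine mul_left_cancel₀ ?_ h3
      positivity
    have h4 : ng * Real.exp (u w) * N' ≤ ng' * Real.exp (u' w) * (Real.exp 1 * Y ^ 2) := by
      calc ng * Real.exp (u w) * N' ≤ Y * Real.exp (u' w + 1) * Y := by
            gcongr
            exact huu w
        _ = 1 * Real.exp (u' w) * (Real.exp 1 * Y ^ 2) := by rw [Real.exp_add]; ring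
        _ ≤ _ := by gcongr
    have h5 : (ng * Real.exp (u w) * N') ^ ℓ ≤
        (ng' * Real.exp (u' w)) ^ ℓ * (Real.exp 1 * Y ^ 2) ^ ℓ := by
      rw [← mul_pow (ng' * Real.exp (u' w))]
      exact pow_le_pow_left₀ (by positivity) h4 ℓ
    rw [← h2] at h5
    exact le_of_mul_le_mul_left h5 (by positivity)
  · have h1 := congrArg (fun y : 𝓞 K => Ideal.span {y}) hβ
    simp only [← Ideal.span_singleton_mul_span_singleton, ← Ideal.span_singleton_pow] at h1
    rw [hJ, hJ', ← hI, ← hI'] at h1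
    have h0 : ((J : Ideal (𝓞 K)) * I * I') ^ ℓ ≠ 0 := pow_ne_zero _ (mul_ne_zero (mul_ne_zero
      (nonZeroDivisors.coe_ne_zero J) (nonZeroDivisors.coe_ne_zero I))
      (nonZeroDivisors.coe_ne_zero I'))
    refine mul_left_cancel₀ h0 ?_
    calc _ = (J * I' * g') ^ ℓ * I ^ ℓ * Ideal.span {β} := by ring
      _ = _ := by rw [← h1]; ring

/-- The packing inequality for the `ℓ`-torsion of the class group. -/
lemma ellTorsion_mul_card_le {ι : Type} [Fintype ι] {ℓ : ℕ} (hℓ : 1 ≤ ℓ) {Y : ℝ} (hY : 1 ≤ Y)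
    (g : ι → (Ideal (𝓞 K))⁰) (hg : ∀ i, (Ideal.absNorm (g i : Ideal (𝓞 K)) : ℝ) ≤ Y)
    (hsep : ∀ i j, ∀ β : 𝓞 K, β ≠ 0 → house (β : K) ≤ (Real.exp 1 * Y ^ 2) ^ ℓ →
      Ideal.span {β} * (g j : Ideal (𝓞 K)) ^ ℓ =
        Ideal.span {(Ideal.absNorm (g j : Ideal (𝓞 K)) : 𝓞 K)} ^ ℓ * (g i : Ideal (𝓞 K)) ^ ℓ →
      i = j)
    {L : ℝ} (hL : L = 2 ^ (Module.finrank ℚ K + 1) * √|discr K|)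
    (S : Finset (Ideal (𝓞 K))⁰)
    (hS : ∀ J : (Ideal (𝓞 K))⁰, (Ideal.absNorm (J : Ideal (𝓞 K)) : ℝ) ≤ L → J ∈ S) :
    (ellTorsion K ℓ : ℝ) * Fintype.card ι ≤
      S.card * (Real.log L + 1) ^ Module.finrank ℚ K := by
  classical
  set n := Module.finrank ℚ K with hn
  have hn0 : 0 < n := Module.finrank_pos
  have hD : (1:ℝ) ≤ √|(discr K : ℝ)| := by
    rw [Real.one_le_sqrt]
    exact_mod_cast Int.one_le_abs (discr_ne_zero K)
  have hL1 : 1 ≤ L := by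
    rw [hL]
    exact one_le_mul_of_one_le_of_one_le (one_le_pow₀ (by norm_num)) hD
  have hlogL : 0 ≤ Real.log L := Real.log_nonneg hL1
  let lam : ℝ := L ^ ((n : ℝ)⁻¹)
  have hlam : 0 < lam := Real.rpow_pos_of_pos (by linarith) _
  have hlamL : lam ^ n = L := Real.rpow_inv_natCast_pow (by linarith) hn0.ne'
  let T := {x : ClassGroup (𝓞 K) // x ^ ℓ = 1}
  have hrep : ∀ c : T, ∃ (I : (Ideal (𝓞 K))⁰) (a : 𝓞 K), a ≠ 0 ∧ ClassGroup.mk0 I = c.1 ∧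
      (I : Ideal (𝓞 K)) ^ ℓ = Ideal.span {a} := fun c => exists_mk0_eq_and_pow_eq_span c.2
  choose I a ha hIc hI using hrep
  have hshort := fun (c : T) (i : ι) =>
    exists_short_element hℓ (I c) (g i) (ha c) (hI c) hlam hlamL hL
  choose x J u hx hJ hJL hu hw using hshort
  let k : ℤ := ⌊-Real.log L⌋
  let B : Finset (InfinitePlace K → ℤ) := Fintype.piFinset fun _ => Finset.Icc k (-1)
  let f : T × ι → (Ideal (𝓞 K))⁰ × (InfinitePlace K → ℤ) :=
    fun ci => (J ci.1 ci.2, fun w => ⌊u ci.1 ci.2 w⌋)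
  have hinj : Function.Injective f := by
    rintro ⟨c, i⟩ ⟨c', j⟩ h
    simp only [f, Prod.mk.injEq] at h
    obtain ⟨h1, h2⟩ := h
    have huu : ∀ w, u c i w ≤ u c' j w + 1 := fun w => by
      have h3 := congrFun h2 w
      have h4 := Int.lt_floor_add_one (u c i w)
      have h5 := Int.floor_le (u c' j w)
      rw [h3] at h4
      linarith
    have hJ' := hJ c' j
    rw [← h1] at hJ'
    obtain ⟨β, hβ0, hβh, hβ⟩ := eq_of_packing_eq hlam hY (ha c) (ha c') (hx c i) (hx c' j)
      (hI c) (hI c') (hg i) (hg j) (hJ c i) hJ' huu (hw c i) (hw c' j)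
    obtain rfl := hsep i j β hβ0 hβh hβ
    have hcc : ClassGroup.mk0 (I c) = ClassGroup.mk0 (I c') := by
      rw [ClassGroup.mk0_eq_mk0_iff]
      refine ⟨x c' i, x c i, hx c' i, hx c i, ?_⟩
      rw [hJ', hJ c i]
      ring
    rw [hIc, hIc] at hcc
    rw [Subtype.ext hcc]
  have hmaps : ∀ ci ∈ (Finset.univ : Finset (T × ι)), f ci ∈ S ×ˢ B := by
    rintro ⟨c, i⟩ -
    simp only [f, B, Finset.mem_product, Fintype.mem_piFinset, Finset.mem_Icc]
    refine ⟨hS _ (hJL c i), fun w => ⟨Int.floor_le_floor (hu c i w).1, ?_⟩⟩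
    have : ⌊u c i w⌋ < 0 := Int.floor_lt.2 (by simpa using (hu c i w).2)
    omega
  have hBc : B.card = (Finset.Icc k (-1)).card ^ Fintype.card (InfinitePlace K) :=
    (Fintype.card_piFinset _).trans (by rw [Finset.prod_const, Finset.card_univ])
  have hcard := Finset.card_le_card_of_injOn f hmaps hinj.injOn
  rw [Finset.card_univ, Fintype.card_prod, Finset.card_product, hBc,
    Int.card_Icc] at hcard
  have hT : ellTorsion K ℓ = Fintype.card T := Nat.card_eq_fintype_card
  rw [hT]
  have hk : (((-1 + 1 - k).toNat : ℕ) : ℝ) ≤ Real.log L + 1 := by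
    have h1 : k ≤ 0 := by
      have : (k : ℝ) ≤ -Real.log L := Int.floor_le _
      have h2 : (k : ℝ) ≤ 0 := by linarith
      exact_mod_cast h2
    have h2 : (((-1 + 1 - k).toNat : ℤ) : ℝ) = -k := by
      rw [Int.toNat_of_nonneg (by omega)]; push_cast; ring
    have h3 : -Real.log L < k + 1 := Int.lt_floor_add_one _
    rw [Int.cast_natCast] at h2
    rw [h2]; linarith
  have hpl : Fintype.card (InfinitePlace K) ≤ n := by
    rw [hn, ← InfinitePlace.sum_mult_eq (K := K), Fintype.card_eq_sum_ones]
    exact Finset.sum_le_sum fun w _ => w.mult_pos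
  calc (Fintype.card T : ℝ) * Fintype.card ι ≤
        S.card * ((-1 + 1 - k).toNat : ℝ) ^ Fintype.card (InfinitePlace K) := by
        exact_mod_cast hcard
    _ ≤ S.card * (Real.log L + 1) ^ Fintype.card (InfinitePlace K) := by gcongr
    _ ≤ _ := by
        gcongr
        linarith

end Packing

section Choice

variable {F : Type} [Field F] [NumberField F]

lemma house_coe_intermediateField (L : IntermediateField ℚ F) (x : L) : house x ≤ house (x : F) := by
  rw [house, pi_norm_le_iff_of_nonneg (house_nonneg _)]
  intro φ
  let := φ.toAlgebra
  let ψ : F →ₐ[L] ℂ := IsAlgClosed.lift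
  have h : φ x = (ψ : F →+* ℂ) (x : F) := (ψ.commutes x).symm
  change ‖φ x‖ ≤ _
  rw [h]
  exact norm_embedding_le_house _ _

lemma house_algEquiv (σ : F ≃ₐ[ℚ] F) (x : F) : house (σ x) ≤ house x := by
  rw [house, pi_norm_le_iff_of_nonneg (house_nonneg _)]
  intro φ
  exact norm_embedding_le_house x (φ.comp (σ : F →+* F))

lemma hasSmallBasis_of_span {L : IntermediateField ℚ F} {s : Set F} {Q : ℝ}
    (hs : ∀ x ∈ s, IsIntegral ℤ x ∧ house x ≤ Q)
    (hspan : Submodule.span ℚ s = L.toSubalgebra.toSubmodule) : HasSmallBasis L Q := by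
  have hmem : ∀ x ∈ s, x ∈ L := fun x hx => by
    have : x ∈ L.toSubalgebra.toSubmodule := hspan ▸ Submodule.subset_span hx
    exact this
  let t : Set L := {y | (y : F) ∈ s}
  have ht : Submodule.span ℚ t = ⊤ := by
    have hinj : Function.Injective (L.val.toLinearMap) := fun a b h => Subtype.ext h
    apply Submodule.map_injective_of_injective hinj
    rw [Submodule.map_span]
    have h1 : (L.val.toLinearMap : L → F) '' t = s := by
      ext x
      constructor
      · rintro ⟨y, hy, rfl⟩
        exact hy
      · intro hx
        exact ⟨⟨x, hmem x hx⟩, hx, rfl⟩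
    rw [h1, hspan]
    ext x
    constructor
    · intro hx
      exact ⟨⟨x, hx⟩, trivial, rfl⟩
    · rintro ⟨y, -, rfl⟩
      exact y.2
  obtain ⟨b, hbt, hbspan, hbli⟩ := exists_linearIndependent ℚ t
  let B := Module.Basis.mk hbli (by rw [Subtype.range_coe, hbspan, ht])
  have hbf : Finite b := Module.Finite.finite_basis B
  have hfin : Fintype b := Fintype.ofFinite b
  let e : b ≃ Fin (Module.finrank ℚ L) := Fintype.equivFinOfCardEq (Module.finrank_eq_card_basis B).symm
  refine ⟨B.reindex e, fun i => ?_⟩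
  have h1 : B.reindex e i = (e.symm i : L) := by simp [B]
  rw [h1]
  have h2 := hs _ (hbt (e.symm i).2)
  refine ⟨?_, (house_coe_intermediateField L _).trans h2.2⟩
  exact (isIntegral_algHom_iff (L.val.restrictScalars ℤ) Subtype.val_injective).1 h2.1

/-- The `ℚ`-span of the algebraic integers with all conjugates at most `T`. -/
noncomputable def smallSpan (F : Type) [Field F] [NumberField F] (T : ℝ) : Submodule ℚ F :=
  Submodule.span ℚ {x : F | IsIntegral ℤ x ∧ house x ≤ T}

lemma smallSpan_mono {T T' : ℝ} (h : T ≤ T') : smallSpan F T ≤ smallSpan F T' :=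
  Submodule.span_mono fun _ hx => ⟨hx.1, hx.2.trans h⟩

lemma one_mem_smallSpan {T : ℝ} (h : 1 ≤ T) : (1 : F) ∈ smallSpan F T := by
  refine Submodule.subset_span ⟨isIntegral_one, ?_⟩
  have := house_intCast (K := F) 1
  simp only [Int.cast_one, abs_one] at this
  rw [this]; exact h

lemma mul_mem_smallSpan {T : ℝ} (hT : 0 ≤ T) {x y : F} (hx : x ∈ smallSpan F T) (hy : y ∈ smallSpan F T) :
    x * y ∈ smallSpan F (T ^ 2) := by
  have h1 : x * y ∈ smallSpan F T * smallSpan F T := Submodule.mul_mem_mul hx hy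
  rw [smallSpan, Submodule.span_mul_span] at h1
  refine Submodule.span_mono ?_ h1
  rintro _ ⟨a, ha, b, hb, rfl⟩
  refine ⟨ha.1.mul hb.1, (house_mul_le a b).trans ?_⟩
  rw [sq]
  exact mul_le_mul ha.2 hb.2 (house_nonneg _) hT

lemma map_mem_smallSpan {T : ℝ} (σ : F ≃ₐ[ℚ] F) {x : F} (hx : x ∈ smallSpan F T) :
    σ x ∈ smallSpan F T := by
  have h1 : σ x ∈ (smallSpan F T).map σ.toLinearMap := ⟨x, hx, rfl⟩
  rw [smallSpan, Submodule.map_span] at h1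
  refine Submodule.span_mono ?_ h1
  rintro _ ⟨a, ha, rfl⟩
  exact ⟨ha.1.map (σ.toAlgHom.restrictScalars ℤ), (house_algEquiv σ a).trans ha.2⟩

/-- Some level of an increasing chain of heights generates a stable subfield. -/
lemma exists_stable_subfield (T : ℕ → ℝ) (h1 : ∀ i, 1 ≤ T i) (hT : ∀ i, T i ^ 2 ≤ T (i + 1)) :
    ∃ i < Module.finrank ℚ F, ∃ K₀ : IntermediateField ℚ F,
      smallSpan F (T i) = K₀.toSubalgebra.toSubmodule ∧
      (∀ β : F, IsIntegral ℤ β → house β ≤ T (i + 1) → β ∈ K₀) ∧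
      ∀ σ : F ≃ₐ[ℚ] F, ∀ x ∈ K₀, σ x ∈ K₀ := by
  have hmono : ∀ i, T i ≤ T (i + 1) := fun i => by nlinarith [hT i, h1 i]
  have hex : ∃ i < Module.finrank ℚ F, smallSpan F (T i) = smallSpan F (T (i + 1)) := by
    by_contra! hcon
    have hgrow : ∀ i ≤ Module.finrank ℚ F, i + 1 ≤ Module.finrank ℚ (smallSpan F (T i)) := by
      intro i
      induction i with
      | zero =>
        intro _
        rw [Nat.zero_add, Nat.one_le_iff_ne_zero, Ne, Submodule.finrank_eq_zero]
        intro h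
        have := one_mem_smallSpan (F := F) (h1 0)
        rw [h, Submodule.mem_bot] at this
        exact one_ne_zero this
      | succ i ih =>
        intro hi
        have hlt : smallSpan F (T i) < smallSpan F (T (i + 1)) :=
          lt_of_le_of_ne (smallSpan_mono (hmono i)) (hcon i (by omega))
        have := Submodule.finrank_lt_finrank_of_lt hlt
        have := ih (by omega)
        omega
    have h2 := hgrow _ le_rfl
    have h3 := Submodule.finrank_le (smallSpan F (T (Module.finrank ℚ F)))
    omega
  obtain ⟨i, hi, hV⟩ := hex
  have hmul : ∀ x y, x ∈ smallSpan F (T i) → y ∈ smallSpan F (T i) → x * y ∈ smallSpan F (T i) :=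
    fun x y hx hy => by
      rw [hV]
      exact smallSpan_mono (hT i) (mul_mem_smallSpan (by linarith [h1 i]) hx hy)
  let A : Subalgebra ℚ F := (smallSpan F (T i)).toSubalgebra (one_mem_smallSpan (h1 i)) hmul
  let K₀ : IntermediateField ℚ F := A.toIntermediateField fun x hx =>
    A.inv_mem_of_algebraic (x := ⟨x, hx⟩) (Algebra.IsAlgebraic.isAlgebraic x)
  refine ⟨i, hi, K₀, ?_, ?_, fun σ x hx => map_mem_smallSpan σ hx⟩
  · ext x
    exact Iff.rfl
  · intro β hβ hh
    change β ∈ smallSpan F (T i)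
    rw [hV]
    exact Submodule.subset_span ⟨hβ, hh⟩

lemma hasSmallBasis_of_smallSpan {L : IntermediateField ℚ F} {Q : ℝ}
    (h : smallSpan F Q = L.toSubalgebra.toSubmodule) : HasSmallBasis L Q :=
  hasSmallBasis_of_span (fun _ hx => hx) h

/-- A small basis of a field yields one of a fixed subfield by averaging. -/
lemma hasSmallBasis_fixedPoints {K₀ : IntermediateField ℚ F} {Q : ℝ}
    (hQ : smallSpan F Q = K₀.toSubalgebra.toSubmodule)
    (W : Subgroup (F ≃ₐ[ℚ] F)) (hW : FixedPoints.intermediateField W ≤ K₀) :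
    HasSmallBasis (FixedPoints.intermediateField W : IntermediateField ℚ F) (Nat.card W * Q) := by
  classical
  let s : Set F := {x | IsIntegral ℤ x ∧ house x ≤ Q}
  have hs : ∀ x ∈ s, IsIntegral ℤ x ∧ house x ≤ Q := fun x hx => hx
  have hspan : Submodule.span ℚ s = K₀.toSubalgebra.toSubmodule := hQ
  have := Fintype.ofFinite W
  let tr : F →ₗ[ℚ] F := ∑ w : W, (w : F ≃ₐ[ℚ] F).toLinearMap
  have htr : ∀ x, tr x = ∑ w : W, (w : F ≃ₐ[ℚ] F) x := fun x => by
    simp [tr, LinearMap.sum_apply]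
  refine hasSmallBasis_of_span (s := tr '' s) ?_ ?_
  · rintro _ ⟨x, hx, rfl⟩
    rw [htr]
    refine ⟨IsIntegral.sum _ fun w _ => (hs x hx).1.map ((w : F ≃ₐ[ℚ] F).toAlgHom.restrictScalars ℤ), ?_⟩
    refine (house_sum_le_sum_house _ _).trans ?_
    calc _ ≤ ∑ w : W, Q := Finset.sum_le_sum fun w _ => (house_algEquiv _ x).trans (hs x hx).2
      _ = _ := by rw [Finset.sum_const, Finset.card_univ, nsmul_eq_mul, Nat.card_eq_fintype_card]
  · rw [← Submodule.map_span, hspan]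
    ext y
    constructor
    · rintro ⟨x, -, rfl⟩
      intro w
      rw [htr]
      change (w : F ≃ₐ[ℚ] F) _ = _
      rw [map_sum]
      exact Fintype.sum_equiv (Equiv.mulLeft w) _ _ fun v => rfl
    · intro hy
      have hfix : ∀ w : W, (w : F ≃ₐ[ℚ] F) y = y := fun w => hy w
      refine ⟨(Fintype.card W : ℚ)⁻¹ • y, K₀.toSubalgebra.toSubmodule.smul_mem _ (hW hy), ?_⟩
      rw [map_smul, htr, Finset.sum_congr rfl fun w _ => hfix w, Finset.sum_const, Finset.card_univ,
        ← Nat.cast_smul_eq_nsmul ℚ, smul_smul, inv_mul_cancel₀, one_smul]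
      exact_mod_cast Fintype.card_ne_zero

end Choice

section Split

open scoped Pointwise

variable {F : Type} [Field F] [NumberField F]

lemma perfectField_residueField {L : Type} [Field L] [NumberField L] (𝔭 : Ideal (𝓞 L)) [𝔭.IsPrime]
    (h0 : 𝔭 ≠ ⊥) : PerfectField 𝔭.ResidueField := by
  have : 𝔭.IsMaximal := Ideal.IsPrime.isMaximal ‹_› h0
  have h1 : Finite (𝓞 L ⧸ 𝔭) := Ideal.finiteQuotientOfFreeOfNeBot 𝔭 h0
  have h2 : Finite 𝔭.ResidueField :=
    Finite.of_surjective _ (Ideal.bijective_algebraMap_quotient_residueField 𝔭).2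
  infer_instance

lemma inertia_eq_bot_of_not_dvd_discr [IsGalois ℚ F] {q : ℕ} (hq : q.Prime)
    (hd : ¬ (q : ℤ) ∣ discr F) {P : Ideal (𝓞 F)} (hP : P ∈ primesAbove F q) :
    P.inertia (F ≃ₐ[ℚ] F) = ⊥ := by
  obtain ⟨hPp, hP0, hPq⟩ := mem_primesAbove.1 hP
  have hmem : ((q : ℤ) : 𝓞 F) ∈ P := by
    rw [ratPrime_eq_iff hPp hP0 hq] at hPq
    simpa using hPq
  have hu := (NumberField.not_dvd_discr_iff_forall_mem F (𝓞 F) (Nat.prime_iff_prime_int.1 hq)).1 hd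
    P hPp hmem
  have h0 : P.under ℤ ≠ ⊥ := fun h => hP0 (Ideal.eq_bot_of_comap_eq_bot h)
  have : (P.under ℤ).IsMaximal := Ideal.IsPrime.isMaximal inferInstance h0
  have : Finite (ℤ ⧸ P.under ℤ) := Ideal.finiteQuotientOfFreeOfNeBot _ h0
  have : Finite (P.under ℤ).ResidueField :=
    Finite.of_surjective _ (Ideal.bijective_algebraMap_quotient_residueField _).2
  have h1 := Ideal.card_inertia_eq_ramificationIdxIn (G := F ≃ₐ[ℚ] F) (P.under ℤ) P
  rw [Ideal.ramificationIdxIn_eq_ramificationIdx _ P (F ≃ₐ[ℚ] F),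
    Ideal.ramificationIdx_eq_one] at h1
  exact Subgroup.card_eq_one.1 h1

/-- The decomposition group at an unramified prime is cyclic. -/
lemma isCyclic_stabilizer {P : Ideal (𝓞 F)} (hPp : P.IsPrime) (hP0 : P ≠ ⊥)
    (hin : P.inertia (F ≃ₐ[ℚ] F) = ⊥) : IsCyclic (MulAction.stabilizer (F ≃ₐ[ℚ] F) P) := by
  have h0 : P.under ℤ ≠ ⊥ := fun h => hP0 (Ideal.eq_bot_of_comap_eq_bot h)
  have : (P.under ℤ).IsMaximal := Ideal.IsPrime.isMaximal inferInstance h0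
  have : P.IsMaximal := Ideal.IsPrime.isMaximal hPp hP0
  have : Finite (𝓞 F ⧸ P) := Ideal.finiteQuotientOfFreeOfNeBot P hP0
  let := Ideal.Quotient.field P
  let := Ideal.Quotient.field (P.under ℤ)
  have hcyc : IsCyclic ((𝓞 F ⧸ P) ≃ₐ[ℤ ⧸ P.under ℤ] (𝓞 F ⧸ P)) := inferInstance
  refine isCyclic_of_injective (Ideal.Quotient.stabilizerHom P (P.under ℤ) (F ≃ₐ[ℚ] F)) ?_
  rw [← MonoidHom.ker_eq_bot_iff]
  apply Subgroup.map_injective (Subgroup.subtype_injective _)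
  rw [Ideal.Quotient.map_ker_stabilizer_subtype, hin, Subgroup.map_bot]

/-- Euler factors over a fixed field in terms of the primes of the top field. -/
lemma prod_primesAbove_eq_pow [IsGalois ℚ F] (H : Subgroup (F ≃ₐ[ℚ] F)) {q d m : ℕ}
    (hin : ∀ P ∈ primesAbove F q, P.inertia (F ≃ₐ[ℚ] F) = ⊥)
    (hst : ∀ P ∈ primesAbove F q, Nat.card (MulAction.stabilizer H P) = d) (hH : Nat.card H = m * d)
    (φ ψ : ℕ → ℂ) (hφ : ∀ a, φ (a ^ d) = ψ a) :
    ∏ P ∈ primesAbove F q, φ (Ideal.absNorm P) =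
      (∏ 𝔭 ∈ primesAbove (FixedPoints.intermediateField H : IntermediateField ℚ F) q,
        ψ (Ideal.absNorm 𝔭)) ^ m := by
  classical
  let L : IntermediateField ℚ F := FixedPoints.intermediateField H
  have hgal : IsGaloisGroup H L F := IsGaloisGroup.subgroup _ ℚ F H
  have hsmul : SMulDistribClass H (𝓞 F) F := ⟨fun g b x => smul_distrib_smul (g : F ≃ₐ[ℚ] F) b x⟩
  have hgal' : IsGaloisGroup H (𝓞 L) (𝓞 F) := IsGaloisGroup.of_isFractionRing H (𝓞 L) (𝓞 F) L F
  have hratP : ∀ P : Ideal (𝓞 F), ratPrime (P.under (𝓞 L)) = ratPrime P := fun P => by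
    rw [ratPrime, ratPrime, Ideal.under_under]
  have hmaps : ∀ P ∈ primesAbove F q, P.under (𝓞 L) ∈ primesAbove L q := by
    intro P hP
    obtain ⟨hPp, hP0, hPq⟩ := mem_primesAbove.1 hP
    exact mem_primesAbove.2 ⟨inferInstance, fun h => hP0 (Ideal.eq_bot_of_comap_eq_bot h),
      (hratP P).trans hPq⟩
  rw [← Finset.prod_fiberwise_of_maps_to hmaps, ← Finset.prod_pow]
  refine Finset.prod_congr rfl fun 𝔭 h𝔭 => ?_
  obtain ⟨h𝔭p, h𝔭0, h𝔭q⟩ := mem_primesAbove.1 h𝔭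
  have hperf := perfectField_residueField 𝔭 h𝔭0
  have hmax : 𝔭.IsMaximal := h𝔭p.isMaximal h𝔭0
  have hfib : ∀ P : Ideal (𝓞 F), P ∈ (primesAbove F q).filter (fun P => P.under (𝓞 L) = 𝔭) ↔
      P ∈ 𝔭.primesOver (𝓞 F) := by
    intro P
    rw [Finset.mem_filter, mem_primesAbove]
    constructor
    · rintro ⟨⟨h1, h2, h3⟩, h4⟩
      exact ⟨h1, ⟨h4.symm⟩⟩
    · rintro ⟨h1, h2⟩
      have h3 := h2.over.symm
      refine ⟨⟨h1, ?_, ?_⟩, h3⟩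
      · rintro rfl
        exact h𝔭0 (h3.symm.trans (Ideal.under_bot _ _))
      · rw [← hratP, h3, h𝔭q]
  have hdeg : ∀ P ∈ (primesAbove F q).filter (fun P => P.under (𝓞 L) = 𝔭),
      Ideal.absNorm P = Ideal.absNorm 𝔭 ^ d ∧ (𝔭.primesOver (𝓞 F)).ncard = m := by
    intro P hP
    have hPF := (Finset.mem_filter.1 hP).1
    obtain ⟨hPp, hP0, hPq⟩ := mem_primesAbove.1 hPF
    have hlies : P.LiesOver 𝔭 := ((hfib P).1 hP).2
    have hPm : P.IsMaximal := hPp.isMaximal hP0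
    have hinH : Nat.card (P.inertia H) = 1 := by
      rw [Subgroup.card_eq_one, eq_bot_iff]
      intro σ hσ
      have : (σ : F ≃ₐ[ℚ] F) ∈ P.inertia (F ≃ₐ[ℚ] F) := hσ
      rw [hin P hPF, Subgroup.mem_bot] at this
      exact Subgroup.mem_bot.2 (Subtype.ext this)
    have h1 := Ideal.card_stabilizer_eq_card_inertia_mul_finrank (G := H) 𝔭 P
    have h2 := Ideal.ncard_primesOver_mul_card_inertia_mul_finrank (G := H) 𝔭 P
    rw [hinH, one_mul] at h1
    replace h1 : d = P.inertiaDeg (𝓞 L) := (hst P hPF).symm.trans h1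
    rw [hinH, mul_one, ← h1, hH] at h2
    have hd : 0 < d := by
      rw [← hst P hPF]; exact Nat.card_pos
    refine ⟨?_, Nat.eq_of_mul_eq_mul_right hd h2⟩
    rw [Ideal.absNorm_eq_pow_inertiaDeg'_of_liesOver P 𝔭 h𝔭p h𝔭0,
      Ideal.inertiaDeg'_eq_inertiaDeg, h1]
  rw [Finset.prod_congr rfl fun P hP => by rw [(hdeg P hP).1, hφ], Finset.prod_const]
  congr 1
  obtain ⟨P, hP⟩ : ((primesAbove F q).filter (fun P => P.under (𝓞 L) = 𝔭)).Nonempty := by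
    obtain ⟨P, hP⟩ := (inferInstance : Nonempty (𝔭.primesOver (𝓞 F)))
    exact ⟨P, (hfib P).2 hP⟩
  rw [← (hdeg P hP).2, ← Set.ncard_coe_finset]
  congr 1
  ext P
  exact hfib P

end Split

section Comb

open Filter

/-- Over a finite set of positive integers, `∑ q ^ (-15/16)` is at most `16 * card ^ (1/16)`. -/
lemma sum_rpow_neg_le_card_rpow (S : Finset ℕ) (hS : ∀ q ∈ S, 0 < q) :
    ∑ q ∈ S, (q : ℝ) ^ (-(15 / 16) : ℝ) ≤ 16 * (S.card : ℝ) ^ (1 / 16 : ℝ) := by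
  induction S using Finset.induction_on_max with
  | empty => simp
  | insert a s ha ih =>
    have has : a ∉ s := fun h => lt_irrefl _ (ha a h)
    rw [Finset.sum_insert has, Finset.card_insert_of_notMem has]
    have h1 := ih fun q hq => hS q (Finset.mem_insert_of_mem hq)
    have hcard : s.card + 1 ≤ a := by
      have : s ⊆ Finset.Ico 1 a := fun q hq =>
        Finset.mem_Ico.2 ⟨hS q (Finset.mem_insert_of_mem hq), ha q hq⟩
      have h2 := Finset.card_le_card this
      rw [Nat.card_Ico] at h2
      have := hS a (Finset.mem_insert_self _ _)
      omega
    set N : ℝ := (s.card : ℝ) with hN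
    have hN0 : 0 ≤ N := Nat.cast_nonneg _
    have h3 : (a : ℝ) ^ (-(15 / 16) : ℝ) ≤ (N + 1) ^ (-(15 / 16) : ℝ) :=
      Real.rpow_le_rpow_of_nonpos (by positivity) (by rw [hN]; exact_mod_cast hcard) (by norm_num)
    have h4 := rpow_one_add_le_one_add_mul_self (s := -(1 / (N + 1))) (p := 1 / 16)
      (by rw [neg_le_neg_iff, div_le_one (by positivity)]; linarith) (by norm_num) (by norm_num)
    have h5 : 1 + -(1 / (N + 1)) = N / (N + 1) := by field_simp; ring
    rw [h5, Real.div_rpow hN0 (by positivity), div_le_iff₀ (by positivity)] at h4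
    have h6 : (N + 1) ^ (1 / 16 : ℝ) = (N + 1) * (N + 1) ^ (-(15 / 16) : ℝ) := by
      rw [← Real.rpow_one_add' (by positivity) (by norm_num)]; norm_num
    have h7 : (1 + 1 / 16 * -(1 / (N + 1))) * (N + 1) ^ (1 / 16 : ℝ) =
        (N + 1) ^ (1 / 16 : ℝ) - (N + 1) ^ (-(15 / 16) : ℝ) / 16 := by
      rw [h6]; field_simp; ring
    push_cast
    rw [← hN]
    linarith

/-- The number of products of at most `k` elements of a set `A` of primes. -/
lemma card_pow_le_card_image_prod (A : Finset ℕ) (hA : ∀ q ∈ A, q.Prime) (k : ℕ) :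
    A.card ^ k ≤ k ^ k * ((Fintype.piFinset fun _ : Fin k => A).image fun f => ∏ i, f i).card := by
  classical
  rw [← Fintype.card_piFinset_const A k]
  refine Finset.card_le_mul_card_image _ _ fun g hg => ?_
  obtain ⟨f, hf, rfl⟩ := Finset.mem_image.1 hg
  rw [Fintype.mem_piFinset] at hf
  have hpf : (∏ i, f i).primeFactors = Finset.univ.image f := by
    ext q
    rw [Nat.mem_primeFactors, Finset.mem_image]
    constructor
    · rintro ⟨hq, hd, -⟩
      obtain ⟨i, -, hi⟩ := (hq.prime.dvd_finsetProd_iff _).1 hd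
      exact ⟨i, Finset.mem_univ _, ((Nat.prime_dvd_prime_iff_eq hq (hA _ (hf i))).1 hi).symm⟩
    · rintro ⟨i, -, rfl⟩
      exact ⟨hA _ (hf i), Finset.dvd_prod_of_mem f (Finset.mem_univ i),
        Finset.prod_ne_zero_iff.2 fun j _ => (hA _ (hf j)).ne_zero⟩
  have hck : (∏ i, f i).primeFactors.card ≤ k := by
    rw [hpf]
    exact Finset.card_image_le.trans (by simp)
  calc _ ≤ (Fintype.piFinset fun _ : Fin k => (∏ i, f i).primeFactors).card := by
        refine Finset.card_le_card fun a ha => ?_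
        rw [Finset.mem_filter, Fintype.mem_piFinset] at ha
        rw [Fintype.mem_piFinset]
        intro i
        rw [Nat.mem_primeFactors]
        refine ⟨hA _ (ha.1 i), ?_, Finset.prod_ne_zero_iff.2 fun j _ => (hA _ (hf j)).ne_zero⟩
        rw [← ha.2]
        exact Finset.dvd_prod_of_mem a (Finset.mem_univ i)
    _ ≤ k ^ k := by
        rw [Fintype.card_piFinset_const]
        exact Nat.pow_le_pow_left hck k

/-- If few of the counting values reach `y ^ (1/2)`, then the sum of `q ^ (-15/16)` is bounded. -/
lemma exists_sum_rpow_le_of_card_lt : ∃ C : ℝ, ∀ (S U : Finset ℕ), U ⊆ S →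
    (∀ y ∈ U, ((S.filter (· ≤ y)).card : ℝ) < (y : ℝ) ^ (1 / 2 : ℝ)) →
    ∑ y ∈ U, (y : ℝ) ^ (-(15 / 16) : ℝ) ≤ C := by
  have hsum : Summable fun m : ℕ => (m : ℝ) ^ (-(15 / 8) : ℝ) :=
    Real.summable_nat_rpow.2 (by norm_num)
  refine ⟨∑' m : ℕ, (m : ℝ) ^ (-(15 / 8) : ℝ), fun S U hUS h => ?_⟩
  have hinj : Set.InjOn (fun y => (S.filter (· ≤ y)).card) U := by
    intro a ha b hb hab
    by_contra hne
    wlog hlt : a < b generalizing a b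
    · exact this hb ha hab.symm (Ne.symm hne) (lt_of_le_of_ne (not_lt.1 hlt) (Ne.symm hne))
    refine absurd hab (ne_of_lt (Finset.card_lt_card ?_))
    rw [Finset.ssubset_iff_of_subset]
    · exact ⟨b, Finset.mem_filter.2 ⟨hUS hb, le_rfl⟩, fun hh =>
        absurd (Finset.mem_filter.1 hh).2 (not_le.2 hlt)⟩
    · intro q hq
      rw [Finset.mem_filter] at hq ⊢
      exact ⟨hq.1, hq.2.trans hlt.le⟩
  calc ∑ y ∈ U, (y : ℝ) ^ (-(15 / 16) : ℝ)
      ≤ ∑ y ∈ U, ((S.filter (· ≤ y)).card : ℝ) ^ (-(15 / 8) : ℝ) := by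
        refine Finset.sum_le_sum fun y hy => ?_
        have hpos : (0 : ℝ) < (S.filter (· ≤ y)).card := by
          rw [Nat.cast_pos]
          exact Finset.card_pos.2 ⟨y, Finset.mem_filter.2 ⟨hUS hy, le_rfl⟩⟩
        have : (y : ℝ) ^ (-(15 / 16) : ℝ) = ((y : ℝ) ^ (1 / 2 : ℝ)) ^ (-(15 / 8) : ℝ) := by
          rw [← Real.rpow_mul (Nat.cast_nonneg _)]; norm_num
        rw [this]
        exact Real.rpow_le_rpow_of_nonpos hpos (h y hy).le (by norm_num)
    _ = ∑ m ∈ U.image (fun y => (S.filter (· ≤ y)).card), (m : ℝ) ^ (-(15 / 8) : ℝ) :=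
        (Finset.sum_image (f := fun m : ℕ => (m : ℝ) ^ (-(15 / 8) : ℝ)) hinj).symm
    _ ≤ _ := hsum.sum_le_tsum _ fun m _ => by positivity

/-- A set of primes up to `X` with many elements up to `y` and logarithmic `y` generates many
integers up to `X`. -/
lemma exists_finset_of_card_ge {X y : ℕ} {S : Finset ℕ} (hS : ∀ q ∈ S, q.Prime) (hy3 : 3 ≤ y)
    (hyX : y ≤ X) (hlog : Real.log X ≤ (y : ℝ) ^ (1 / 8 : ℝ))
    (hc : (y : ℝ) ^ (1 / 2 : ℝ) ≤ (S.filter (· ≤ y)).card) :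
    ∃ T : Finset ℕ, (∀ g ∈ T, g ≠ 0 ∧ g ≤ X ∧ ∀ q ∈ g.primeFactors, q ∈ S) ∧
      (X : ℝ) ^ (1 / 8 : ℝ) ≤ T.card := by
  classical
  set A := S.filter (· ≤ y) with hA
  have hAp : ∀ q ∈ A, q.Prime := fun q hq => hS q (Finset.mem_filter.1 hq).1
  set k := Nat.log y X with hk
  have hX0 : X ≠ 0 := by omega
  have hk1 : 1 ≤ k := Nat.log_pos (by omega) hyX
  have hkX : y ^ k ≤ X := Nat.pow_log_le_self y hX0
  have hXk : X < y ^ (k + 1) := Nat.lt_pow_succ_log_self (by omega) X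
  have hy0 : (0 : ℝ) < y := by positivity
  refine ⟨(Fintype.piFinset fun _ : Fin k => A).image fun f => ∏ i, f i, ?_, ?_⟩
  · intro g hg
    obtain ⟨f, hf, rfl⟩ := Finset.mem_image.1 hg
    rw [Fintype.mem_piFinset] at hf
    refine ⟨Finset.prod_ne_zero_iff.2 fun j _ => (hAp _ (hf j)).ne_zero, ?_, ?_⟩
    · calc ∏ i, f i ≤ ∏ _i : Fin k, y :=
            Finset.prod_le_prod' fun i _ => (Finset.mem_filter.1 (hf i)).2
        _ = y ^ k := by simp
        _ ≤ X := hkX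
    · intro q hq
      obtain ⟨hqp, hd, -⟩ := Nat.mem_primeFactors.1 hq
      obtain ⟨i, -, hi⟩ := (hqp.prime.dvd_finsetProd_iff _).1 hd
      rw [(Nat.prime_dvd_prime_iff_eq hqp (hAp _ (hf i))).1 hi]
      exact (Finset.mem_filter.1 (hf i)).1
  · have h1 := card_pow_le_card_image_prod A hAp k
    set T := (Fintype.piFinset fun _ : Fin k => A).image fun f => ∏ i, f i
    have h1' : (A.card : ℝ) ^ k ≤ (k : ℝ) ^ k * T.card := by exact_mod_cast h1
    have hlogy : 1 ≤ Real.log y := by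
      rw [Real.le_log_iff_exp_le hy0]
      have h3 : (3 : ℝ) ≤ y := by exact_mod_cast hy3
      linarith [Real.exp_one_lt_d9]
    have hkl : (k : ℝ) ≤ (y : ℝ) ^ (1 / 8 : ℝ) := by
      refine le_trans ?_ hlog
      have : Real.log ((y : ℝ) ^ k) ≤ Real.log X :=
        Real.log_le_log (by positivity) (by exact_mod_cast hkX)
      rw [Real.log_pow] at this
      have hk0 : (0 : ℝ) ≤ k := Nat.cast_nonneg _
      nlinarith
    have h2 : ((y : ℝ) ^ (1 / 2 : ℝ)) ^ k ≤ ((y : ℝ) ^ (1 / 8 : ℝ)) ^ k * T.card := by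
      calc ((y : ℝ) ^ (1 / 2 : ℝ)) ^ k ≤ (A.card : ℝ) ^ k := by gcongr
        _ ≤ _ := h1'
        _ ≤ _ := by gcongr
    have h3 : (y : ℝ) ^ (1 / 2 : ℝ) = (y : ℝ) ^ (1 / 8 : ℝ) * (y : ℝ) ^ (3 / 8 : ℝ) := by
      rw [← Real.rpow_add hy0]; norm_num
    rw [h3, mul_pow] at h2
    have h4 : ((y : ℝ) ^ (3 / 8 : ℝ)) ^ k ≤ T.card := le_of_mul_le_mul_left h2 (by positivity)
    refine le_trans ?_ h4
    have h5 : (X : ℝ) ≤ (y : ℝ) ^ (2 * k : ℝ) := by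
      calc (X : ℝ) ≤ (y : ℝ) ^ (k + 1) := by exact_mod_cast hXk.le
        _ ≤ (y : ℝ) ^ (2 * k) :=
          pow_le_pow_right₀ (by exact_mod_cast (by omega : 1 ≤ y)) (by omega)
        _ = _ := by rw [← Real.rpow_natCast]; push_cast; rfl
    calc (X : ℝ) ^ (1 / 8 : ℝ) ≤ ((y : ℝ) ^ (2 * k : ℝ)) ^ (1 / 8 : ℝ) := by gcongr
      _ = (y : ℝ) ^ (2 / 8 * k : ℝ) := by rw [← Real.rpow_mul hy0.le]; ring_nf
      _ ≤ (y : ℝ) ^ (3 / 8 * k : ℝ) := by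
          refine Real.rpow_le_rpow_of_exponent_le (by exact_mod_cast (by omega : 1 ≤ y)) ?_
          have hk0 : (0 : ℝ) ≤ k := Nat.cast_nonneg _
          linarith
      _ = _ := by rw [Real.rpow_mul hy0.le, Real.rpow_natCast]

lemma eventually_const_mul_log_rpow_le {r ε : ℝ} (c : ℝ) (hr : r < 1) (hε : 0 < ε) :
    ∀ᶠ X : ℕ in atTop, c * Real.log X ^ r ≤ ε * Real.log X := by
  have h1 : Tendsto (fun X : ℕ => Real.log X) atTop atTop :=
    Real.tendsto_log_atTop.comp tendsto_natCast_atTop_atTop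
  have h2 : Tendsto (fun X : ℕ => Real.log X ^ (1 - r)) atTop atTop :=
    (tendsto_rpow_atTop (by linarith)).comp h1
  filter_upwards [h1.eventually_gt_atTop 0, h2.eventually_ge_atTop (c / ε)] with X hX h3
  rw [div_le_iff₀ hε] at h3
  calc c * Real.log X ^ r ≤ Real.log X ^ (1 - r) * ε * Real.log X ^ r := by gcongr
    _ = ε * (Real.log X ^ (1 - r) * Real.log X ^ r) := by ring
    _ = ε * Real.log X := by rw [← Real.rpow_add hX]; norm_num

/-- Many integers composed of primes in `S`, from a lower bound for `∑ q ^ (-15/16)` over `S`. -/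
lemma exists_finset_of_mul_log_le_sum {ε : ℝ} (hε : 0 < ε) :
    ∀ᶠ X : ℕ in atTop, ∀ S : Finset ℕ, (∀ q ∈ S, q.Prime ∧ q ≤ X) →
      ε * Real.log X ≤ ∑ q ∈ S, (q : ℝ) ^ (-(15 / 16) : ℝ) →
      ∃ T : Finset ℕ, (∀ g ∈ T, g ≠ 0 ∧ g ≤ X ∧ ∀ q ∈ g.primeFactors, q ∈ S) ∧
        (X : ℝ) ^ (1 / 8 : ℝ) ≤ T.card := by
  obtain ⟨C, hC⟩ := exists_sum_rpow_le_of_card_lt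
  have h1 : Tendsto (fun X : ℕ => Real.log X) atTop atTop :=
    Real.tendsto_log_atTop.comp tendsto_natCast_atTop_atTop
  filter_upwards [h1.eventually_ge_atTop 3, h1.eventually_gt_atTop (C / (ε / 2)),
    eventually_const_mul_log_rpow_le 16 (show (1 / 2 : ℝ) < 1 by norm_num) (half_pos hε)]
    with X hX3 hXC hX16 S hS hsum
  set l := Real.log X
  have hsplit := Finset.sum_filter_add_sum_filter_not S (fun q : ℕ => (q : ℝ) ≤ l ^ 8)
    (fun q => (q : ℝ) ^ (-(15 / 16) : ℝ))
  have hsmall : ∑ q ∈ S.filter (fun q : ℕ => (q : ℝ) ≤ l ^ 8), (q : ℝ) ^ (-(15 / 16) : ℝ) ≤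
      16 * l ^ (1 / 2 : ℝ) := by
    refine (sum_rpow_neg_le_card_rpow _ fun q hq =>
      (hS q (Finset.mem_filter.1 hq).1).1.pos).trans ?_
    have hcard : ((S.filter (fun q : ℕ => (q : ℝ) ≤ l ^ 8)).card : ℝ) ≤ l ^ 8 := by
      have : S.filter (fun q : ℕ => (q : ℝ) ≤ l ^ 8) ⊆ Finset.Ioc 0 ⌊l ^ 8⌋₊ := by
        intro q hq
        rw [Finset.mem_filter] at hq
        exact Finset.mem_Ioc.2 ⟨(hS q hq.1).1.pos, Nat.le_floor hq.2⟩
      have h2 := Finset.card_le_card this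
      rw [Nat.card_Ioc, Nat.sub_zero] at h2
      calc _ ≤ ((⌊l ^ 8⌋₊ : ℕ) : ℝ) := by exact_mod_cast h2
        _ ≤ _ := Nat.floor_le (by positivity)
    calc _ ≤ 16 * (l ^ 8) ^ (1 / 16 : ℝ) := by gcongr
      _ = 16 * l ^ (1 / 2 : ℝ) := by
        rw [← Real.rpow_natCast, ← Real.rpow_mul (by linarith)]; norm_num
  by_contra hT
  have hlarge := hC S (S.filter (fun q : ℕ => ¬ (q : ℝ) ≤ l ^ 8)) (Finset.filter_subset _ _) (by
    intro y hy
    rw [Finset.mem_filter, not_le] at hy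
    by_contra hcon
    refine hT (exists_finset_of_card_ge (fun q hq => (hS q hq).1) ?_ (hS y hy.1).2 ?_
      (not_lt.1 hcon))
    · have h3 : (3 : ℝ) ^ 8 ≤ l ^ 8 := by gcongr
      have : (3 : ℝ) ≤ y := by linarith
      exact_mod_cast this
    · calc l = (l ^ 8) ^ (1 / 8 : ℝ) := by
            rw [← Real.rpow_natCast, ← Real.rpow_mul (by linarith)]; norm_num
        _ ≤ _ := by
            have := hy.2.le
            gcongr)
  rw [div_lt_iff₀ (half_pos hε)] at hXC
  linarith

/-- Removing the primes dividing a polynomially bounded integer does not affect the conclusion. -/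
lemma exists_finset_of_mul_log_le_sum_of_dvd {ε : ℝ} (hε : 0 < ε) (B : ℝ) :
    ∀ᶠ X : ℕ in atTop, ∀ (S S' : Finset ℕ) (D : ℕ), D ≠ 0 → (D : ℝ) ≤ (X : ℝ) ^ B →
      (∀ q ∈ S, q.Prime ∧ q ≤ X) → S' ⊆ S → (∀ q ∈ S, q ∉ S' → q ∣ D) →
      ε * Real.log X ≤ ∑ q ∈ S, (q : ℝ) ^ (-(15 / 16) : ℝ) →
      ∃ T : Finset ℕ, (∀ g ∈ T, g ≠ 0 ∧ g ≤ X ∧ ∀ q ∈ g.primeFactors, q ∈ S') ∧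
        (X : ℝ) ^ (1 / 8 : ℝ) ≤ T.card := by
  have h1 : Tendsto (fun X : ℕ => Real.log X) atTop atTop :=
    Real.tendsto_log_atTop.comp tendsto_natCast_atTop_atTop
  filter_upwards [h1.eventually_gt_atTop 0, exists_finset_of_mul_log_le_sum (half_pos hε),
    eventually_const_mul_log_rpow_le (16 * (B / Real.log 2) ^ (1 / 16 : ℝ))
      (show (1 / 16 : ℝ) < 1 by norm_num) (half_pos hε)] with X hX0 hX hXr S S' D hD hDX hS hS' hdvd
      hsum
  refine hX S' (fun q hq => hS q (hS' hq)) ?_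
  have hX1 : (0 : ℝ) < X := by
    rcases Nat.eq_zero_or_pos X with h | h
    · rw [h] at hX0; simp at hX0
    · exact_mod_cast h
  have hsplit := Finset.sum_sdiff hS' (f := fun q : ℕ => (q : ℝ) ^ (-(15 / 16) : ℝ))
  have hcard : ((S \ S').card : ℝ) ≤ B / Real.log 2 * Real.log X := by
    have h2 : 2 ^ (S \ S').card ≤ D := by
      calc 2 ^ (S \ S').card = ∏ _q ∈ S \ S', 2 := by simp
        _ ≤ ∏ q ∈ S \ S', q := Finset.prod_le_prod' fun q hq =>
            (hS q (Finset.mem_sdiff.1 hq).1).1.two_le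
        _ ≤ D := Nat.le_of_dvd (Nat.pos_of_ne_zero hD) (Finset.prod_primes_dvd D
            (fun q hq => (hS q (Finset.mem_sdiff.1 hq).1).1.prime)
            fun q hq => hdvd q (Finset.mem_sdiff.1 hq).1 (Finset.mem_sdiff.1 hq).2)
    have h3 : Real.log ((2 : ℝ) ^ (S \ S').card) ≤ Real.log ((X : ℝ) ^ B) :=
      Real.log_le_log (by positivity) (le_trans (by exact_mod_cast h2) hDX)
    rw [Real.log_pow, Real.log_rpow hX1] at h3
    rw [div_mul_eq_mul_div, le_div_iff₀ (Real.log_pos one_lt_two)]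
    exact h3
  have hB : 0 ≤ B := by
    have h2 : (1 : ℝ) ≤ (X : ℝ) ^ B := le_trans (by exact_mod_cast Nat.one_le_iff_ne_zero.2 hD) hDX
    have h3 := Real.log_nonneg h2
    rw [Real.log_rpow hX1] at h3
    exact nonneg_of_mul_nonneg_left h3 hX0
  have hr : ∑ q ∈ S \ S', (q : ℝ) ^ (-(15 / 16) : ℝ) ≤ ε / 2 * Real.log X := by
    refine (sum_rpow_neg_le_card_rpow _ fun q hq =>
      (hS q (Finset.mem_sdiff.1 hq).1).1.pos).trans (le_trans ?_ hXr)
    have hl2 := Real.log_pos one_lt_two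
    rw [mul_assoc, ← Real.mul_rpow (by positivity) hX0.le]
    gcongr
  linarith

lemma eventually_log_le_sum_primesLE {σ : ℝ} (h0 : 0 ≤ σ) (hσ : σ < 1) :
    ∀ᶠ X : ℕ in atTop, Real.log X ≤ ∑ q ∈ Nat.primesLE X, (q : ℝ) ^ (-σ) := by
  have ht : Tendsto (fun X : ℕ => (X : ℝ)) atTop atTop := tendsto_natCast_atTop_atTop
  have h1 : Tendsto (fun X : ℕ => Real.log X) atTop atTop := Real.tendsto_log_atTop.comp ht
  have h2 := ht.eventually ((isLittleO_log_rpow_rpow_atTop 2 (sub_pos.2 hσ)).def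
    (show (0 : ℝ) < 1 / 4 by norm_num))
  have h3 := ht.eventually ((isLittleO_log_rpow_rpow_atTop 1 one_pos).def
    (show (0 : ℝ) < 1 / 8 by norm_num))
  filter_upwards [h1.eventually_gt_atTop 0, h2, h3, eventually_ge_atTop 16] with X hX hX2 hX3 hX16
  have hX16' : (16 : ℝ) ≤ X := by exact_mod_cast hX16
  have hX0 : (0 : ℝ) < X := by linarith
  simp only [Real.rpow_one] at hX3
  rw [Real.norm_of_nonneg (by positivity), Real.norm_of_nonneg (by positivity)] at hX2 hX3
  have h4 : Real.log (X + 1) ≤ Real.log X + 1 := by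
    have : Real.log (X + 1) ≤ Real.log (2 * X) := Real.log_le_log (by positivity) (by linarith)
    rw [Real.log_mul two_ne_zero hX0.ne'] at this
    linarith [Real.log_two_lt_d9]
  have h5 := (Chebyshev.psi_ge X).trans (Chebyshev.psi_le_primeCounting_mul_log X)
  have h6 : (X : ℝ) / 4 ≤ Nat.primeCounting X * Real.log X := by
    have : (X : ℝ) * (1 / 2) ≤ X * Real.log 2 := by
      gcongr; linarith [Real.log_two_gt_d9]
    linarith
  have h7 : (Nat.primeCounting X : ℝ) * (X : ℝ) ^ (-σ) ≤ ∑ q ∈ Nat.primesLE X, (q : ℝ) ^ (-σ) := by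
    rw [← Nat.primesLE_card_eq_primeCounting, ← nsmul_eq_mul]
    refine Finset.card_nsmul_le_sum _ _ _ fun q hq => ?_
    rw [Nat.mem_primesLE] at hq
    exact Real.rpow_le_rpow_of_nonpos (by exact_mod_cast hq.2.pos) (by exact_mod_cast hq.1)
      (by linarith)
  refine le_trans ?_ h7
  refine le_of_mul_le_mul_right ?_ hX
  calc Real.log X * Real.log X = Real.log X ^ (2 : ℝ) := by
        rw [Real.rpow_two, sq]
    _ ≤ 1 / 4 * (X : ℝ) ^ (1 - σ) := hX2
    _ = X / 4 * (X : ℝ) ^ (-σ) := by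
        rw [sub_eq_add_neg, Real.rpow_add hX0, Real.rpow_one]; ring
    _ ≤ Nat.primeCounting X * Real.log X * (X : ℝ) ^ (-σ) := by gcongr
    _ = _ := by ring

end Comb

section Good

open scoped Pointwise nonZeroDivisors

variable {F : Type} [Field F] [NumberField F]

/-- Some prime above `q` is not fixed by the subgroup `H`. -/
def MovesPrimesAbove (H : Subgroup (F ≃ₐ[ℚ] F)) (q : ℕ) : Prop :=
  ∃ P ∈ primesAbove F q, ∃ σ ∈ H, σ • P ≠ P

lemma eq_of_smul_le {P Q : Ideal (𝓞 F)} (hP : P.IsMaximal) (hQ : Q.IsPrime) (σ : F ≃ₐ[ℚ] F)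
    (h : σ • P ≤ Q) : σ • P = Q := by
  rw [← smul_left_cancel_iff σ⁻¹, inv_smul_smul]
  refine hP.eq_of_le ?_ ?_
  · intro h1
    apply hQ.ne_top
    rw [Ideal.eq_top_iff_one] at h1 ⊢
    rw [Ideal.mem_inv_pointwise_smul_iff, smul_one] at h1
    exact h1
  · intro x hx
    rw [Ideal.mem_inv_pointwise_smul_iff]
    exact h (Ideal.smul_mem_pointwise_smul σ x P hx)

lemma absNorm_le_pow_of_mem_primesAbove {q : ℕ} (hq : q.Prime) {P : Ideal (𝓞 F)}
    (hP : P ∈ primesAbove F q) : Ideal.absNorm P ≤ q ^ Module.finrank ℚ F := by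
  obtain ⟨h1, h2, h3⟩ := mem_primesAbove.1 hP
  rw [ratPrime_eq_iff h1 h2 hq] at h3
  rw [← RingOfIntegers.rank F, ← Ideal.absNorm_span_natCast]
  refine Nat.le_of_dvd ?_ (map_dvd Ideal.absNorm
    (Ideal.dvd_iff_le.2 ((Ideal.span_singleton_le_iff_mem _).2 h3)))
  rw [Ideal.absNorm_span_natCast]
  exact pow_pos hq.pos _

/-- Ideals attached to integers composed of moved primes, in distinct classes relative to
elements fixed by `H`. -/
lemma exists_separated_ideals (H : Subgroup (F ≃ₐ[ℚ] F)) (T : Finset ℕ)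
    (hT : ∀ g ∈ T, g ≠ 0 ∧ ∀ q ∈ g.primeFactors, MovesPrimesAbove H q) {ℓ : ℕ} (hℓ : 1 ≤ ℓ) :
    ∃ J : ℕ → (Ideal (𝓞 F))⁰,
      (∀ g ∈ T, Ideal.absNorm (J g : Ideal (𝓞 F)) ≤ g ^ Module.finrank ℚ F) ∧
      ∀ i ∈ T, ∀ j ∈ T, ∀ β : 𝓞 F, β ≠ 0 → (∀ σ ∈ H, σ • β = β) → ∀ M : ℕ, M ≠ 0 →
        Ideal.span {β} * (J j : Ideal (𝓞 F)) ^ ℓ =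
          Ideal.span {(M : 𝓞 F)} ^ ℓ * (J i : Ideal (𝓞 F)) ^ ℓ → i = j := by
  classical
  have hch : ∀ q : ℕ, ∃ P : Ideal (𝓞 F), ∃ σ ∈ H, P ≠ ⊥ ∧
      (MovesPrimesAbove H q → P ∈ primesAbove F q ∧ σ • P ≠ P) := by
    intro q
    by_cases h : MovesPrimesAbove H q
    · obtain ⟨P, hP, σ, hσ, hne⟩ := h
      exact ⟨P, σ, hσ, (mem_primesAbove.1 hP).2.1, fun _ => ⟨hP, hne⟩⟩
    · exact ⟨⊤, 1, H.one_mem, top_ne_bot, fun h' => absurd h' h⟩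
  choose P τ hτ hP0 hP using hch
  have hI0 : ∀ g : ℕ, ∏ q ∈ g.primeFactors, P q ^ g.factorization q ∈ (Ideal (𝓞 F))⁰ := fun g =>
    mem_nonZeroDivisors_of_ne_zero (Finset.prod_ne_zero_iff.2 fun q _ => pow_ne_zero _ (hP0 q))
  have hprime : ∀ q, MovesPrimesAbove H q → Prime (P q) := fun q hq =>
    Ideal.prime_of_isPrime (hP0 q) (mem_primesAbove.1 (hP q hq).1).1
  have hmax : ∀ q, MovesPrimesAbove H q → (P q).IsMaximal := fun q hq =>
    (mem_primesAbove.1 (hP q hq).1).1.isMaximal (hP0 q)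
  have hrat : ∀ q, MovesPrimesAbove H q → ∀ q', q'.Prime → MovesPrimesAbove H q' →
      ∀ σ : F ≃ₐ[ℚ] F, P q ∣ σ • P q' → q' = q ∧ σ • P q' = P q := by
    intro q hq q' hq'p hq' σ hd
    obtain ⟨h1, h2, h3⟩ := mem_primesAbove.1 (hP q hq).1
    obtain ⟨h1', h2', h3'⟩ := mem_primesAbove.1 (hP q' hq').1
    have heq := eq_of_smul_le (hmax q' hq') h1 σ (Ideal.dvd_iff_le.1 hd)
    refine ⟨?_, heq⟩
    rw [ratPrime_eq_iff h1' h2' hq'p] at h3'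
    have h4 := Ideal.smul_mem_pointwise_smul σ _ _ h3'
    rw [heq, show σ • (q' : 𝓞 F) = q' from map_natCast (MulSemiringAction.toRingHom _ (𝓞 F) σ) q',
      ← ratPrime_eq_iff h1 h2 hq'p, h3] at h4
    exact h4.symm
  have hm1 : ∀ g ∈ T, ∀ q, MovesPrimesAbove H q →
      emultiplicity (P q) (∏ q ∈ g.primeFactors, P q ^ g.factorization q) =
        (g.factorization q : ℕ∞) := by
    intro g hg q hq
    rw [Finset.emultiplicity_prod (hprime q hq)]
    rw [Finset.sum_eq_single q]
    · exact emultiplicity_pow_self (hP0 q) (hprime q hq).not_isUnit _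
    · intro q' hq' hne
      rw [emultiplicity_pow (hprime q hq), emultiplicity_eq_zero.2, mul_zero]
      intro hd
      refine hne (hrat q hq q' (Nat.prime_of_mem_primeFactors hq') ((hT g hg).2 q' hq') 1 ?_).1
      rwa [one_smul]
    · intro hq'
      rw [Finsupp.notMem_support_iff.1 (by rwa [Nat.support_factorization]), pow_zero]
      exact emultiplicity_of_one_right (hprime q hq).not_isUnit
  have hm2 : ∀ g ∈ T, ∀ q, MovesPrimesAbove H q →
      emultiplicity (P q) (τ q • ∏ q ∈ g.primeFactors, P q ^ g.factorization q) = 0 := by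
    intro g hg q hq
    rw [emultiplicity_eq_zero, Finset.smul_prod', (hprime q hq).dvd_finsetProd_iff]
    rintro ⟨q', hq', hd⟩
    rw [smul_pow'] at hd
    obtain ⟨h1, h2⟩ := hrat q hq q' (Nat.prime_of_mem_primeFactors hq') ((hT g hg).2 q' hq') _
      ((hprime q hq).dvd_of_dvd_pow hd)
    subst h1
    exact (hP _ hq).2 h2
  refine ⟨fun g => ⟨_, hI0 g⟩, fun g hg => ?_, fun i hi j hj β hβ hfix M hM h => ?_⟩
  · dsimp only
    conv_rhs => rw [← Nat.prod_factorization_pow_eq_self (hT g hg).1]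
    rw [Finsupp.prod, Nat.support_factorization, ← Finset.prod_pow, map_prod]
    refine Finset.prod_le_prod' fun q hq => ?_
    rw [map_pow, ← pow_mul, mul_comm, pow_mul]
    exact Nat.pow_le_pow_left (absNorm_le_pow_of_mem_primesAbove
      (Nat.prime_of_mem_primeFactors hq) (hP q ((hT g hg).2 q hq)).1) _
  · dsimp only at h
    refine Nat.eq_of_factorization_eq (hT i hi).1 (hT j hj).1 fun q => ?_
    by_cases hq : MovesPrimesAbove H q
    · have h1 := congrArg (fun I => τ q • I) h
      simp only [smul_mul', smul_pow', Ideal.smul_closure, Set.smul_set_singleton,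
        hfix _ (hτ q)] at h1
      rw [show τ q • (M : 𝓞 F) = M from map_natCast (MulSemiringAction.toRingHom _ (𝓞 F) (τ q)) M]
        at h1
      have hβ0 : Ideal.span {β} ≠ (0 : Ideal (𝓞 F)) := by simpa using hβ
      have hM0 : Ideal.span {(M : 𝓞 F)} ^ ℓ ≠ (0 : Ideal (𝓞 F)) := by
        apply pow_ne_zero; simpa using hM
      have hmi := hm1 i hi q hq
      have hmj := hm1 j hj q hq
      have hmi' := hm2 i hi q hq
      have hmj' := hm2 j hj q hq
      set I := ∏ q ∈ i.primeFactors, P q ^ i.factorization q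
      set J := ∏ q ∈ j.primeFactors, P q ^ j.factorization q
      have h2 : (J * τ q • I) ^ ℓ = (I * τ q • J) ^ ℓ := by
        refine mul_left_cancel₀ (mul_ne_zero hβ0 hM0) ?_
        rw [mul_pow J, mul_pow I]
        calc _ = (Ideal.span {β} * J ^ ℓ) * (Ideal.span {(M : 𝓞 F)} ^ ℓ * (τ q • I) ^ ℓ) := by ring
          _ = (Ideal.span {(M : 𝓞 F)} ^ ℓ * I ^ ℓ) * (Ideal.span {β} * (τ q • J) ^ ℓ) := by
            rw [h, h1]
          _ = _ := by ring
      have h3 := congrArg (emultiplicity (P q)) h2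
      rw [emultiplicity_pow (hprime q hq), emultiplicity_pow (hprime q hq),
        emultiplicity_mul (hprime q hq), emultiplicity_mul (hprime q hq), hmi, hmj, hmi', hmj',
        add_zero, add_zero] at h3
      have h4 : ℓ * j.factorization q = ℓ * i.factorization q := by exact_mod_cast h3
      exact (Nat.eq_of_mul_eq_mul_left hℓ h4).symm
    · rw [Finsupp.notMem_support_iff.1, Finsupp.notMem_support_iff.1]
      · rw [Nat.support_factorization]
        exact fun h' => hq ((hT j hj).2 q h')
      · rw [Nat.support_factorization]
        exact fun h' => hq ((hT i hi).2 q h')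

lemma le_stabilizer_of_not_moves {H : Subgroup (F ≃ₐ[ℚ] F)} {q : ℕ} (h : ¬ MovesPrimesAbove H q)
    {P : Ideal (𝓞 F)} (hP : P ∈ primesAbove F q) : H ≤ MulAction.stabilizer (F ≃ₐ[ℚ] F) P := by
  intro σ hσ
  by_contra hne
  exact h ⟨P, hP, σ, hσ, hne⟩

lemma isCyclic_of_le_stabilizer [IsGalois ℚ F] {H : Subgroup (F ≃ₐ[ℚ] F)} {q : ℕ} (hq : q.Prime)
    (hd : ¬ (q : ℤ) ∣ discr F) {P : Ideal (𝓞 F)} (hP : P ∈ primesAbove F q)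
    (h : H ≤ MulAction.stabilizer (F ≃ₐ[ℚ] F) P) : IsCyclic H := by
  obtain ⟨h1, h2, -⟩ := mem_primesAbove.1 hP
  have := isCyclic_stabilizer h1 h2 (inertia_eq_bot_of_not_dvd_discr hq hd hP)
  exact isCyclic_of_injective (Subgroup.inclusion h) (Subgroup.inclusion_injective h)

lemma primesAbove_nonempty {q : ℕ} (hq : q.Prime) : (primesAbove F q).Nonempty := by
  have h1 : Ideal.span {(q : 𝓞 F)} ≠ ⊤ := by
    intro h
    have h2 := congrArg Ideal.absNorm h
    rw [Ideal.absNorm_span_natCast, Ideal.absNorm_top, RingOfIntegers.rank] at h2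
    exact absurd h2 (Nat.one_lt_pow Module.finrank_pos.ne' hq.one_lt).ne'
  obtain ⟨P, hP, hle⟩ := Ideal.exists_le_maximal _ h1
  rw [Ideal.span_singleton_le_iff_mem] at hle
  have h0 : P ≠ ⊥ := by
    rintro rfl
    exact hq.ne_zero (by simpa using hle)
  exact ⟨P, mem_primesAbove.2 ⟨hP.isPrime, h0, (ratPrime_eq_iff hP.isPrime h0 hq).2 hle⟩⟩

lemma movesPrimesAbove_of_not_isCyclic [IsGalois ℚ F] {H : Subgroup (F ≃ₐ[ℚ] F)}
    (hH : ¬ IsCyclic H) {q : ℕ} (hq : q.Prime) (hd : ¬ (q : ℤ) ∣ discr F) :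
    MovesPrimesAbove H q := by
  by_contra h
  obtain ⟨P, hP⟩ := primesAbove_nonempty (F := F) hq
  exact hH (isCyclic_of_le_stabilizer hq hd hP (le_stabilizer_of_not_moves h hP))

/-- Euler factors at an unramified prime all of whose extensions are fixed by `H`, for the fixed
fields of `H` and of a non-cyclic `W` containing `H` with prime index. -/
lemma prod_primesAbove_eq_of_not_moves [IsGalois ℚ F] {H W : Subgroup (F ≃ₐ[ℚ] F)} {p : ℕ}
    (hp : p.Prime) (hHW : H ≤ W) (hcard : Nat.card W = p * Nat.card H) (hW : ¬ IsCyclic W) {q : ℕ}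
    (hq : q.Prime) (hd : ¬ (q : ℤ) ∣ discr F) (h : ¬ MovesPrimesAbove H q) (s : ℂ) :
    ∏ 𝔭 ∈ primesAbove (FixedPoints.intermediateField H : IntermediateField ℚ F) q,
      (1 - ((Ideal.absNorm 𝔭 : ℝ) : ℂ) ^ (-s)) =
    (∏ 𝔭 ∈ primesAbove (FixedPoints.intermediateField W : IntermediateField ℚ F) q,
      (1 - ((Ideal.absNorm 𝔭 : ℝ) : ℂ) ^ (-s))) ^ p := by
  have hin : ∀ P ∈ primesAbove F q, P.inertia (F ≃ₐ[ℚ] F) = ⊥ := fun P hP =>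
    inertia_eq_bot_of_not_dvd_discr hq hd hP
  have hd0 : 0 < Nat.card H := Nat.card_pos
  have hstH : ∀ P ∈ primesAbove F q, Nat.card (MulAction.stabilizer H P) = Nat.card H := by
    intro P hP
    have : MulAction.stabilizer H P = ⊤ := by
      rw [eq_top_iff]
      intro σ _
      exact le_stabilizer_of_not_moves h hP σ.2
    rw [this, Subgroup.card_top]
  have hstW : ∀ P ∈ primesAbove F q, Nat.card (MulAction.stabilizer W P) = Nat.card H := by
    intro P hP
    have h1 : H.subgroupOf W ≤ MulAction.stabilizer W P := by
      intro σ hσ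
      exact le_stabilizer_of_not_moves h hP hσ
    have h2 := Subgroup.card_dvd_of_le h1
    rw [Nat.card_congr (Subgroup.subgroupOfEquivOfLe hHW).toEquiv] at h2
    have h3 := Subgroup.card_subgroup_dvd_card (MulAction.stabilizer W P)
    obtain ⟨k, hk⟩ := h2
    rw [hcard, hk, mul_comm p] at h3
    rcases (Nat.dvd_prime hp).1 (Nat.dvd_of_mul_dvd_mul_left hd0 h3) with hk1 | hkp
    · rw [hk, hk1, mul_one]
    · exfalso
      have htop : MulAction.stabilizer W P = ⊤ := by
        apply Subgroup.eq_top_of_card_eq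
        rw [hk, hkp, hcard, mul_comm]
      refine hW (isCyclic_of_le_stabilizer hq hd hP fun σ hσ => ?_)
      have : (⟨σ, hσ⟩ : W) ∈ MulAction.stabilizer W P := by rw [htop]; exact Subgroup.mem_top _
      exact this
  let φ : ℕ → ℂ := fun m => 1 - (((m : ℝ) ^ ((Nat.card H : ℝ)⁻¹) : ℝ) : ℂ) ^ (-s)
  let ψ : ℕ → ℂ := fun a => 1 - ((a : ℝ) : ℂ) ^ (-s)
  have hφ : ∀ a : ℕ, φ (a ^ Nat.card H) = ψ a := by
    intro a
    simp only [φ, ψ]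
    rw [Nat.cast_pow, Real.pow_rpow_inv_natCast (Nat.cast_nonneg _) hd0.ne']
  have e1 := prod_primesAbove_eq_pow H hin hstH (one_mul _).symm φ ψ hφ
  have e2 := prod_primesAbove_eq_pow W hin hstW hcard φ ψ hφ
  rw [pow_one] at e1
  exact e1.symm.trans e2

end Good

section Group

/-- Adjoining an element of order `p` outside a nontrivial cyclic normal subgroup. -/
lemma IsPGroup.exists_not_isCyclic_le {p : ℕ} [Fact p.Prime] {G : Type*} [Group G] [Finite G]
    (hG : IsPGroup p G) (hnc : ¬ IsCyclic G)
    (hnq : ∀ n : ℕ, 1 ≤ n → IsEmpty (G ≃* QuaternionGroup (2 ^ n))) (H : Subgroup G) [H.Normal]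
    (hH : IsCyclic H) (hbot : H ≠ ⊥) :
    ∃ W : Subgroup G, H ≤ W ∧ Nat.card W = p * Nat.card H ∧ ¬ IsCyclic W := by
  classical
  obtain ⟨z, hz, hzH⟩ := hG.exists_orderOf_eq_prime_notMem hnc hnq H
  have hp : p.Prime := Fact.out
  have hzc : Nat.card (Subgroup.zpowers z) = p := by rw [Nat.card_zpowers, hz]
  have hinf : H ⊓ Subgroup.zpowers z = ⊥ := by
    rw [← Subgroup.card_eq_one]
    have h1 := Subgroup.card_dvd_of_le (inf_le_right : H ⊓ Subgroup.zpowers z ≤ _)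
    rw [hzc] at h1
    rcases (Nat.dvd_prime hp).1 h1 with h | h
    · exact h
    · exfalso
      have h2 : H ⊓ Subgroup.zpowers z = Subgroup.zpowers z :=
        Subgroup.eq_of_le_of_card_ge inf_le_right (by rw [h, hzc])
      exact hzH ((h2.ge (Subgroup.mem_zpowers z)).1)
  have hcard : Nat.card (H ⊔ Subgroup.zpowers z : Subgroup G) = p * Nat.card H := by
    have h1 := Subgroup.relIndex_mul_relIndex ⊥ H (H ⊔ Subgroup.zpowers z) bot_le le_sup_left
    rw [Subgroup.relIndex_sup_left, ← Subgroup.inf_relIndex_right H, hinf, Subgroup.relIndex_bot_left,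
      Subgroup.relIndex_bot_left, Subgroup.relIndex_bot_left, hzc] at h1
    rw [← h1, mul_comm]
  refine ⟨H ⊔ Subgroup.zpowers z, le_sup_left, hcard, fun hcyc => ?_⟩
  set W := H ⊔ Subgroup.zpowers z
  have hpH : p ∣ Nat.card H := by
    obtain ⟨k, hk⟩ := (hG.to_subgroup H).exists_card_eq
    have hk0 : k ≠ 0 := by
      rintro rfl
      exact hbot (Subgroup.card_eq_one.1 (by rw [hk, pow_zero]))
    rw [hk]
    exact dvd_pow_self _ hk0
  obtain ⟨w, hw⟩ := exists_prime_orderOf_dvd_card' p hpH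
  let w' : W := ⟨w, le_sup_left (a := H) w.2⟩
  let z' : W := ⟨z, le_sup_right (a := H) (Subgroup.mem_zpowers z)⟩
  have hw' : orderOf w' = p := by
    rw [← hw, ← Subgroup.orderOf_coe, ← Subgroup.orderOf_coe w]
  have hz' : orderOf z' = p := by rw [← hz, ← Subgroup.orderOf_coe]
  have : Fintype W := Fintype.ofFinite W
  have hle := IsCyclic.card_pow_eq_one_le (α := W) hp.pos
  have hsub : insert z' ((Subgroup.zpowers w' : Set W).toFinset) ⊆
      Finset.univ.filter fun a : W => a ^ p = 1 := by
    intro a ha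
    rw [Finset.mem_filter]
    refine ⟨Finset.mem_univ _, ?_⟩
    rw [Finset.mem_insert, Set.mem_toFinset] at ha
    rcases ha with rfl | ha
    · rw [← hz', pow_orderOf_eq_one]
    · rw [← hw']
      exact orderOf_dvd_iff_pow_eq_one.1 (orderOf_dvd_of_mem_zpowers ha)
  have hnot : z' ∉ (Subgroup.zpowers w' : Set W).toFinset := by
    rw [Set.mem_toFinset]
    rintro ⟨k, hk⟩
    apply hzH
    have : (w : G) ^ k = z := congrArg Subtype.val hk
    rw [← this]
    exact H.zpow_mem w.2 k
  have h1 := (Finset.card_le_card hsub).trans hle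
  rw [Finset.card_insert_of_notMem hnot, Set.toFinset_card, ← Nat.card_eq_fintype_card] at h1
  have h2 : Nat.card (Subgroup.zpowers w' : Set W) = p := by
    rw [← hw']; exact Nat.card_zpowers w'
  omega

end Group

/-- A version of `exists_mul_log_le_sum` that is uniform in fields of bounded degree. -/
lemma exists_mul_log_le_sum_of_finrank_le (N p : ℕ) (hp : 2 ≤ p) :
    ∃ ε : ℝ, 0 < ε ∧ ∃ A : ℝ, 0 < A ∧ ∃ X₀ : ℝ,
    ∀ (E K : Type) [Field E] [NumberField E] [Field K] [NumberField K],
      Module.finrank ℚ E ≤ N → Module.finrank ℚ K = p * Module.finrank ℚ E →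
      ∀ Q : ℝ, HasSmallBasis E Q → HasSmallBasis K Q →
      ∀ X : ℕ, X₀ ≤ X → Q ^ A ≤ X → ∀ S : Finset ℕ, (∀ q ∈ S, q.Prime ∧ q ≤ X) →
      (∀ q : ℕ, q.Prime → q ≤ X → q ∉ S → ∀ s : ℂ,
        ∏ P ∈ primesAbove K q, (1 - ((Ideal.absNorm P : ℝ) : ℂ) ^ (-s)) =
          (∏ P ∈ primesAbove E q, (1 - ((Ideal.absNorm P : ℝ) : ℂ) ^ (-s))) ^ p) →
      ε * Real.log X ≤ ∑ q ∈ S, (q : ℝ) ^ (-(15 / 16) : ℝ) := by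
  induction N with
  | zero =>
    refine ⟨1, one_pos, 1, one_pos, 0, ?_⟩
    intro E K _ _ _ _ hE
    have := Module.finrank_pos (R := ℚ) (M := E)
    omega
  | succ N ih =>
    obtain ⟨ε₁, hε₁, A₁, hA₁, X₁, h₁⟩ := ih
    obtain ⟨ε₂, hε₂, A₂, hA₂, X₂, h₂⟩ := exists_mul_log_le_sum (N + 1) p (by omega) hp
    refine ⟨min ε₁ ε₂, lt_min hε₁ hε₂, max A₁ A₂, lt_max_of_lt_left hA₁, max X₁ X₂, ?_⟩
    intro E K _ _ _ _ hE hK Q hQE hQK X hX hQX S hS hSp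
    have hQ1 := hQE.one_le
    have hlog : 0 ≤ Real.log X := Real.log_natCast_nonneg X
    rcases Nat.lt_or_ge (Module.finrank ℚ E) (N + 1) with hlt | hge
    · refine le_trans ?_ (h₁ E K (by omega) hK Q hQE hQK X ((le_max_left _ _).trans hX)
        (le_trans ?_ hQX) S hS hSp)
      · exact mul_le_mul_of_nonneg_right (min_le_left _ _) hlog
      · exact Real.rpow_le_rpow_of_exponent_le hQ1 (le_max_left _ _)
    · have hEN : Module.finrank ℚ E = N + 1 := le_antisymm hE hge
      refine le_trans (le_trans ?_ (h₂ E K hEN (by rw [hK, hEN]) Q hQE hQK X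
        ((le_max_right _ _).trans hX) (le_trans ?_ hQX) S hS hSp)) ?_
      · exact mul_le_mul_of_nonneg_right (min_le_right _ _) hlog
      · exact Real.rpow_le_rpow_of_exponent_le hQ1 (le_max_right _ _)
      · refine Finset.sum_le_sum fun q hq => ?_
        refine Real.rpow_le_rpow_of_exponent_le (by exact_mod_cast (hS q hq).1.one_le) ?_
        have h1 : (1 : ℝ) ≤ (p * (N + 1) : ℕ) := by
          exact_mod_cast Nat.mul_pos (by omega) (Nat.succ_pos N)
        have : 1 / (16 * (p * (N + 1) : ℕ) : ℝ) ≤ 1 / 16 := by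
          apply one_div_le_one_div_of_le <;> linarith
        linarith

open scoped Classical in
/-- Many integers of size `X` have only prime factors above which the subgroup moves a prime. -/
lemma exists_finset_movesPrimesAbove (N p : ℕ) [hp : Fact p.Prime] :
    ∃ A : ℝ, 0 < A ∧ ∀ B : ℝ, ∃ X₀ : ℝ, ∀ (F : Type) [Field F] [NumberField F] [IsGalois ℚ F],
      Module.finrank ℚ F ≤ N → IsPGroup p (F ≃ₐ[ℚ] F) → ¬ IsCyclic (F ≃ₐ[ℚ] F) →
      (∀ n : ℕ, 1 ≤ n → IsEmpty ((F ≃ₐ[ℚ] F) ≃* QuaternionGroup (2 ^ n))) →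
      ∀ H : Subgroup (F ≃ₐ[ℚ] F), H.Normal → H ≠ ⊥ → ∀ Q : ℝ,
      (∀ W : Subgroup (F ≃ₐ[ℚ] F), H ≤ W →
        HasSmallBasis (FixedPoints.intermediateField W : IntermediateField ℚ F) Q) →
      ∀ X : ℕ, X₀ ≤ X → Q ^ A ≤ X → (|discr F| : ℝ) ≤ (X : ℝ) ^ B →
      ∃ T : Finset ℕ, (∀ g ∈ T, g ≠ 0 ∧ g ≤ X ∧ ∀ q ∈ g.primeFactors, MovesPrimesAbove H q) ∧
        (X : ℝ) ^ (1 / 8 : ℝ) ≤ T.card := by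
  obtain ⟨ε, hε, A, hA, X₁, h₁⟩ := exists_mul_log_le_sum_of_finrank_le N p hp.out.two_le
  refine ⟨A, hA, fun B => ?_⟩
  have hev := ((exists_finset_of_mul_log_le_sum_of_dvd (lt_min hε one_pos) B).and
    (eventually_log_le_sum_primesLE (σ := 15 / 16) (by norm_num) (by norm_num)))
  obtain ⟨X₂, h₂⟩ := Filter.eventually_atTop.1 hev
  refine ⟨max X₁ X₂, ?_⟩
  intro F _ _ _ hN hpG hnc hnq H hHn hbot Q hQ X hX hQX hD
  have hX2 : X₂ ≤ X := by exact_mod_cast (le_max_right _ _).trans hX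
  obtain ⟨hcomb, hprimes⟩ := h₂ X hX2
  have hlog : 0 ≤ Real.log X := Real.log_natCast_nonneg X
  have hD0 : discr F ≠ 0 := discr_ne_zero F
  set S : Finset ℕ := (Nat.primesLE X).filter
    (fun q : ℕ => MovesPrimesAbove H q ∨ (q : ℤ) ∣ discr F) with hS
  have hSp : ∀ q ∈ S, q.Prime ∧ q ≤ X := by
    intro q hq
    have := (Finset.mem_filter.1 hq).1
    rw [Nat.mem_primesLE] at this
    exact this.symm
  have key : min ε 1 * Real.log X ≤ ∑ q ∈ S, (q : ℝ) ^ (-(15 / 16) : ℝ) := by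
    by_cases hcyc : IsCyclic H
    · obtain ⟨W, hHW, hcard, hW⟩ := hpG.exists_not_isCyclic_le hnc hnq H hcyc hbot
      refine (mul_le_mul_of_nonneg_right (min_le_left _ _) hlog).trans ?_
      have hE : Module.finrank ℚ (FixedPoints.intermediateField W : IntermediateField ℚ F) *
          Nat.card W = Module.finrank ℚ F := by
        rw [← IsGaloisGroup.finrank_fixedPoints_eq_card_subgroup (G := F ≃ₐ[ℚ] F) (K := ℚ)
          (L := F) (H := W)]
        exact Module.finrank_mul_finrank _ _ _
      have hK : Module.finrank ℚ (FixedPoints.intermediateField H : IntermediateField ℚ F) *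
          Nat.card H = Module.finrank ℚ F := by
        rw [← IsGaloisGroup.finrank_fixedPoints_eq_card_subgroup (G := F ≃ₐ[ℚ] F) (K := ℚ)
          (L := F) (H := H)]
        exact Module.finrank_mul_finrank _ _ _
      have hHpos : 0 < Nat.card H := Nat.card_pos
      have hWpos : 0 < Nat.card W := Nat.card_pos
      refine h₁ (FixedPoints.intermediateField W : IntermediateField ℚ F)
        (FixedPoints.intermediateField H : IntermediateField ℚ F) ?_ ?_ Q (hQ W hHW)
        (hQ H le_rfl) X ((le_max_left _ _).trans hX) hQX S hSp ?_
      · exact (Nat.le_mul_of_pos_right _ hWpos).trans (hE.le.trans hN)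
      · apply Nat.eq_of_mul_eq_mul_right hHpos
        rw [hK, ← hE, hcard]; ring
      · intro q hq hqX hqS s
        have hq' : q ∈ Nat.primesLE X := Nat.mem_primesLE.2 ⟨hqX, hq⟩
        have hnot : ¬ (MovesPrimesAbove H q ∨ (q : ℤ) ∣ discr F) := fun h =>
          hqS (Finset.mem_filter.2 ⟨hq', h⟩)
        push Not at hnot
        exact prod_primesAbove_eq_of_not_moves hp.out hHW hcard hW hq hnot.2 hnot.1 s
    · have hSe : S = Nat.primesLE X := by
        refine Finset.filter_true_of_mem fun q hq => ?_
        by_cases hd : (q : ℤ) ∣ discr F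
        · exact Or.inr hd
        · exact Or.inl (movesPrimesAbove_of_not_isCyclic hcyc (Nat.mem_primesLE.1 hq).2 hd)
      rw [hSe]
      refine (mul_le_mul_of_nonneg_right (min_le_right _ _) hlog).trans ?_
      rw [one_mul]
      exact hprimes
  obtain ⟨T, hT, hcard⟩ := hcomb S (S.filter fun q : ℕ => MovesPrimesAbove H q) (discr F).natAbs
    (Int.natAbs_ne_zero.2 hD0) (by rw [Nat.cast_natAbs, Int.cast_abs]; exact hD) hSp
    (Finset.filter_subset _ _)
    (fun q hq hq' => by
      have h := (Finset.mem_filter.1 hq).2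
      have : ¬ MovesPrimesAbove H q := fun hm => hq' (Finset.mem_filter.2 ⟨hq, hm⟩)
      exact Int.natCast_dvd.1 (h.resolve_left this)) key
  exact ⟨T, fun g hg => ⟨(hT g hg).1, (hT g hg).2.1,
    fun q hq => (Finset.mem_filter.1 ((hT g hg).2.2 q hq)).2⟩, hcard⟩

section Final

open scoped nonZeroDivisors

/-- The packing inequality with its right-hand side in terms of the discriminant only. -/
lemma exists_ellTorsion_mul_card_le (n : ℕ) (hn : 1 ≤ n) {ε : ℝ} (hε : 0 < ε) :
    ∃ C : ℝ, 0 < C ∧ ∀ (K : Type) [Field K] [NumberField K], Module.finrank ℚ K = n →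
    ∀ {ι : Type} [Fintype ι] {ℓ : ℕ}, 1 ≤ ℓ → ∀ {Y : ℝ}, 1 ≤ Y →
    ∀ g : ι → (Ideal (𝓞 K))⁰, (∀ i, (Ideal.absNorm (g i : Ideal (𝓞 K)) : ℝ) ≤ Y) →
    (∀ i j, ∀ β : 𝓞 K, β ≠ 0 → house (β : K) ≤ (Real.exp 1 * Y ^ 2) ^ ℓ →
      Ideal.span {β} * (g j : Ideal (𝓞 K)) ^ ℓ =
        Ideal.span {(Ideal.absNorm (g j : Ideal (𝓞 K)) : 𝓞 K)} ^ ℓ * (g i : Ideal (𝓞 K)) ^ ℓ →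
      i = j) →
    (ellTorsion K ℓ : ℝ) * Fintype.card ι ≤ C * (|discr K| : ℝ) ^ (1 / 2 + ε) := by
  have hn' : (0 : ℝ) < n := by exact_mod_cast hn
  have hθ : 0 < ε / n := by positivity
  have hZ : 0 ≤ natZeta (1 + ε) := tsum_nonneg fun m => by positivity
  refine ⟨(natZeta (1 + ε) ^ n + 1) * (1 / (ε / n) + 1) ^ n * (2 ^ (n + 1)) ^ (1 + 2 * ε),
    by positivity, ?_⟩
  intro K _ _ hK ι _ ℓ hℓ Y hY g hg hsep
  set D : ℝ := |(discr K : ℝ)| with hDdef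
  have hD : 1 ≤ D := by
    rw [hDdef]
    exact_mod_cast Int.one_le_abs (discr_ne_zero K)
  set L : ℝ := 2 ^ (n + 1) * √D with hL
  have hL1 : 1 ≤ L :=
    one_le_mul_of_one_le_of_one_le (one_le_pow₀ (by norm_num)) (by rwa [Real.one_le_sqrt])
  have hL0 : 0 < L := by linarith
  have hfin := Ideal.finite_setOfPred_absNorm_le₀ (S := 𝓞 K) ⌊L⌋₊
  have hmem : ∀ J : (Ideal (𝓞 K))⁰,
      J ∈ hfin.toFinset ↔ (Ideal.absNorm (J : Ideal (𝓞 K)) : ℝ) ≤ L := by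
    intro J
    rw [Set.Finite.mem_toFinset, Set.mem_ofPred_eq, Nat.le_floor_iff hL0.le]
  have h1 := ellTorsion_mul_card_le hℓ hY g hg hsep (L := L) (by rw [hK, hL]) hfin.toFinset
    (fun J hJ => (hmem J).2 hJ)
  have h2 := card_ideal_le (K := K) (σ := 1 + ε) (by linarith) hL0 hfin.toFinset
    (fun J hJ => (hmem J).1 hJ)
  rw [hK] at h1 h2
  have hlog : Real.log L + 1 ≤ (1 / (ε / n) + 1) * L ^ (ε / n) := by
    have h3 := Real.log_le_rpow_div hL0.le hθ
    have h4 : 1 ≤ L ^ (ε / n) := Real.one_le_rpow hL1 hθ.le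
    calc Real.log L + 1 ≤ L ^ (ε / n) / (ε / n) + L ^ (ε / n) := add_le_add h3 h4
      _ = _ := by ring
  have hlog0 : 0 ≤ Real.log L + 1 := by linarith [Real.log_nonneg hL1]
  have hpow : (L ^ (ε / n)) ^ n = L ^ ε := by
    rw [← Real.rpow_mul_natCast hL0.le, div_mul_cancel₀ _ hn'.ne']
  calc (ellTorsion K ℓ : ℝ) * Fintype.card ι
      ≤ hfin.toFinset.card * (Real.log L + 1) ^ n := h1
    _ ≤ (L ^ (1 + ε) * natZeta (1 + ε) ^ n) * ((1 / (ε / n) + 1) * L ^ (ε / n)) ^ n := by gcongr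
    _ = (natZeta (1 + ε) ^ n) * (1 / (ε / n) + 1) ^ n * (L ^ (1 + ε) * L ^ ε) := by
        rw [mul_pow, hpow]; ring
    _ ≤ (natZeta (1 + ε) ^ n + 1) * (1 / (ε / n) + 1) ^ n * (L ^ (1 + ε) * L ^ ε) := by
        gcongr; linarith
    _ = _ := by
        rw [← Real.rpow_add hL0, hL, show 1 + ε + ε = 1 + 2 * ε by ring,
          Real.mul_rpow (by positivity) (by positivity), Real.sqrt_eq_rpow,
          ← Real.rpow_mul (by positivity), show 1 / 2 * (1 + 2 * ε) = 1 / 2 + ε by ring]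
        ring

end Final

section Final

variable {F : Type} [Field F] [NumberField F]

lemma HasSmallBasis.mono {Q Q' : ℝ} (h : HasSmallBasis F Q) (hQ : Q ≤ Q') : HasSmallBasis F Q' :=
  let ⟨b, hb⟩ := h
  ⟨b, fun i => ⟨(hb i).1, (hb i).2.trans hQ⟩⟩

/-- The integers of small house are fixed by a nontrivial normal subgroup, provided that the
discriminant is large. -/
lemma exists_normal_subgroup_fixing_small [IsGalois ℚ F] (T : ℕ → ℝ) (h1 : ∀ i, 1 ≤ T i)
    (hT : ∀ i, T i ^ 2 ≤ T (i + 1))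
    (hdisc : ∀ i < Module.finrank ℚ F,
      ((Module.finrank ℚ F).factorial * T i ^ Module.finrank ℚ F) ^ 2 < (|discr F| : ℝ)) :
    ∃ i < Module.finrank ℚ F, ∃ H : Subgroup (F ≃ₐ[ℚ] F), H.Normal ∧ H ≠ ⊥ ∧
      (∀ W : Subgroup (F ≃ₐ[ℚ] F), H ≤ W →
        HasSmallBasis (FixedPoints.intermediateField W : IntermediateField ℚ F)
          (Module.finrank ℚ F * T i)) ∧
      ∀ β : 𝓞 F, house (β : F) ≤ T (i + 1) → ∀ σ ∈ H, σ • β = β := by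
  obtain ⟨i, hi, K₀, hK₀, hsmall, hstab⟩ := exists_stable_subfield (F := F) T h1 hT
  refine ⟨i, hi, K₀.fixingSubgroup, ⟨?_⟩, ?_, ?_, ?_⟩
  · intro τ hτ σ
    rw [IntermediateField.mem_fixingSubgroup_iff] at hτ ⊢
    intro x hx
    change σ (τ (σ⁻¹ x)) = x
    rw [hτ _ (hstab σ⁻¹ x hx)]
    exact σ.apply_symm_apply x
  · intro hbot
    have htop : K₀ = ⊤ := by
      rw [← IsGalois.fixedField_fixingSubgroup K₀, hbot, IntermediateField.fixedField_bot]
    subst htop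
    have h2 := (hasSmallBasis_of_smallSpan hK₀).abs_discr_le
    rw [IntermediateField.finrank_top', discr_eq_discr_of_algEquiv _
      (IntermediateField.topEquiv (F := ℚ) (E := F))] at h2
    exact absurd (hdisc i hi) (not_lt.2 h2)
  · intro W hW
    have hWK : FixedPoints.intermediateField W ≤ K₀ := by
      rw [← IsGalois.fixedField_fixingSubgroup K₀]
      exact IntermediateField.fixedField_antitone hW
    refine (hasSmallBasis_fixedPoints hK₀ W hWK).mono ?_
    have hc : Nat.card W ≤ Module.finrank ℚ F := by
      rw [← IsGalois.card_aut_eq_finrank]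
      exact Subgroup.card_le_card_group W
    have := h1 i
    gcongr
  · intro β hβ σ hσ
    have hmem := hsmall β β.isIntegral_coe hβ
    rw [IntermediateField.mem_fixingSubgroup_iff] at hσ
    exact RingOfIntegers.ext (hσ _ hmem)

end Final

section Final

open scoped nonZeroDivisors

/-- In a field of large discriminant there are many ideals of small norm that are separated in the
sense of `ellTorsion_mul_card_le`. -/
lemma exists_many_separated_ideals (n p ℓ : ℕ) [Fact p.Prime] (hn : 1 ≤ n) (hℓ : 1 ≤ ℓ) :
    ∃ δ : ℝ, 0 < δ ∧ ∃ D₀ : ℝ, 0 < D₀ ∧ ∀ (F : Type) [Field F] [NumberField F] [IsGalois ℚ F],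
      Module.finrank ℚ F = n → IsPGroup p (F ≃ₐ[ℚ] F) → ¬ IsCyclic (F ≃ₐ[ℚ] F) →
      (∀ m : ℕ, 1 ≤ m → IsEmpty ((F ≃ₐ[ℚ] F) ≃* QuaternionGroup (2 ^ m))) →
      D₀ ≤ (|discr F| : ℝ) → ∃ (T : Finset ℕ) (Y : ℝ) (g : T → (Ideal (𝓞 F))⁰), 1 ≤ Y ∧
        (∀ i, (Ideal.absNorm (g i : Ideal (𝓞 F)) : ℝ) ≤ Y) ∧
        (∀ i j, ∀ β : 𝓞 F, β ≠ 0 → house (β : F) ≤ (Real.exp 1 * Y ^ 2) ^ ℓ →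
          Ideal.span {β} * (g j : Ideal (𝓞 F)) ^ ℓ =
            Ideal.span {(Ideal.absNorm (g j : Ideal (𝓞 F)) : 𝓞 F)} ^ ℓ *
              (g i : Ideal (𝓞 F)) ^ ℓ → i = j) ∧
        (|discr F| : ℝ) ^ δ ≤ T.card := by
  obtain ⟨A, hA, hAB⟩ := exists_finset_movesPrimesAbove n p
  have hn' : (1 : ℝ) ≤ n := by exact_mod_cast hn
  have hℓ' : (1 : ℝ) ≤ ℓ := by exact_mod_cast hℓ
  set R : ℝ := 2 * n * ℓ * (A + 2) + 2 with hR
  have hR2 : 2 ≤ R := by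
    have : 0 ≤ 2 * n * ℓ * (A + 2) := by positivity
    linarith
  set a : ℝ := 1 / (4 * n * R ^ n) with ha
  have ha0 : 0 < a := by positivity
  obtain ⟨X₀, hX₀⟩ := hAB (1 / a)
  set M : ℝ := max 2 (max ((n : ℝ) ^ A) (max (Real.exp ℓ) X₀)) with hM
  obtain ⟨D₀, hD₀⟩ := Filter.eventually_atTop.1
    (((tendsto_rpow_atTop ha0).eventually_ge_atTop M).and
      (Filter.eventually_gt_atTop ((n.factorial : ℝ) ^ 4)))
  refine ⟨a / 8, by positivity, max D₀ 1, by positivity, ?_⟩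
  intro F _ _ _ hFn hpG hnc hnq hFD
  set D : ℝ := |(discr F : ℝ)| with hDdef
  have hD1 : 1 ≤ D := (le_max_right _ _).trans hFD
  have hDpos : 0 < D := by linarith
  obtain ⟨hDM, hDfac⟩ := hD₀ D ((le_max_left _ _).trans hFD)
  set T : ℕ → ℝ := fun i => D ^ (a * R ^ i) with hTdef
  have hTM : ∀ i, D ^ a ≤ T i := fun i =>
    Real.rpow_le_rpow_of_exponent_le hD1 (le_mul_of_one_le_right ha0.le
      (one_le_pow₀ (by linarith)))
  have hTR : ∀ i, T i ^ R = T (i + 1) := fun i => by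
    simp only [hTdef]
    rw [← Real.rpow_mul hDpos.le, pow_succ, mul_assoc]
  have hT2 : ∀ i, 2 ≤ T i := fun i => (le_max_left _ _).trans (hDM.trans (hTM i))
  have hT1 : ∀ i, 1 ≤ T i := fun i => by linarith [hT2 i]
  obtain ⟨i, -, H, hHn, hbot, hbasis, hfix⟩ := exists_normal_subgroup_fixing_small (F := F) T hT1
    (fun i => by
      rw [← hTR, ← Real.rpow_natCast]
      exact Real.rpow_le_rpow_of_exponent_le (hT1 i) (by exact_mod_cast hR2))
    (fun i hi => by
      rw [hFn] at hi ⊢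
      have h1 : (T i ^ n) ^ 2 ≤ √D := by
        rw [← pow_mul, ← Real.rpow_natCast, ← Real.rpow_mul hDpos.le, Real.sqrt_eq_rpow]
        refine Real.rpow_le_rpow_of_exponent_le hD1 ?_
        have h2 : R ^ i ≤ R ^ n := pow_le_pow_right₀ (by linarith) hi.le
        have h3 : 0 < R ^ n := by positivity
        rw [ha]
        push_cast
        rw [div_mul_eq_mul_div, div_mul_eq_mul_div, div_le_div_iff₀ (by positivity) (by norm_num)]
        nlinarith [mul_le_mul_of_nonneg_left h2 (by linarith : (0 : ℝ) ≤ n)]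
      have h4 : (n.factorial : ℝ) ^ 2 < √D := by
        apply Real.lt_sqrt_of_sq_lt
        rw [← pow_mul]; exact hDfac
      rw [mul_pow]
      calc (n.factorial : ℝ) ^ 2 * (T i ^ n) ^ 2 ≤ (n.factorial : ℝ) ^ 2 * √D := by gcongr
        _ < √D * √D := by
          have : 0 < √D := Real.sqrt_pos.2 hDpos
          gcongr
        _ = D := Real.mul_self_sqrt hDpos.le)
  rw [hFn] at hbasis
  set t : ℝ := T i with ht
  have ht2 : 2 ≤ t := hT2 i
  have ht0 : 0 < t := by linarith
  have hMt : M ≤ t := hDM.trans (hTM i)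
  have hnA : (n : ℝ) ^ A ≤ t := ((le_max_left _ _).trans (le_max_right _ _)).trans hMt
  have hexp : Real.exp ℓ ≤ t :=
    (((le_max_left _ _).trans (le_max_right _ _)).trans (le_max_right _ _)).trans hMt
  have hXt : X₀ ≤ t :=
    (((le_max_right _ _).trans (le_max_right _ _)).trans (le_max_right _ _)).trans hMt
  have htA : 1 ≤ t ^ A := Real.one_le_rpow (by linarith) hA.le
  have htA2 : t ^ (A + 2) = t ^ A * t ^ 2 := by
    rw [Real.rpow_add ht0]; norm_num
  set X : ℕ := ⌊t ^ (A + 2)⌋₊ with hX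
  have hXle : (X : ℝ) ≤ t ^ (A + 2) := Nat.floor_le (by positivity)
  have hXge : t ^ A * t ^ 2 / 2 ≤ X := by
    have h1 : t ^ (A + 2) < X + 1 := Nat.lt_floor_add_one _
    rw [htA2] at h1
    have h2 : 2 ≤ t ^ A * t ^ 2 := by nlinarith
    linarith
  have htX : t ≤ X := by
    refine le_trans ?_ hXge
    nlinarith
  have hX0 : (0 : ℝ) < X := by linarith
  have hX1 : (1 : ℝ) ≤ X := by linarith
  obtain ⟨S, hS, hScard⟩ := hX₀ F hFn.le hpG hnc hnq H hHn hbot (n * t) hbasis X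
    (hXt.trans htX)
    (by
      rw [Real.mul_rpow (by positivity) ht0.le]
      refine le_trans ?_ hXge
      have : (n : ℝ) ^ A ≤ t ^ 2 / 2 := by nlinarith
      nlinarith)
    (by
      calc D = (D ^ a) ^ (1 / a) := by
            rw [← Real.rpow_mul hDpos.le, mul_one_div_cancel ha0.ne', Real.rpow_one]
        _ ≤ (X : ℝ) ^ (1 / a) := by
            have := (hTM i).trans htX
            gcongr)
  obtain ⟨J, hJ, hsep⟩ := exists_separated_ideals H S (fun g hg => ⟨(hS g hg).1, (hS g hg).2.2⟩) hℓ
  refine ⟨S, (X : ℝ) ^ n, fun i => J i, one_le_pow₀ hX1, ?_, ?_, ?_⟩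
  · intro i
    have h1 := hJ i i.2
    rw [hFn] at h1
    exact_mod_cast h1.trans (Nat.pow_le_pow_left (hS i i.2).2.1 n)
  · intro i j β hβ hh heq
    refine Subtype.ext (hsep i i.2 j j.2 β hβ (hfix β (hh.trans ?_)) _ ?_ heq)
    · rw [← hTR, mul_pow, ← Real.exp_nat_mul, mul_one, ← pow_mul, ← pow_mul]
      calc Real.exp ℓ * (X : ℝ) ^ (n * (2 * ℓ)) ≤ t * (t ^ (A + 2)) ^ (n * (2 * ℓ)) := by gcongr
        _ = t ^ (1 + 2 * n * ℓ * (A + 2)) := by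
            rw [Real.rpow_add ht0 1, Real.rpow_one, ← Real.rpow_natCast, ← Real.rpow_mul ht0.le]
            push_cast
            ring_nf
        _ ≤ t ^ R := Real.rpow_le_rpow_of_exponent_le (by linarith) (by linarith)
    · exact fun h0 => nonZeroDivisors.coe_ne_zero (J j) (Ideal.absNorm_eq_zero_iff.1 h0)
  · refine le_trans ?_ hScard
    rw [div_eq_mul_one_div, Real.rpow_mul hDpos.le]
    have := (hTM i).trans htX
    gcongr

end Final

/-- For every prime `p`, integer `ℓ > 1`, and finite non-cyclic,
non-(generalized-)quaternion `p`-group `G`, there is `δ > 0` such that for every `ε > 0` there is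
`C > 0` with `|Cl_F[ℓ]| ≤ C · Disc(F)^(1/2 - δ + ε)` for every Galois number field `F/ℚ` with
`Gal(F/ℚ) ≅ G`. -/
theorem pointwise_ltorsion_bound_pGroup (p : ℕ) (hp : p.Prime) (ℓ : ℕ) (hℓ : 1 < ℓ)
    (G : Type) [Group G] [Finite G] (hpG : IsPGroup p G) (hnc : ¬ IsCyclic G)
    (hnq : ∀ n : ℕ, 1 ≤ n → IsEmpty (G ≃* QuaternionGroup (2 ^ n))) :
    ∃ δ : ℝ, 0 < δ ∧ ∀ ε : ℝ, 0 < ε → ∃ C : ℝ, 0 < C ∧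
      ∀ (F : Type) [Field F] [NumberField F] [IsGalois ℚ F],
        Nonempty ((F ≃ₐ[ℚ] F) ≃* G) →
        (ellTorsion F ℓ : ℝ) ≤ C * (|discr F| : ℝ) ^ ((1 : ℝ) / 2 - δ + ε) := by
  have : Fact p.Prime := ⟨hp⟩
  have hG : 1 ≤ Nat.card G := Nat.card_pos
  obtain ⟨δ, hδ, D₀, hD₀, hsep⟩ := exists_many_separated_ideals (Nat.card G) p ℓ hG hℓ.le
  refine ⟨δ, hδ, fun ε hε => ?_⟩
  obtain ⟨C, hC, hbound⟩ := exists_ellTorsion_mul_card_le (Nat.card G) hG hε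
  refine ⟨C * max (D₀ ^ δ) 1, by positivity, ?_⟩
  intro F _ _ _ ⟨e⟩
  have hFn : Module.finrank ℚ F = Nat.card G := by
    rw [← IsGalois.card_aut_eq_finrank]
    exact Nat.card_congr e.toEquiv
  set D : ℝ := |(discr F : ℝ)| with hDdef
  have hD1 : 1 ≤ D := by
    rw [hDdef]
    exact_mod_cast Int.one_le_abs (discr_ne_zero F)
  have hDpos : 0 < D := by linarith
  have hDδ : 0 < D ^ δ := by positivity
  rw [show (1 : ℝ) / 2 - δ + ε = (1 / 2 + ε) - δ by ring, Real.rpow_sub hDpos, mul_div_assoc',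
    le_div_iff₀ hDδ]
  rcases le_or_gt D₀ D with hle | hlt
  · obtain ⟨T, Y, g, hY, hg, hgs, hcard⟩ := hsep F hFn (hpG.of_equiv e.symm)
      (fun h => hnc (isCyclic_of_surjective e e.surjective))
      (fun m hm => ⟨fun f => (hnq m hm).false (e.symm.trans f)⟩) hle
    have h1 := hbound F hFn hℓ.le hY g hg hgs
    rw [Fintype.card_coe] at h1
    calc (ellTorsion F ℓ : ℝ) * D ^ δ ≤ ellTorsion F ℓ * T.card := by gcongr
      _ ≤ C * D ^ (1 / 2 + ε) := h1
      _ ≤ C * max (D₀ ^ δ) 1 * D ^ (1 / 2 + ε) := by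
        gcongr
        exact le_mul_of_one_le_right hC.le (le_max_right _ _)
  · have h1 := hbound F hFn (ι := Unit) hℓ.le (Y := 1) le_rfl (fun _ => 1) (by simp)
      (fun _ _ _ _ _ _ => rfl)
    rw [Fintype.card_unit, Nat.cast_one, mul_one] at h1
    calc (ellTorsion F ℓ : ℝ) * D ^ δ ≤ (C * D ^ (1 / 2 + ε)) * max (D₀ ^ δ) 1 := by
          gcongr
          exact le_max_of_le_left (by gcongr)
      _ = _ := by ring
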